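/- Let G be a MAG whose skeleton satisfies the (η,γ)-local path property with η ≤ 3. Then every pair of non-adjacent nodes admits a γ-local-graph separator of size at most η; i.e., L(G,γ) ≤ η. -/

import Mathlib

universe u

/-- A mixed graph with directed, bidirected and undirected edges. -/
structure MixedGraph (V : Type u) where
  dir : V → V → Prop
  bidir : V → V → Prop
  undir : V → V → Prop
  bidir_symm : ∀ a b, bidir a b → bidir b a
  undir_symm : ∀ a b, undir a b → undir b a

namespace MixedGraph

variable {V : Type u} (G : MixedGraph V)

/-- Adjacency in a mixed graph. -/
def Adj (a b : V) : Prop :=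
  G.dir a b ∨ G.dir b a ∨ G.bidir a b ∨ G.undir a b

/-- The edge between `a` and `b` has an arrowhead at `b`. -/
def ArrowInto (a b : V) : Prop := G.dir a b ∨ G.bidir a b

/-- `b` is a descendant of `a` (equivalently `a` is an ancestor of `b`),
allowing trivial directed paths. -/
def Anc (a b : V) : Prop := Relation.ReflTransGen G.dir a b

/-- `b` is a collider on the consecutive triple `(a, b, c)`. -/
def Collider (a b c : V) : Prop := G.ArrowInto a b ∧ G.ArrowInto c b

/-- `π` is a path from `i` to `j`: a list of distinct vertices with consecutive
vertices adjacent, starting at `i` and ending at `j`. -/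
def IsPathBetween (i j : V) (π : List V) : Prop :=
  π.Nodup ∧ π.Chain' G.Adj ∧ π.head? = some i ∧ π.getLast? = some j

/-- A set `S` blocks a path `π`: some non-collider of `π` is in `S`, or some
collider of `π` has no descendant (including itself) in `S`. -/
def Blocks (S : Set V) (π : List V) : Prop :=
  ∃ a b c, [a, b, c] <:+: π ∧
    ((¬ G.Collider a b c ∧ b ∈ S) ∨
     (G.Collider a b c ∧ ∀ d, G.Anc b d → d ∉ S))

/-- `S` m-separates `i` and `j`: every path between them is blocked by `S`. -/
def MSep (i j : V) (S : Set V) : Prop :=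
  ∀ π, G.IsPathBetween i j π → G.Blocks S π

/-- Ancestral graph: no directed cycles, no almost directed cycles, and no
arrowhead at an endpoint of an undirected edge. -/
def IsAncestral : Prop :=
  (∀ a b, G.dir a b → ¬ G.Anc b a) ∧
  (∀ a b, G.bidir a b → ¬ G.Anc a b) ∧
  (∀ a b, G.undir a b → ∀ c, ¬ G.ArrowInto c b)

/-- A maximal ancestral graph (MAG). -/
def IsMAG : Prop :=
  G.IsAncestral ∧
  ∀ i j : V, i ≠ j → ¬ G.Adj i j →
    ∃ S : Set V, S ⊆ {v | v ≠ i ∧ v ≠ j} ∧ G.MSep i j S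

/-- Induced subgraph on a vertex set `A` (keeping the ambient vertex type). -/
def induce (A : Set V) : MixedGraph V where
  dir a b := a ∈ A ∧ b ∈ A ∧ G.dir a b
  bidir a b := a ∈ A ∧ b ∈ A ∧ G.bidir a b
  undir a b := a ∈ A ∧ b ∈ A ∧ G.undir a b
  bidir_symm := fun a b ⟨ha, hb, h⟩ => ⟨hb, ha, G.bidir_symm _ _ h⟩
  undir_symm := fun a b ⟨ha, hb, h⟩ => ⟨hb, ha, G.undir_symm _ _ h⟩

/-- `V_γ(i,j)`: vertices lying on some path between `i` and `j` of length
(number of edges) at most `γ`. -/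
def Vγ (γ : ℕ) (i j : V) : Set V :=
  {v | ∃ π, G.IsPathBetween i j π ∧ π.length ≤ γ + 1 ∧ v ∈ π}

/-- The γ-local graph `G_γ(i,j)`: the subgraph induced by `V_γ(i,j)`. -/
def localGraph (γ : ℕ) (i j : V) : MixedGraph V :=
  G.induce (G.Vγ γ i j)

/-- A γ-local-graph separator of `(i,j)`: a subset of `V_γ(i,j) \ {i,j}`
m-separating `i` and `j` in the γ-local graph. -/
def IsLocalSep (γ : ℕ) (i j : V) (S : Set V) : Prop :=
  S ⊆ G.Vγ γ i j \ {i, j} ∧ (G.localGraph γ i j).MSep i j S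

/-- The (η,γ)-local path property: between any two non-adjacent nodes there
are at most η paths of length at most γ. -/
def LocalPathProp (η γ : ℕ) : Prop :=
  ∀ i j : V, i ≠ j → ¬ G.Adj i j →
    {π : List V | G.IsPathBetween i j π ∧ π.length ≤ γ + 1}.ncard ≤ η

/-- The parents of a vertex. -/
def pa (v : V) : Set V := {u | G.dir u v}

/-- All non-endpoint vertices of `π` are colliders on `π`. -/
def ColliderPathList (π : List V) : Prop :=
  ∀ a b c, [a, b, c] <:+: π → G.Collider a b c

end MixedGraph

/-- The mixed graph of a directed graph. -/
def MixedGraph.ofDir {V : Type u} (E : V → V → Prop) : MixedGraph V where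
  dir := E
  bidir _ _ := False
  undir _ _ := False
  bidir_symm := fun _ _ h => h.elim
  undir_symm := fun _ _ h => h.elim

/-- A directed graph is acyclic. -/
def Acyclic {V : Type u} (E : V → V → Prop) : Prop :=
  ∀ v, ¬ Relation.TransGen E v v

namespace ShortPath
variable {V : Type u}

/-- `l` is an `R`-path from `a` to `b` with at most `n` edges. -/
def SP (R : V → V → Prop) (n : ℕ) (a b : V) (l : List V) : Prop :=
  l.Nodup ∧ l.IsChain R ∧ l.head? = some a ∧ l.getLast? = some b ∧ l.length ≤ n + 1

/-- The list of edges traversed by a list of vertices. -/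
def es : List V → List (Sym2 V)
  | a :: b :: l => s(a, b) :: es (b :: l)
  | _ => []

@[simp] theorem es_nil : es ([] : List V) = [] := rfl
@[simp] theorem es_singleton (a : V) : es [a] = [] := rfl
@[simp] theorem es_cons_cons (a b : V) (l : List V) : es (a :: b :: l) = s(a, b) :: es (b :: l) := rfl

theorem es_append_cons (A : List V) (a : V) (B : List V) :
    es (A ++ a :: B) = es (A ++ [a]) ++ es (a :: B) := by
  induction A with
  | nil => simp
  | cons x A ih =>
    cases A with
    | nil => simp
    | cons y A => simpa using ih

theorem es_append {L M : List V} {p m : V} (hL : L.getLast? = some p) (hM : M.head? = some m) :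
    es (L ++ M) = es L ++ s(p, m) :: es M := by
  obtain ⟨L, rfl⟩ : ∃ L', L = L' ++ [p] := List.getLast?_eq_some_iff.1 hL
  obtain ⟨M, rfl⟩ : ∃ M', M = m :: M' := List.head?_eq_some_iff.1 hM
  rw [List.append_assoc, List.singleton_append, es_append_cons]; simp

theorem mem_of_mem_es {l : List V} {e : Sym2 V} {x : V} (he : e ∈ es l) (hx : x ∈ e) : x ∈ l := by
  induction l with
  | nil => simp at he
  | cons a l ih =>
    cases l with
    | nil => simp at he
    | cons b l =>
      rw [es_cons_cons, List.mem_cons] at he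
      rcases he with rfl | he
      · simp at hx; rcases hx with rfl | rfl <;> simp
      · exact List.mem_cons_of_mem _ (ih he)

theorem mem_left_of_mem_es {l : List V} {a b : V} (he : s(a, b) ∈ es l) : a ∈ l :=
  mem_of_mem_es he (by simp)

theorem mem_right_of_mem_es {l : List V} {a b : V} (he : s(a, b) ∈ es l) : b ∈ l :=
  mem_of_mem_es he (by simp)

theorem mem_es_iff {l : List V} {a b : V} : s(a, b) ∈ es l ↔
    ∃ A B, l = A ++ a :: b :: B ∨ l = A ++ b :: a :: B := by
  constructor
  · intro h
    induction l with
    | nil => simp at h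
    | cons x l ih =>
      cases l with
      | nil => simp at h
      | cons y l =>
        rw [es_cons_cons, List.mem_cons] at h
        rcases h with h | h
        · rw [Sym2.eq_iff] at h
          rcases h with ⟨rfl, rfl⟩ | ⟨rfl, rfl⟩
          · exact ⟨[], l, Or.inl rfl⟩
          · exact ⟨[], l, Or.inr rfl⟩
        · obtain ⟨A, B, h⟩ := ih h
          exact ⟨x :: A, B, by rcases h with h | h <;> simp [h]⟩
  · rintro ⟨A, B, rfl | rfl⟩
    · rw [es_append_cons]; simp
    · rw [es_append_cons]; simp [Sym2.eq_swap]

theorem es_nodup {l : List V} (h : l.Nodup) : (es l).Nodup := by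
  induction l with
  | nil => simp
  | cons a l ih =>
    cases l with
    | nil => simp
    | cons b l =>
      rw [es_cons_cons, List.nodup_cons]
      rw [List.nodup_cons] at h
      exact ⟨fun he => h.1 (mem_left_of_mem_es he), ih h.2⟩

theorem length_es (l : List V) : (es l).length = l.length - 1 := by
  induction l with
  | nil => simp
  | cons a l ih => cases l with
    | nil => simp
    | cons b l => simp [ih]

theorem mem_es_reverse {l : List V} {e : Sym2 V} : e ∈ es l.reverse ↔ e ∈ es l := by
  induction e with
  | _ a b =>
    have key : ∀ l : List V, s(a, b) ∈ es l → s(a, b) ∈ es l.reverse := by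
      intro l h
      rw [mem_es_iff] at h ⊢
      obtain ⟨A, B, h | h⟩ := h
      · exact ⟨B.reverse, A.reverse, Or.inr (by simp [h])⟩
      · exact ⟨B.reverse, A.reverse, Or.inl (by simp [h])⟩
    exact ⟨fun h => by simpa using key _ h, key l⟩

theorem chain_reverse {R : V → V → Prop} (hR : ∀ a b, R a b → R b a) {l : List V}
    (h : l.IsChain R) : l.reverse.IsChain R := by
  rw [List.isChain_reverse]
  exact h.imp fun a b hab => hR _ _ hab

theorem SP.reverse {R : V → V → Prop} (hR : ∀ a b, R a b → R b a) {n : ℕ} {a b : V} {l : List V}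
    (h : SP R n a b l) : SP R n b a l.reverse := by
  obtain ⟨h1, h2, h3, h4, h5⟩ := h
  exact ⟨by simpa using h1, chain_reverse hR h2, by simpa using h4, by simpa using h3,
    by simpa using h5⟩

theorem chain_splice {R : V → V → Prop} {A W Z B : List V} {u v : V}
    (h : (A ++ u :: W ++ v :: B).IsChain R) (hZ : (u :: Z ++ [v]).IsChain R) :
    (A ++ u :: Z ++ v :: B).IsChain R := by
  have h1 : (A ++ [u]).IsChain R :=
    h.infix ⟨[], W ++ v :: B, by simp⟩
  have h2 : (v :: B).IsChain R := h.infix ⟨A ++ u :: W, [], by simp⟩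
  have : ((A ++ u :: Z) ++ v :: B).IsChain R := by
    rw [List.isChain_split]
    refine ⟨?_, h2⟩
    have : (A ++ u :: (Z ++ [v])).IsChain R := by
      rw [List.isChain_split]
      exact ⟨h1, by simpa using hZ⟩
    simpa using this
  simpa using this

theorem getLast?_app (X : List V) (v : V) (B : List V) :
    (X ++ v :: B).getLast? = (v :: B).getLast? := by
  rw [List.getLast?_append]; simp [List.getLast?_cons]

theorem es_three (A W B : List V) (u v : V) :
    es (A ++ u :: W ++ v :: B) = es (A ++ [u]) ++ es (u :: W ++ [v]) ++ es (v :: B) := by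
  rw [List.append_assoc, List.cons_append, es_append_cons, ← List.cons_append,
    es_append_cons (u :: W), List.append_assoc]

/-- Replacing a segment of a path by a segment that is disjoint from the path. -/
theorem SP.splice {R : V → V → Prop} {n : ℕ} {a b u v : V} {A W Z B : List V}
    (h : SP R n a b (A ++ u :: W ++ v :: B)) (hZ : (u :: Z ++ [v]).IsChain R) (hZn : Z.Nodup)
    (hd : ∀ x ∈ Z, x ∉ A ++ u :: W ++ v :: B) (hlen : Z.length ≤ W.length) :
    SP R n a b (A ++ u :: Z ++ v :: B) := by
  obtain ⟨h1, h2, h3, h4, h5⟩ := h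
  refine ⟨?_, chain_splice h2 hZ, ?_, ?_, ?_⟩
  · clear h2 h3 h4 h5 hZ hlen
    grind
  · cases A <;> simpa using h3
  · have e1 : (A ++ u :: W ++ v :: B).getLast? = (v :: B).getLast? := getLast?_app _ _ _
    have e2 : (A ++ u :: Z ++ v :: B).getLast? = (v :: B).getLast? := getLast?_app _ _ _
    rw [e2, ← e1, h4]
  · simp at h5 ⊢; omega

theorem mem_es_splice {A W Z B : List V} {u v : V} (h : (A ++ u :: W ++ v :: B).Nodup)
    (e : Sym2 V) : e ∈ es (A ++ u :: Z ++ v :: B) ↔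
      (e ∈ es (A ++ u :: W ++ v :: B) ∧ e ∉ es (u :: W ++ [v])) ∨ e ∈ es (u :: Z ++ [v]) := by
  have hn := es_nodup h
  rw [es_three] at hn
  rw [es_three, es_three A W B]
  grind
end ShortPath

namespace ShortPath
variable {V : Type u}

theorem exists_last_split {p : V → Prop} {l : List V} (h : ∃ x ∈ l, p x) :
    ∃ A z B, l = A ++ z :: B ∧ p z ∧ ∀ x ∈ B, ¬ p x := by
  induction l with
  | nil => simp at h
  | cons a l ih =>
    by_cases h' : ∃ x ∈ l, p x
    · obtain ⟨A, z, B, rfl, hz⟩ := ih h'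
      exact ⟨a :: A, z, B, rfl, hz⟩
    · refine ⟨[], a, l, rfl, ?_, fun x hx hp => h' ⟨x, hx, hp⟩⟩
      obtain ⟨x, hx, hp⟩ := h
      rcases List.mem_cons.1 hx with rfl | hx
      · exact hp
      · exact absurd ⟨x, hx, hp⟩ h'

theorem exists_first_split {p : V → Prop} {l : List V} (h : ∃ x ∈ l, p x) :
    ∃ A z B, l = A ++ z :: B ∧ p z ∧ ∀ x ∈ A, ¬ p x := by
  obtain ⟨A, z, B, h1, h2, h3⟩ := exists_last_split (l := l.reverse) (p := p) (by simpa using h)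
  refine ⟨B.reverse, z, A.reverse, ?_, h2, by simpa using h3⟩
  rw [List.reverse_eq_iff] at h1
  simp [h1]

theorem exists_two_split {l : List V} {x y : V} (hx : x ∈ l) (hy : y ∈ l) (hxy : x ≠ y) :
    ∃ A W B, l = A ++ x :: W ++ y :: B ∨ l = A ++ y :: W ++ x :: B := by
  obtain ⟨A, B, rfl⟩ := List.append_of_mem hx
  rw [List.mem_append, List.mem_cons] at hy
  rcases hy with hy | hy | hy
  · obtain ⟨C, D, rfl⟩ := List.append_of_mem hy
    exact ⟨C, D, B, Or.inr (by simp)⟩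
  · exact absurd hy.symm hxy
  · obtain ⟨C, D, rfl⟩ := List.append_of_mem hy
    exact ⟨A, C, D, Or.inl (by simp)⟩

theorem exists_excursion {p m : V → Prop} {l : List V} {a : V} (ha : l.head? = some a) (hpa : p a)
    (hma : ¬ m a) (h : ∃ x ∈ l, m x) :
    ∃ X s T t Y, l = X ++ s :: T ++ t :: Y ∧ p s ∧ ¬ m s ∧ m t ∧ ∀ x ∈ T, ¬ p x := by
  obtain ⟨A, t, B, rfl, ht, hA⟩ := exists_first_split h
  have : a ∈ A := by
    cases A with
    | nil => simp at ha; exact absurd (ha ▸ ht) hma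
    | cons b A => simp at ha; simp [ha]
  obtain ⟨X, s, T, rfl, hs, hT⟩ := exists_last_split ⟨a, this, hpa⟩
  exact ⟨X, s, T, t, B, rfl, hs, hA s (by simp), ht, hT⟩

theorem length_le_of_not_mem_right {A B A' B' : List V} {z s : V}
    (h : A ++ z :: B = A' ++ s :: B') (hs : s ∉ B) : B.length ≤ B'.length := by
  rw [List.append_eq_append_iff] at h
  rcases h with ⟨C, h1, h2⟩ | ⟨C, h1, h2⟩
  · cases C with
    | nil => simp at h2; simp [h2.2]
    | cons c C => simp at h2; simp [h2.2] at hs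
  · cases C with
    | nil => simp at h2; simp [h2.2]
    | cons c C => simp at h2; simp [h2.2]; omega

theorem length_le_of_not_mem_left {A B A' B' : List V} {z s : V}
    (h : A ++ z :: B = A' ++ s :: B') (hs : s ∉ A) : A.length ≤ A'.length := by
  rw [List.append_eq_append_iff] at h
  rcases h with ⟨C, h1, h2⟩ | ⟨C, h1, h2⟩
  · simp [h1]
  · cases C with
    | nil => simp at h1; simp [h1]
    | cons c C => simp at h2; simp [h1, ← h2.1] at hs

theorem mem_es_of_infix_of {L M N : List V} {e : Sym2 V} (h : e ∈ es M) : e ∈ es (L ++ M ++ N) := by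
  induction e with
  | _ a b =>
    rw [mem_es_iff] at h ⊢
    obtain ⟨A, B, rfl | rfl⟩ := h
    · exact ⟨L ++ A, B ++ N, Or.inl (by simp)⟩
    · exact ⟨L ++ A, B ++ N, Or.inr (by simp)⟩

theorem mem_es_seg {A W B l : List V} {u v : V} {e : Sym2 V} (hl : l = A ++ u :: W ++ v :: B)
    (h : e ∈ es (u :: W ++ [v])) : e ∈ es l := by
  rw [hl, es_three]; exact List.mem_append_left _ (List.mem_append_right _ h)

theorem SP.chain_seg {R : V → V → Prop} {A W B l : List V} {u v : V}
    (h : l.IsChain R) (hl : l = A ++ u :: W ++ v :: B) : (u :: W ++ [v]).IsChain R :=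
  h.infix ⟨A, B, by simp [hl]⟩

theorem SP.nodup_seg {A W B l : List V} {u v : V}
    (h : l.Nodup) (hl : l = A ++ u :: W ++ v :: B) : (u :: W ++ [v]).Nodup :=
  List.Nodup.sublist (List.IsInfix.sublist ⟨A, B, by simp [hl]⟩) h

theorem reverse_seg (u v : V) (W : List V) : v :: W.reverse ++ [u] = (u :: W ++ [v]).reverse := by
  simp

theorem SP.swap {R : V → V → Prop} (hR : ∀ a b, R a b → R b a) {n : ℕ} {a b u v : V} {P : List V}
    (hP : SP R n a b P) (hu : u ∈ P) (hv : v ∈ P) (huv : u ≠ v) :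
    ∃ W : List V, (u :: W ++ [v]).IsChain R ∧ (u :: W ++ [v]).Nodup ∧ (∀ x ∈ W, x ∈ P) ∧
      (∀ e ∈ es (u :: W ++ [v]), e ∈ es P) ∧
      ∀ Z : List V, Z.Nodup → (u :: Z ++ [v]).IsChain R → (∀ x ∈ Z, x ∉ P) →
        Z.length ≤ W.length → ∃ T, SP R n a b T ∧
          ∀ e, e ∈ es T ↔ (e ∈ es P ∧ e ∉ es (u :: W ++ [v])) ∨ e ∈ es (u :: Z ++ [v]) := by
  obtain ⟨A, W, B, h | h⟩ := exists_two_split hu hv huv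
  · subst h
    refine ⟨W, SP.chain_seg hP.2.1 rfl, SP.nodup_seg hP.1 rfl, by simp +contextual,
      fun e he => mem_es_seg rfl he, fun Z hZ1 hZ2 hZ3 hZ4 => ?_⟩
    exact ⟨_, hP.splice hZ2 hZ1 hZ3 hZ4, fun e => mem_es_splice hP.1 e⟩
  · subst h
    refine ⟨W.reverse, ?_, ?_, by simp +contextual, ?_, fun Z hZ1 hZ2 hZ3 hZ4 => ?_⟩
    · rw [reverse_seg]; exact chain_reverse hR (SP.chain_seg hP.2.1 rfl)
    · rw [reverse_seg, List.nodup_reverse]; exact SP.nodup_seg hP.1 rfl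
    · intro e he
      rw [reverse_seg, mem_es_reverse] at he
      exact mem_es_seg rfl he
    · refine ⟨_, hP.splice (Z := Z.reverse) ?_ (by simpa using hZ1) (by simpa using hZ3)
        (by simpa using hZ4), fun e => ?_⟩
      · rw [reverse_seg]; exact chain_reverse hR hZ2
      · rw [mem_es_splice hP.1 e, reverse_seg, mem_es_reverse, reverse_seg, mem_es_reverse]

set_option maxHeartbeats 1000000 in
theorem short_of_crossing_half {R : V → V → Prop} (hR : ∀ a b, R a b → R b a) {n : ℕ} {i j p m m' q : V}
    {L M N P : List V} (hQ : SP R n i j (L ++ M ++ N)) (hP : SP R n i j P)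
    (hL : L.getLast? = some p) (hM : M.head? = some m) (hM' : M.getLast? = some m')
    (hN : N.head? = some q) (h1 : s(p, m) ∉ es P) (h2 : s(m', q) ∉ es P)
    (none : ∀ T, SP R n i j T → (∀ e ∈ es T, e ∈ es (L ++ M ++ N) ∨ e ∈ es P) →
      (s(p, m) ∈ es T ↔ s(m', q) ∈ es T))
    {L1 L2 M1 M2 M3 M4 R1 R2 : List V} {z y z2 y2 : V}
    (eL : L = L1 ++ z :: L2) (hz : z ∈ P) (hL2 : ∀ x ∈ L2, x ∉ P)
    (eM : M = M1 ++ y :: M2) (hy : y ∈ P) (hM1 : ∀ x ∈ M1, x ∉ P)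
    (eM' : M = M3 ++ z2 :: M4) (hM4 : ∀ x ∈ M4, x ∉ P)
    (eN : N = R1 ++ y2 :: R2) (hR1 : ∀ x ∈ R1, x ∉ P) :
    M4.length + R1.length < L2.length + M1.length := by
  obtain ⟨hn1, hn2, hn3⟩ : (∀ x ∈ L, x ∉ M) ∧ (∀ x ∈ L, x ∉ N) ∧ (∀ x ∈ M, x ∉ N) := by
    have := hQ.1
    simp only [List.nodup_append, List.mem_append] at this
    exact ⟨fun x hx h => this.1.2.2 x hx x h rfl, fun x hx h => this.2.2 x (Or.inl hx) x h rfl,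
      fun x hx h => this.2.2 x (Or.inr hx) x h rfl⟩
  have hpL : p ∈ L := List.mem_of_getLast? hL
  have hqN : q ∈ N := List.mem_of_head? hN
  have hmM : m ∈ M := List.mem_of_head? hM
  have hmM' : m' ∈ M := List.mem_of_getLast? hM'
  have hzL : z ∈ L := by simp [eL]
  have hyM : y ∈ M := by simp [eM]
  obtain ⟨W, hW1, hW2, hW3, hW4, hW5⟩ := hP.swap hR hz hy (fun h => hn1 z hzL (h ▸ hyM))
  have e1Q : s(p, m) ∈ es (L ++ M ++ N) := by
    rw [List.append_assoc, es_append hL (m := m) (by rw [List.head?_append, hM]; rfl)]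
    simp
  have e2Q : s(m', q) ∈ es (L ++ M ++ N) := by
    rw [es_append (p := m') (by rw [List.getLast?_append, hM']; rfl) hN]
    simp
  have hWlt : W.length < L2.length + M1.length := by
    by_contra hcon
    have eQ : L ++ M ++ N = L1 ++ z :: (L2 ++ M1) ++ y :: (M2 ++ N) := by simp [eL, eM]
    obtain ⟨T, hT1, hT2⟩ := hW5 (L2 ++ M1) (by
        have := SP.nodup_seg hQ.1 eQ
        simp only [List.cons_append, List.nodup_cons, List.nodup_append] at this ⊢
        grind) (SP.chain_seg hQ.2.1 eQ) (by
        intro x hx; rcases List.mem_append.1 hx with hx | hx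
        · exact hL2 x hx
        · exact hM1 x hx) (by simp; omega)
    have hN1 := none T hT1 (by
      intro e he
      rcases (hT2 e).1 he with he | he
      · exact Or.inr he.1
      · exact Or.inl (mem_es_seg eQ he))
    have a1 : s(p, m) ∈ es T := by
      rw [hT2]; right
      have : z :: (L2 ++ M1) ++ [y] = (z :: L2) ++ (M1 ++ [y]) := by simp
      rw [this, es_append (p := p) (m := m)]
      · simp
      · rw [← hL, eL, getLast?_app]
      · rw [← hM, eM]; cases M1 <;> simp
    have a2 := hN1.1 a1
    rw [hT2] at a2
    rcases a2 with a2 | a2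
    · exact h2 a2.1
    · have := mem_right_of_mem_es a2
      have : q ∈ L ∨ q ∈ M := by
        rw [eL, eM]; simp at this ⊢; tauto
      rcases this with h | h
      · exact hn2 _ h hqN
      · exact hn3 _ h hqN
  obtain ⟨X, s, T, t, Y, hl, hs, hsM, ht, hT⟩ := exists_excursion (p := fun x => x ∈ L ++ M ++ N)
    (m := fun x => x ∈ M) (l := z :: W ++ [y]) (a := z) (by simp) (by simp [hzL]) (hn1 z hzL)
    ⟨y, by simp, hyM⟩
  have hTW : T.length ≤ W.length := by
    have := congrArg List.length hl
    simp at this; omega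
  have hTc := SP.chain_seg hW1 hl
  have hTn := SP.nodup_seg hW2 hl
  have hTn' : T.Nodup := by
    simp only [List.cons_append, List.nodup_cons, List.nodup_append] at hTn; exact hTn.2.1
  have hTe : ∀ e ∈ es (s :: T ++ [t]), e ∈ es P := fun e he => hW4 e (mem_es_seg hl he)
  have hlP : ∀ x ∈ z :: W ++ [y], x ∈ P := by
    intro x hx; simp at hx
    rcases hx with rfl | hx | rfl
    exacts [hz, hW3 _ hx, hy]
  have hsP : s ∈ P := hlP s (by rw [hl]; simp)
  have htP : t ∈ P := hlP t (by rw [hl]; simp)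
  obtain ⟨M1', M2', eMt⟩ := List.append_of_mem ht
  simp only [List.mem_append] at hs
  rcases hs with (hs | hs) | hs
  · exfalso
    obtain ⟨L1', L2', eLs⟩ := List.append_of_mem hs
    have l1 : L2.length ≤ L2'.length :=
      length_le_of_not_mem_right (eL.symm.trans eLs) (fun h => hL2 s h hsP)
    have l2 : M1.length ≤ M1'.length :=
      length_le_of_not_mem_left (eM.symm.trans eMt) (fun h => hM1 t h htP)
    have eQ : L ++ M ++ N = L1' ++ s :: (L2' ++ M1') ++ t :: (M2' ++ N) := by
      conv_lhs => rw [eLs, eMt]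
      simp
    have hQ' := eQ ▸ hQ
    have hsp := hQ'.splice hTc hTn' (by rw [← eQ]; exact hT) (by simp; omega)
    have hmem := mem_es_splice (Z := T) hQ'.1
    have hN1 := none _ hsp (by
      intro e he
      rcases (hmem e).1 he with he | he
      · exact Or.inl (eQ ▸ he.1)
      · exact Or.inr (hTe e he))
    rw [hmem, hmem, ← eQ] at hN1
    have a2 := hN1.2 (Or.inl ⟨e2Q, fun h => by
      have := mem_right_of_mem_es h
      have : q ∈ L ∨ q ∈ M := by
        rw [eLs, eMt]; simp at this ⊢; tauto
      rcases this with h | h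
      · exact hn2 _ h hqN
      · exact hn3 _ h hqN⟩)
    rcases a2 with a2 | a2
    · refine a2.2 ?_
      have : s :: (L2' ++ M1') ++ [t] = (s :: L2') ++ (M1' ++ [t]) := by simp
      rw [this, es_append (p := p) (m := m)]
      · simp
      · rw [← hL, eLs, getLast?_app]
      · rw [← hM, eMt]; cases M1' <;> simp
    · exact h1 (hTe _ a2)
  · exact absurd hs hsM
  · obtain ⟨R1', R2', eNs⟩ := List.append_of_mem hs
    have l1 : M4.length ≤ M2'.length :=
      length_le_of_not_mem_right (eM'.symm.trans eMt) (fun h => hM4 t h htP)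
    have l2 : R1.length ≤ R1'.length :=
      length_le_of_not_mem_left (eN.symm.trans eNs) (fun h => hR1 s h hsP)
    by_contra hcon
    have eQ : L ++ M ++ N = (L ++ M1') ++ t :: (M2' ++ R1') ++ s :: R2' := by
      conv_lhs => rw [eNs, eMt]
      simp
    have hQ' := eQ ▸ hQ
    have hsp := hQ'.splice (Z := T.reverse) (by rw [reverse_seg]; exact chain_reverse hR hTc)
      (by simpa using hTn') (by rw [← eQ]; simpa using hT) (by simp; omega)
    have hmem := mem_es_splice (Z := T.reverse) hQ'.1
    rw [reverse_seg] at hmem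
    simp only [mem_es_reverse] at hmem
    have hN1 := none _ hsp (by
      intro e he
      rcases (hmem e).1 he with he | he
      · exact Or.inl (eQ ▸ he.1)
      · exact Or.inr (hTe e he))
    rw [hmem, hmem, ← eQ] at hN1
    have a2 := hN1.1 (Or.inl ⟨e1Q, fun h => by
      have := mem_left_of_mem_es h
      have : p ∈ M ∨ p ∈ N := by
        rw [eNs, eMt]; simp at this ⊢; tauto
      rcases this with h | h
      · exact hn1 _ hpL h
      · exact hn2 _ hpL h⟩)
    rcases a2 with a2 | a2
    · refine a2.2 ?_
      have : t :: (M2' ++ R1') ++ [s] = (t :: M2') ++ (R1' ++ [s]) := by simp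
      rw [this, es_append (p := m') (m := q)]
      · simp
      · rw [← hM', eMt, getLast?_app]
      · rw [← hN, eNs]; cases R1' <;> simp
    · exact h2 (hTe _ a2)

/-- If a short path meets the part of another short path between two of its edges but uses
neither of them, then some short path in the union uses exactly one of the two edges. -/
theorem exchange {R : V → V → Prop} (hR : ∀ a b, R a b → R b a) {n : ℕ} {i j p m m' q : V}
    {L M N P : List V} (hQ : SP R n i j (L ++ M ++ N)) (hP : SP R n i j P)
    (hL : L.getLast? = some p) (hM : M.head? = some m) (hM' : M.getLast? = some m')
    (hN : N.head? = some q) (h1 : s(p, m) ∉ es P) (h2 : s(m', q) ∉ es P)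
    (hx : ∃ x ∈ M, x ∈ P) :
    ∃ T, SP R n i j T ∧ (∀ e ∈ es T, e ∈ es (L ++ M ++ N) ∨ e ∈ es P) ∧
      ((s(p, m) ∈ es T ∧ s(m', q) ∉ es T) ∨ (s(p, m) ∉ es T ∧ s(m', q) ∈ es T)) := by
  by_contra hcon
  have none : ∀ T, SP R n i j T → (∀ e ∈ es T, e ∈ es (L ++ M ++ N) ∨ e ∈ es P) →
      (s(p, m) ∈ es T ↔ s(m', q) ∈ es T) := by
    intro T hT1 hT2
    by_contra h
    exact hcon ⟨T, hT1, hT2, by tauto⟩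
  have hiP : i ∈ P := List.mem_of_head? hP.2.2.1
  have hjP : j ∈ P := List.mem_of_getLast? hP.2.2.2.1
  have hiL : i ∈ L := by
    have := hQ.2.2.1
    obtain ⟨L', rfl⟩ := List.getLast?_eq_some_iff.1 hL
    cases L' <;> simp at this <;> simp [this]
  have hjN : j ∈ N := by
    have := hQ.2.2.2.1
    obtain ⟨N', rfl⟩ := List.head?_eq_some_iff.1 hN
    rw [getLast?_app] at this
    exact List.mem_of_getLast? this
  obtain ⟨L1, z, L2, eL, hz, hL2⟩ := exists_last_split (p := fun x => x ∈ P) ⟨i, hiL, hiP⟩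
  obtain ⟨M1, y, M2, eM, hy, hM1⟩ := exists_first_split (p := fun x => x ∈ P) hx
  obtain ⟨M3, z2, M4, eM', hz2, hM4⟩ := exists_last_split (p := fun x => x ∈ P) hx
  obtain ⟨R1, y2, R2, eN, hy2, hR1⟩ := exists_first_split (p := fun x => x ∈ P) ⟨j, hjN, hjP⟩
  have k1 := short_of_crossing_half hR hQ hP hL hM hM' hN h1 h2 none eL hz hL2 eM hy hM1 eM' hM4 eN hR1
  have hrev : N.reverse ++ M.reverse ++ L.reverse = (L ++ M ++ N).reverse := by simp
  have k2 := short_of_crossing_half (L := N.reverse) (M := M.reverse) (N := L.reverse) (P := P.reverse)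
    (i := j) (j := i) (p := q) (m := m') (m' := m) (q := p) hR
    (by rw [hrev]; exact hQ.reverse hR) (hP.reverse hR) (by simpa using hN) (by simpa using hM')
    (by simpa using hM) (by simpa using hL)
    (by rw [mem_es_reverse, Sym2.eq_swap]; exact h2) (by rw [mem_es_reverse, Sym2.eq_swap]; exact h1)
    (by
      intro T hT1 hT2
      have := none T.reverse (hT1.reverse hR) (by
        intro e he
        rw [mem_es_reverse] at he
        have := hT2 e he
        rwa [hrev, mem_es_reverse, mem_es_reverse] at this)
      rw [mem_es_reverse, mem_es_reverse] at this
      rw [Sym2.eq_swap, ← this, Sym2.eq_swap])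
    (L1 := R2.reverse) (z := y2) (L2 := R1.reverse) (M1 := M4.reverse) (y := z2) (M2 := M3.reverse)
    (M3 := M2.reverse) (z2 := y) (M4 := M1.reverse) (R1 := L2.reverse) (y2 := z) (R2 := L1.reverse)
    (by simp [eN]) (by simpa using hy2) (by simpa using hR1) (by simp [eM']) (by simpa using hz2)
    (by simpa using hM4) (by simp [eM]) (by simpa using hM1) (by simp [eL]) (by simpa using hL2)
  simp at k2
  omega
end ShortPath

namespace ShortPath
variable {V : Type u}

theorem walk_to_path {R : V → V → Prop} {n : ℕ} {a b : V} (l : List V) (hc : l.IsChain R)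
    (ha : l.head? = some a) (hb : l.getLast? = some b) (hn : l.length ≤ n + 1) :
    ∃ T, SP R n a b T ∧ ∀ x ∈ T, x ∈ l := by
  induction hk : l.length using Nat.strong_induction_on generalizing l with
  | _ k ih =>
    by_cases hnd : l.Nodup
    · exact ⟨l, ⟨hnd, hc, ha, hb, hn⟩, fun x hx => hx⟩
    · obtain ⟨x, A, B, C, rfl⟩ : ∃ x A B C, l = A ++ x :: B ++ x :: C := by
        clear ih hc ha hb hn hk
        induction l with
        | nil => simp at hnd
        | cons y l ih =>
          by_cases hy : y ∈ l
          · obtain ⟨B, C, rfl⟩ := List.append_of_mem hy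
            exact ⟨y, [], B, C, rfl⟩
          · obtain ⟨x, A, B, C, rfl⟩ := ih (fun h => hnd (List.nodup_cons.2 ⟨hy, h⟩))
            exact ⟨x, y :: A, B, C, rfl⟩
      have hc' : (A ++ x :: C).IsChain R := by
        rw [List.isChain_split]
        exact ⟨hc.infix ⟨[], B ++ x :: C, by simp⟩, hc.infix ⟨A ++ x :: B, [], by simp⟩⟩
      simp at hk hn
      obtain ⟨T, hT1, hT2⟩ := ih (A ++ x :: C).length (by simp; omega) (A ++ x :: C) hc'
        (by cases A <;> simpa using ha) (by rw [getLast?_app] at hb ⊢; exact hb)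
        (by simp; omega) rfl
      exact ⟨T, hT1, fun y hy => by have := hT2 y hy; simp at this ⊢; tauto⟩

theorem SP.exists_mid {R : V → V → Prop} {n : ℕ} {i j : V} {Q : List V} (hij : i ≠ j)
    (hna : ¬ R i j) (h : SP R n i j Q) : ∃ q, q ≠ [] ∧ Q = i :: q ++ [j] := by
  obtain ⟨h1, h2, h3, h4, h5⟩ := h
  obtain ⟨q, rfl⟩ := List.getLast?_eq_some_iff.1 h4
  cases q with
  | nil => simp at h3; exact absurd h3.symm hij
  | cons a q =>
    simp at h3; subst h3
    refine ⟨q, ?_, rfl⟩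
    rintro rfl
    simp at h2; exact hna h2

theorem SP.exists_first {R : V → V → Prop} {n : ℕ} {i j : V} {Q : List V} (hij : i ≠ j)
    (hna : ¬ R i j) (h : SP R n i j Q) : ∃ f r, r ≠ [] ∧ Q = i :: f :: r := by
  obtain ⟨q, hq, rfl⟩ := h.exists_mid hij hna
  cases q with
  | nil => simp at hq
  | cons f q => exact ⟨f, q ++ [j], by simp, rfl⟩

theorem first_edge {i f g : V} {r : List V} (h : (i :: f :: r).Nodup) :
    s(i, g) ∈ es (i :: f :: r) ↔ g = f := by
  rw [es_cons_cons, List.mem_cons]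
  constructor
  · rintro (h' | h')
    · rw [Sym2.eq_iff] at h'
      rcases h' with h' | h'
      · exact h'.2
      · exact h'.2.trans h'.1
    · exact absurd (mem_left_of_mem_es h') (List.nodup_cons.1 h).1
  · rintro rfl; exact Or.inl rfl

theorem last_edge {l g j : V} {r : List V} (h : (r ++ [l, j]).Nodup) :
    s(g, j) ∈ es (r ++ [l, j]) ↔ g = l := by
  have e : j :: l :: r.reverse = (r ++ [l, j]).reverse := by simp
  rw [← mem_es_reverse, Sym2.eq_swap, ← e, first_edge]
  rw [e]; exact List.nodup_reverse.2 h

/-- An edge that lies on no short path. -/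
def Rung (R : V → V → Prop) (n : ℕ) (i j x y : V) : Prop :=
  x ≠ y ∧ R x y ∧ ∀ T, SP R n i j T → s(x, y) ∉ es T

theorem Rung.symm {R : V → V → Prop} (hR : ∀ a b, R a b → R b a) {n : ℕ} {i j x y : V}
    (h : Rung R n i j x y) : Rung R n i j y x :=
  ⟨h.1.symm, hR _ _ h.2.1, fun T hT => by rw [Sym2.eq_swap]; exact h.2.2 T hT⟩

theorem Rung.reverse {R : V → V → Prop} (hR : ∀ a b, R a b → R b a) {n : ℕ} {i j x y : V}
    (h : Rung R n i j x y) : Rung R n j i x y :=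
  ⟨h.1, h.2.1, fun T hT => by rw [← mem_es_reverse]; exact h.2.2 _ (hT.reverse hR)⟩

theorem Rung.not_mem {R : V → V → Prop} (hR : ∀ a b, R a b → R b a) {n : ℕ} {i j x y : V}
    (h : Rung R n i j x y) {P : List V} (hP : SP R n i j P) (hx : x ∈ P) : y ∉ P := by
  intro hy
  obtain ⟨W, -, -, -, -, hW⟩ := hP.swap hR hx hy h.1
  obtain ⟨T, hT1, hT2⟩ := hW [] (by simp) (by simpa using h.2.1) (by simp) (by simp)
  exact h.2.2 T hT1 ((hT2 _).2 (Or.inr (by simp)))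

theorem cross_chain {R : V → V → Prop} {x y : V} {A B A' B' : List V} (hxy : R x y)
    (h : (A ++ x :: B).IsChain R) (h' : (A' ++ y :: B').IsChain R) :
    (A ++ x :: y :: B').IsChain R := by
  rw [List.isChain_split] at h h' ⊢
  exact ⟨h.1, List.isChain_cons_cons.2 ⟨hxy, h'.2⟩⟩

theorem cross_nodup {x y : V} {A B A' B' : List V}
    (h : (A ++ x :: B).Nodup) (h' : (A' ++ y :: B').Nodup)
    (hd : ∀ v ∈ A ++ [x], v ∉ y :: B') : (A ++ x :: y :: B').Nodup := by
  have e : A ++ x :: y :: B' = (A ++ [x]) ++ (y :: B') := by simp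
  rw [e, List.nodup_append]
  refine ⟨?_, ?_, fun a ha b hb hab => hd a ha (hab ▸ hb)⟩
  · exact List.Nodup.sublist (List.IsInfix.sublist ⟨[], B, by simp⟩) h
  · exact List.Nodup.sublist (List.IsInfix.sublist ⟨A', [], by simp⟩) h'

theorem Rung.cross_len {R : V → V → Prop} {n : ℕ} {i j x y : V}
    (h : Rung R n i j x y) {A B A' B' : List V} (hQ : SP R n i j (A ++ x :: B))
    (hQ' : SP R n i j (A' ++ y :: B')) (hd : ∀ v ∈ A ++ [x], v ∉ y :: B') :
    n ≤ A.length + B'.length := by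
  by_contra hcon
  refine h.2.2 (A ++ x :: y :: B') ⟨cross_nodup hQ.1 hQ'.1 hd, cross_chain h.2.1 hQ.2.1 hQ'.2.1,
    ?_, ?_, by simp; omega⟩ (mem_es_iff.2 ⟨A, B', Or.inl rfl⟩)
  · have := hQ.2.2.1; cases A <;> simpa using this
  · have := hQ'.2.2.2.1
    rw [getLast?_app] at this ⊢
    simpa [List.getLast?_cons] using this

theorem Rung.cross_eq {R : V → V → Prop} (hR : ∀ a b, R a b → R b a) {n : ℕ} {i j x y : V}
    (h : Rung R n i j x y) {A B A' B' : List V} (hQ : SP R n i j (A ++ x :: B))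
    (hQ' : SP R n i j (A' ++ y :: B')) (hd : ∀ v ∈ A ++ [x], v ∉ y :: B')
    (hd' : ∀ v ∈ A' ++ [y], v ∉ x :: B) :
    A.length + B.length = n ∧ A'.length + B'.length = n ∧ A.length = A'.length := by
  have h1 := h.cross_len hQ hQ' hd
  have h2 := (h.symm hR).cross_len hQ' hQ hd'
  have h3 := hQ.2.2.2.2
  have h4 := hQ'.2.2.2.2
  simp at h3 h4
  omega

theorem exists_common_prefix_split {l l' : List V} (h1 : ¬ l <+: l') (h2 : ¬ l' <+: l) :
    ∃ A a b B B', a ≠ b ∧ l = A ++ a :: B ∧ l' = A ++ b :: B' := by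
  induction l generalizing l' with
  | nil => simp at h1
  | cons x l ih =>
    cases l' with
    | nil => simp at h2
    | cons y l' =>
      by_cases hxy : x = y
      · subst hxy
        obtain ⟨A, a, b, B, B', h, rfl, rfl⟩ := ih (l' := l')
          (fun h => h1 (by simpa using h)) (fun h => h2 (by simpa using h))
        exact ⟨x :: A, a, b, B, B', h, rfl, rfl⟩
      · exact ⟨[], x, y, l, l', hxy, rfl, rfl⟩

theorem branch_edge {p a b : V} {A B : List V} (h : (A ++ p :: b :: B).Nodup) (hab : a ≠ b)
    (ha : a ∉ A) (hap : a ≠ p) : s(p, a) ∉ es (A ++ p :: b :: B) := by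
  intro he
  rw [es_append_cons, List.mem_append, es_cons_cons, List.mem_cons] at he
  rcases he with he | he | he
  · have := mem_right_of_mem_es he
    simp at this; tauto
  · rw [Sym2.eq_iff] at he
    rcases he with he | he
    · exact hab he.2
    · exact hap he.2
  · have := mem_left_of_mem_es he
    have h2 := (List.nodup_append.1 h).2.1
    exact (List.nodup_cons.1 h2).1 this

theorem mid_split {A A' C C' : List V} {a a' x : V} (h : A ++ a :: C' = A' ++ a' :: C)
    (hx : x ∈ A ++ a :: C') (hxA : x ∉ A) (hxC : x ∉ C) :
    ∃ B, A ++ a :: C' = A ++ B ++ C ∧ x ∈ B ∧ B.head? = some a ∧ B.getLast? = some a' := by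
  have h0 := h
  rw [List.append_eq_append_iff] at h
  rcases h with ⟨D, h1, h2⟩ | ⟨D, h1, h2⟩
  · refine ⟨D ++ [a'], by rw [h0, h1]; simp, ?_, ?_, by simp⟩
    · rw [h0, h1] at hx; simp at hx ⊢; tauto
    · cases D <;> simp at h2 ⊢ <;> simp [h2.1]
  · cases D with
    | nil =>
      simp at h1 h2
      refine ⟨[a], by rw [h2.2]; simp, ?_, by simp, by simp [h2.1]⟩
      rw [← h2.2] at hx; simp at hx ⊢; tauto
    | cons d D =>
      exfalso
      simp at h2
      rw [h2.2] at hxC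
      simp at hx hxC
      tauto

theorem not_prefix_of_SP {R : V → V → Prop} {n : ℕ} {i j : V} {Q Q' : List V}
    (hQ : SP R n i j Q) (hQ' : SP R n i j Q') {x : V} (hx : x ∈ Q) (hx' : x ∉ Q') :
    ¬ Q <+: Q' ∧ ¬ Q' <+: Q := by
  refine ⟨fun h => hx' (h.subset hx), ?_⟩
  rintro ⟨t, rfl⟩
  cases t with
  | nil => simp at hx; exact hx' hx
  | cons a t =>
    have h1 := hQ.2.2.2.1
    rw [getLast?_app] at h1
    have h2 := List.mem_of_getLast? h1
    have h3 := List.mem_of_getLast? hQ'.2.2.2.1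
    exact (List.nodup_append.1 hQ.1).2.2 j h3 j h2 rfl

theorem lens {R : V → V → Prop} (hR : ∀ a b, R a b → R b a) {n : ℕ} {i j x y : V} {Q Q' : List V}
    (hQ : SP R n i j Q) (hQ' : SP R n i j Q') (hx : x ∈ Q) (hx' : x ∉ Q') (hy : y ∈ Q')
    (hy' : y ∉ Q)
    (hexc : ∀ T, SP R n i j T → (∀ e ∈ es T, e ∈ es Q ∨ e ∈ es Q') → T = Q ∨ T = Q') :
    ∃ A B B' C, Q = A ++ B ++ C ∧ Q' = A ++ B' ++ C ∧ x ∈ B ∧ y ∈ B' ∧ (∀ v ∈ B, v ∉ B') ∧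
      B.head? ≠ B'.head? := by
  obtain ⟨p1, p2⟩ := not_prefix_of_SP hQ hQ' hx hx'
  obtain ⟨A, a, b, D, D', hab, e1, e1'⟩ := exists_common_prefix_split p1 p2
  obtain ⟨p3, p4⟩ := not_prefix_of_SP (hQ.reverse hR) (hQ'.reverse hR)
    (by simpa using hx) (by simpa using hx')
  obtain ⟨C, a', b', E, E', hab', e2, e2'⟩ := exists_common_prefix_split p3 p4
  rw [List.reverse_eq_iff] at e2 e2'
  simp at e2 e2'
  have hxA : x ∉ A := fun h => hx' (by rw [e1']; simp [h])
  have hxC : x ∉ C := fun h => hx' (by rw [e2']; simp [h])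
  have hyA : y ∉ A := fun h => hy' (by rw [e1]; simp [h])
  have hyC : y ∉ C := fun h => hy' (by rw [e2]; simp [h])
  obtain ⟨B, eB, hxB, hBh, hBl⟩ := mid_split (x := x) (e1.symm.trans e2) (e1 ▸ hx) hxA (by simpa using hxC)
  obtain ⟨B', eB', hyB, hBh', hBl'⟩ := mid_split (x := y) (e1'.symm.trans e2') (e1' ▸ hy) hyA
    (by simpa using hyC)
  rw [← e1] at eB
  rw [← e1'] at eB'
  refine ⟨A, B, B', C.reverse, eB, eB', hxB, hyB, ?_, by rw [hBh, hBh']; simpa using hab⟩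
  by_contra hcon
  push Not at hcon
  obtain ⟨v, hv, hv'⟩ := hcon
  have hAne : A ≠ [] := by
    rintro rfl
    have h1 := hQ.2.2.1
    have h2 := hQ'.2.2.1
    rw [e1] at h1; rw [e1'] at h2; simp at h1 h2
    exact hab (h1.trans h2.symm)
  have hCne : C ≠ [] := by
    rintro rfl
    have h1 := hQ.2.2.2.1
    have h2 := hQ'.2.2.2.1
    rw [e2] at h1; rw [e2'] at h2; simp at h1 h2
    exact hab' (h1.trans h2.symm)
  obtain ⟨A0, p, rfl⟩ : ∃ A' p, A = A' ++ [p] := ⟨_, _, (List.dropLast_append_getLast hAne).symm⟩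
  obtain ⟨C0, q, rfl⟩ : ∃ A' p, C = A' ++ [p] := ⟨_, _, (List.dropLast_append_getLast hCne).symm⟩
  have f1 : s(p, a) ∉ es Q' := by
    rw [e1', List.append_assoc, List.singleton_append]
    have hn := hQ.1
    rw [e1] at hn
    have hn' := hQ'.1
    rw [e1', List.append_assoc, List.singleton_append] at hn'
    refine branch_edge hn' hab ?_ ?_
    · intro h
      exact (List.nodup_append.1 hn).2.2 a (by simp [h]) a (by simp) rfl
    · intro h
      exact (List.nodup_append.1 hn).2.2 p (by simp) a (by simp) h.symm
  have f2 : s(a', q) ∉ es Q' := by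
    have hn := hQ.1
    rw [e2] at hn
    have e3 : Q'.reverse = C0 ++ q :: b' :: E' := by rw [e2']; simp
    have hn' := hQ'.1
    rw [← List.nodup_reverse, e3] at hn'
    rw [← mem_es_reverse, e3, Sym2.eq_swap]
    have hn2 : ∀ w ∈ C0 ++ [q], a' ≠ w := by
      intro w hw
      have := (List.nodup_append.1 hn).2.1
      rw [List.nodup_cons] at this
      rintro rfl
      exact this.1 (by simp at hw ⊢; tauto)
    exact branch_edge hn' hab' (fun h => hn2 a' (by simp [h]) rfl) (hn2 q (by simp))
  obtain ⟨T, hT1, hT2, hT3⟩ := exchange (L := A0 ++ [p]) (M := B) (N := (C0 ++ [q]).reverse) (P := Q')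
    (p := p) (m := a) (m' := a') (q := q) hR (eB ▸ hQ) hQ' (by simp) hBh hBl (by simp) f1 f2
    ⟨v, hv, by rw [eB']; simp [hv']⟩
  rw [← eB] at hT2
  rcases hexc T hT1 hT2 with rfl | rfl
  · have g1 : s(p, a) ∈ es T := by
      rw [e1, es_append (p := p) (m := a)] <;> simp
    have g2 : s(a', q) ∈ es T := by
      have : T = (E.reverse ++ [a']) ++ (q :: C0.reverse) := by rw [e2]; simp
      rw [this, es_append (p := a') (m := q)] <;> simp
    tauto
  · tauto

end ShortPath

namespace ShortPath
variable {V : Type u}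

/-- Any two distinct non-adjacent vertices are joined by at most `η` short paths. -/
def PathBound (R : V → V → Prop) (n η : ℕ) : Prop :=
  ∀ a b, a ≠ b → ¬ R a b → ∀ ls : List (List V), ls.Nodup → (∀ l ∈ ls, SP R n a b l) →
    ls.length ≤ η

/-- Every short path is one of three given lists. -/
def All3 (R : V → V → Prop) (n : ℕ) (i j : V) (P1 P2 P3 : List V) : Prop :=
  ∀ T, SP R n i j T → T = P1 ∨ T = P2 ∨ T = P3

theorem All3.reverse {R : V → V → Prop} (hR : ∀ a b, R a b → R b a) {n : ℕ} {i j : V}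
    {P1 P2 P3 : List V} (h : All3 R n i j P1 P2 P3) :
    All3 R n j i P1.reverse P2.reverse P3.reverse := by
  intro T hT
  rcases h _ (hT.reverse hR) with h | h | h <;> rw [List.reverse_eq_iff] at h <;> simp [h]

theorem PathBound.false_of_four {R : V → V → Prop} {n : ℕ} (hL : PathBound R n 3) {a b : V}
    (hab : a ≠ b) (hna : ¬ R a b) {p1 p2 p3 p4 : List V} (h1 : SP R n a b p1)
    (h2 : SP R n a b p2) (h3 : SP R n a b p3) (h4 : SP R n a b p4)
    (hd : [p1, p2, p3, p4].Nodup) : False := by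
  have := hL a b hab hna [p1, p2, p3, p4] hd (by
    intro l hl; simp at hl; rcases hl with rfl | rfl | rfl | rfl <;> assumption)
  simp at this

theorem SP.tail {R : V → V → Prop} {n : ℕ} {i j f : V} {r : List V}
    (h : SP R n i j (i :: f :: r)) : SP R n f j (f :: r) := by
  obtain ⟨h1, h2, h3, h4, h5⟩ := h
  refine ⟨(List.nodup_cons.1 h1).2, (List.isChain_cons_cons.1 h2).2, rfl, ?_, by simp at h5 ⊢; omega⟩
  simpa [List.getLast?_cons] using h4

theorem lens_disjoint {P B1 B2 B1' B2' C : List V} {x y : V}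
    (n1 : (P ++ (B1 ++ x :: B2) ++ C).Nodup) (n2 : (P ++ (B1' ++ y :: B2') ++ C).Nodup)
    (hB : ∀ v ∈ B1 ++ x :: B2, v ∉ B1' ++ y :: B2') :
    ∀ v ∈ P ++ B1 ++ [x], v ∉ y :: (B2' ++ C) := by
  rw [List.append_assoc] at n2
  have q1 := (List.nodup_append.1 n2).2.2
  have q2 := (List.nodup_append.1 n1).2.2
  intro v hv hv'
  have h3 := hB v
  simp only [List.mem_append, List.mem_cons, List.not_mem_nil, or_false] at *
  rcases hv with (hv | hv) | hv
  · exact q1 v hv v (by tauto) rfl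
  · rcases hv' with h | h | h
    · exact h3 (by tauto) (by tauto)
    · exact h3 (by tauto) (by tauto)
    · exact q2 v (by tauto) v h rfl
  · rcases hv' with h | h | h
    · exact h3 (by tauto) (by tauto)
    · exact h3 (by tauto) (by tauto)
    · exact q2 v (by tauto) v h rfl

set_option maxHeartbeats 1000000 in
theorem Rung.false_of_same_first {R : V → V → Prop} (hR : ∀ a b, R a b → R b a) {n : ℕ}
    (hn : 2 ≤ n) {i j : V} (hij : i ≠ j) (hna : ¬ R i j) (hL : PathBound R n 3) {x y : V}
    (h : Rung R n i j x y) {P1 P2 r1 r2 : List V} {f : V} (hP1 : SP R n i j P1)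
    (hP2 : SP R n i j P2) (hA : ∀ r, SP R n i j (i :: f :: r) → r = r1 ∨ r = r2)
    (e1 : P1 = i :: f :: r1) (e2 : P2 = i :: f :: r2)
    (hx : x ∈ P1) (hy : y ∈ P2) : False := by
  have hy' := h.not_mem hR hP1 hx
  have hx' := (h.symm hR).not_mem hR hP2 hy
  obtain ⟨A, B, B', C, eA, eA', hxB, hyB, hBB, hBh⟩ := lens hR hP1 hP2 hx hx' hy hy' (by
    intro T hT hTe
    obtain ⟨g, r, -, rfl⟩ := hT.exists_first hij hna
    have hg : g = f := by
      rcases hTe s(i, g) (by simp) with h' | h'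
      · rw [e1, first_edge (e1 ▸ hP1.1)] at h'; exact h'
      · rw [e2, first_edge (e2 ▸ hP2.1)] at h'; exact h'
    subst hg
    rcases hA r hT with rfl | rfl
    · exact Or.inl e1.symm
    · exact Or.inr e2.symm)
  have hBne : B ≠ [] := by rintro rfl; simp at hxB
  have hBne' : B' ≠ [] := by rintro rfl; simp at hyB
  obtain ⟨A0, rfl⟩ : ∃ A0, A = i :: f :: A0 := by
    obtain ⟨b, B, rfl⟩ := List.exists_cons_of_ne_nil hBne
    obtain ⟨b', B', rfl⟩ := List.exists_cons_of_ne_nil hBne'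
    rw [e1] at eA; rw [e2] at eA'
    rcases A with _ | ⟨a, _ | ⟨a', A⟩⟩
    · simp at eA eA' hBh; exact absurd (eA.1.symm.trans eA'.1) hBh
    · simp at eA eA' hBh; exact absurd (eA.2.1.symm.trans eA'.2.1) hBh
    · simp at eA; exact ⟨A, by rw [← eA.1, ← eA.2.1]⟩
  obtain ⟨B1, B2, rfl⟩ := List.append_of_mem hxB
  obtain ⟨B1', B2', rfl⟩ := List.append_of_mem hyB
  have s1 : P1 = (i :: f :: (A0 ++ B1)) ++ x :: (B2 ++ C) := by rw [eA]; simp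
  have s2 : P2 = (i :: f :: (A0 ++ B1')) ++ y :: (B2' ++ C) := by rw [eA']; simp
  have n1 := hP1.1
  have n2 := hP2.1
  rw [eA] at n1
  rw [eA'] at n2
  have d1 : ∀ v ∈ (i :: f :: (A0 ++ B1)) ++ [x], v ∉ y :: (B2' ++ C) :=
    lens_disjoint (P := i :: f :: A0) n1 n2 hBB
  have d2 : ∀ v ∈ (i :: f :: (A0 ++ B1')) ++ [y], v ∉ x :: (B2 ++ C) :=
    lens_disjoint (P := i :: f :: A0) n2 n1 fun v h1 h2 => hBB v h2 h1
  obtain ⟨l1, l2, l3⟩ := h.cross_eq hR (s1 ▸ hP1) (s2 ▸ hP2) d1 d2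
  have nX := cross_nodup (s1 ▸ hP1.1) (s2 ▸ hP2.1) d1
  have nY := cross_nodup (s2 ▸ hP2.1) (s1 ▸ hP1.1) d2
  have cX := cross_chain h.2.1 (s1 ▸ hP1.2.1) (s2 ▸ hP2.2.1)
  have cY := cross_chain (h.symm hR).2.1 (s2 ▸ hP2.2.1) (s1 ▸ hP1.2.1)
  have j1 := hP1.2.2.2.1
  have j2 := hP2.2.2.2.1
  rw [s1, getLast?_app] at j1
  rw [s2, getLast?_app] at j2
  have hfj : f ≠ j := by
    rintro rfl
    have := hP1.1
    have hl := hP1.2.2.2.1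
    rw [e1] at this hl
    cases r1 with
    | nil => rw [e1] at hx hP1; exact hna (List.isChain_cons_cons.1 hP1.2.1).1
    | cons a r1 =>
      have : f ∈ a :: r1 := by
        refine List.mem_of_getLast? (a := f) ?_
        simpa [List.getLast?_cons] using hl
      have h3 := hP1.1
      rw [e1] at h3
      simp at h3 this; tauto
  have hnfj : ¬ R f j := by
    intro hfj'
    have hT : SP R n i j [i, f, j] := by
      refine ⟨?_, ?_, rfl, rfl, by simpa using hn⟩
      · have h3 := hP1.1
        rw [e1] at h3
        simp at h3 ⊢
        exact ⟨⟨h3.1.1, hij⟩, hfj⟩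
      · have h3 := hP1.2.1
        rw [e1] at h3
        simp at h3 ⊢; exact ⟨h3.1, hfj'⟩
    have jC : j ∈ C := by
      have : C ≠ [] := by
        rintro rfl
        simp [List.getLast?_cons] at j1 j2
        have g1 : j ∈ B1 ++ x :: B2 := by
          apply List.mem_of_getLast? (a := j)
          rw [getLast?_app, List.getLast?_cons, j1]
        have g2 : j ∈ B1' ++ y :: B2' := by
          apply List.mem_of_getLast? (a := j)
          rw [getLast?_app, List.getLast?_cons, j2]
        exact hBB _ g1 g2
      obtain ⟨c, C', rfl⟩ := List.exists_cons_of_ne_nil this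
      apply List.mem_of_getLast? (a := j)
      rw [← j1]
      have : x :: (B2 ++ c :: C') = (x :: B2) ++ c :: C' := by simp
      rw [this, getLast?_app]
    rcases hA _ hT with h' | h'
    · have : x ∈ [i, f, j] := by rw [h', ← e1]; exact hx
      simp at this
      have n1' := n1
      simp only [List.nodup_append, List.nodup_cons, List.mem_append, List.mem_cons] at n1'
      grind
    · have : y ∈ [i, f, j] := by rw [h', ← e2]; exact hy
      simp at this
      have n1' := n2
      simp only [List.nodup_append, List.nodup_cons, List.mem_append, List.mem_cons] at n1'
      grind
  have ends : ∀ (D E : List V) (z w : V), (z :: E).getLast? = some j →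
      (D ++ w :: z :: E).getLast? = some j := by
    intro D E z w hz
    rw [getLast?_app, ← hz]; simp [List.getLast?_cons]
  simp only [List.length_cons, List.length_append] at l1 l2 l3
  refine hL.false_of_four hfj hnfj (p1 := f :: r1) (p2 := f :: r2)
    (p3 := f :: (A0 ++ B1) ++ x :: y :: (B2' ++ C)) (p4 := f :: (A0 ++ B1') ++ y :: x :: (B2 ++ C))
    (e1 ▸ hP1).tail (e2 ▸ hP2).tail ⟨nX.tail, (by simpa using cX.tail), rfl, ends _ _ _ _ j2, ?_⟩
    ⟨nY.tail, (by simpa using cY.tail), rfl, ends _ _ _ _ j1, ?_⟩ ?_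
  · simp; omega
  · simp; omega
  · have hne12 : f :: r1 ≠ f :: r2 := by
      intro h'; rw [e1, h', ← e2] at hx; exact hx' hx
    have key1 : ∀ D, s(x, y) ∈ es (i :: D) → f :: r1 ≠ D := by
      rintro D hD rfl; rw [← e1] at hD; exact h.2.2 _ hP1 hD
    have key2 : ∀ D, s(x, y) ∈ es (i :: D) → f :: r2 ≠ D := by
      rintro D hD rfl; rw [← e2] at hD; exact h.2.2 _ hP2 hD
    have m1 : s(x, y) ∈ es (i :: (f :: (A0 ++ B1) ++ x :: y :: (B2' ++ C))) :=
      mem_es_iff.2 ⟨i :: f :: (A0 ++ B1), B2' ++ C, Or.inl (by simp)⟩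
    have m2 : s(x, y) ∈ es (i :: (f :: (A0 ++ B1') ++ y :: x :: (B2 ++ C))) :=
      mem_es_iff.2 ⟨i :: f :: (A0 ++ B1'), B2 ++ C, Or.inr (by simp)⟩
    have hne34 : f :: (A0 ++ B1) ++ x :: y :: (B2' ++ C) ≠
        f :: (A0 ++ B1') ++ y :: x :: (B2 ++ C) := by
      intro h'
      have := List.append_inj_right h' (by simp; omega)
      simp at this; exact h.1 this.1
    have q1 := key1 _ m1
    have q2 := key1 _ m2
    have q3 := key2 _ m1
    have q4 := key2 _ m2
    rw [List.nodup_cons, List.nodup_cons, List.nodup_cons]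
    refine ⟨?_, ?_, ?_, List.nodup_singleton _⟩
    · intro h'; rw [List.mem_cons, List.mem_cons, List.mem_singleton] at h'; tauto
    · intro h'; rw [List.mem_cons, List.mem_singleton] at h'; tauto
    · intro h'; rw [List.mem_singleton] at h'; tauto

theorem Rung.false_of_same_last {R : V → V → Prop} (hR : ∀ a b, R a b → R b a) {n : ℕ}
    (hn : 2 ≤ n) {i j : V} (hij : i ≠ j) (hna : ¬ R i j) (hL : PathBound R n 3) {x y : V}
    (h : Rung R n i j x y) {P1 P2 r1 r2 : List V} {f : V} (hP1 : SP R n i j P1)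
    (hP2 : SP R n i j P2) (hA : ∀ r, SP R n i j (r ++ [f, j]) → r = r1 ∨ r = r2)
    (e1 : P1 = r1 ++ [f, j]) (e2 : P2 = r2 ++ [f, j])
    (hx : x ∈ P1) (hy : y ∈ P2) : False :=
  (h.reverse hR).false_of_same_first hR hn hij.symm (fun h => hna (hR _ _ h)) hL
    (hP1.reverse hR) (hP2.reverse hR) (r1 := r1.reverse) (r2 := r2.reverse)
    (fun r hr => by
      have := hA r.reverse (by simpa using hr.reverse hR)
      rwa [List.reverse_eq_iff, List.reverse_eq_iff] at this)
    (by simp [e1]) (by simp [e2]) (by simpa using hx) (by simpa using hy)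
end ShortPath

namespace ShortPath
variable {V : Type u}

theorem exists_first_edge_split (p : Sym2 V → Prop) (Q : List V) :
    (∀ e ∈ es Q, p e) ∨ ∃ L M a b, Q = L ++ M ∧ L.getLast? = some a ∧ M.head? = some b ∧
      (∀ e ∈ es L, p e) ∧ ¬ p s(a, b) := by
  induction Q with
  | nil => simp
  | cons a Q ih =>
    cases Q with
    | nil => simp
    | cons b Q =>
      by_cases hab : p s(a, b)
      · rcases ih with h | ⟨L, M, c, d, h1, h2, h3, h4, h5⟩
        · left
          intro e he
          rw [es_cons_cons, List.mem_cons] at he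
          rcases he with rfl | he
          · exact hab
          · exact h e he
        · right
          refine ⟨a :: L, M, c, d, by rw [h1]; rfl, ?_, h3, ?_, h5⟩
          · rw [List.getLast?_cons, h2]; rfl
          · cases L with
            | nil => simp
            | cons x L =>
              have : x = b := by simp at h1; exact h1.1.symm
              subst this
              intro e he
              rw [es_cons_cons, List.mem_cons] at he
              rcases he with rfl | he
              · exact hab
              · exact h4 e he
      · exact Or.inr ⟨[a], b :: Q, a, b, rfl, rfl, rfl, by simp, hab⟩

theorem exists_last_edge_split (p : Sym2 V → Prop) (Q : List V) :
    (∀ e ∈ es Q, p e) ∨ ∃ L M a b, Q = L ++ M ∧ L.getLast? = some a ∧ M.head? = some b ∧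
      (∀ e ∈ es M, p e) ∧ ¬ p s(a, b) := by
  rcases exists_first_edge_split p Q.reverse with h | ⟨L, M, a, b, h1, h2, h3, h4, h5⟩
  · exact Or.inl fun e he => h e (mem_es_reverse.2 he)
  · refine Or.inr ⟨M.reverse, L.reverse, b, a, ?_, by simpa using h3, by simpa using h2, ?_, ?_⟩
    · rw [List.reverse_eq_iff] at h1; simpa using h1
    · intro e he; exact h4 e (mem_es_reverse.1 he)
    · rwa [Sym2.eq_swap]

/-- Adding a path to a graph creates at most one more edge than vertices, provided the part of
the path between its first and last new edges is new. -/
theorem ear [DecidableEq V] {X : Finset V} {E : Finset (Sym2 V)} {Q : List V} (hQ : Q.Nodup)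
    (hnew : ∀ L M N p m m' q, Q = L ++ M ++ N → L.getLast? = some p → M.head? = some m →
      M.getLast? = some m' → N.head? = some q → s(p, m) ∉ E → s(m', q) ∉ E → ∀ x ∈ M, x ∉ X) :
    (E ∪ (es Q).toFinset).card + X.card ≤ E.card + (X ∪ Q.toFinset).card + 1 := by
  have hX : X.card ≤ (X ∪ Q.toFinset).card := Finset.card_le_card Finset.subset_union_left
  rcases exists_first_edge_split (· ∈ E) Q with h | ⟨L, M', p, m, rfl, hL, hm, hLE, hpm⟩
  · have : E ∪ (es Q).toFinset = E := by
      apply Finset.union_eq_left.2; intro e he; exact h e (by simpa using he)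
    rw [this]; omega
  have hes := es_append hL hm
  rcases exists_last_edge_split (· ∈ E) M' with h | ⟨M, N, m', q, rfl, hM', hN, hNE, hmq⟩
  · have : E ∪ (es (L ++ M')).toFinset ⊆ insert s(p, m) E := by
      intro e he
      rw [hes] at he
      simp only [Finset.mem_union, List.mem_toFinset, List.mem_append, List.mem_cons,
        Finset.mem_insert] at he ⊢
      rcases he with he | he | he | he
      · exact Or.inr he
      · exact Or.inr (hLE e he)
      · exact Or.inl he
      · exact Or.inr (h e he)
    have := (Finset.card_le_card this).trans (Finset.card_insert_le _ _)
    omega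
  · have hm2 : M.head? = some m := by
      cases M with
      | nil => simp at hM'
      | cons a M => simpa using hm
    have hx := hnew L M N p m m' q (by simp) hL hm2 hM' hN hpm hmq
    have s1 : E ∪ (es (L ++ (M ++ N))).toFinset ⊆
        E ∪ (s(p, m) :: s(m', q) :: es M).toFinset := by
      intro e he
      rw [hes, es_append hM' hN] at he
      simp only [Finset.mem_union, List.mem_toFinset, List.mem_append, List.mem_cons] at he ⊢
      rcases he with he | he | he | he | he | he
      · exact Or.inl he
      · exact Or.inl (hLE e he)
      · tauto
      · tauto
      · tauto
      · exact Or.inl (hNE e he)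
    have c1 := (Finset.card_le_card s1).trans (Finset.card_union_le _ _)
    have c2 := List.toFinset_card_le (s(p, m) :: s(m', q) :: es M)
    have c3 := length_es M
    have hMn : M.Nodup := (List.nodup_append.1 (List.nodup_append.1 hQ).2.1).1
    have hMne : M.length ≠ 0 := by
      intro h0; rw [List.length_eq_zero_iff] at h0; subst h0; simp at hM'
    have s2 : X ∪ M.toFinset ⊆ X ∪ (L ++ (M ++ N)).toFinset := by
      intro x; simp only [Finset.mem_union, List.mem_toFinset, List.mem_append]; tauto
    have c4 := Finset.card_le_card s2
    rw [Finset.card_union_of_disjoint (Finset.disjoint_left.2 fun x h1 h2 =>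
      hx x (by simpa using h2) h1), List.toFinset_card_of_nodup hMn] at c4
    simp only [List.length_cons] at c2
    omega

/-- The edges of a path are one fewer than its vertices. -/
theorem card_es [DecidableEq V] {Q : List V} (hQ : Q.Nodup) :
    (es Q).toFinset.card = Q.toFinset.card - 1 := by
  rw [List.toFinset_card_of_nodup hQ, List.toFinset_card_of_nodup (es_nodup hQ), length_es]

theorem count_two [DecidableEq V] {R : V → V → Prop} (hR : ∀ a b, R a b → R b a) {n : ℕ}
    {i j : V} {Q Q' : List V} (hQ : SP R n i j Q) (hQ' : SP R n i j Q')
    (hA : ∀ T, SP R n i j T → (∀ e ∈ es T, e ∈ es Q' ∨ e ∈ es Q) → T = Q ∨ T = Q') :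
    ((es Q).toFinset ∪ (es Q').toFinset).card ≤ (Q.toFinset ∪ Q'.toFinset).card := by
  have h1 := card_es hQ.1
  have h2 : 1 ≤ Q.toFinset.card := by
    rw [List.toFinset_card_of_nodup hQ.1]
    have := hQ.2.2.1
    cases Q with
    | nil => simp at this
    | cons => simp
  have := ear (X := Q.toFinset) (E := (es Q).toFinset) (Q := Q') hQ'.1 (by
    intro L M N p m m' q e hL hM hM' hN e1 e2 x hx hxQ
    subst e
    simp only [List.mem_toFinset] at e1 e2 hxQ
    obtain ⟨T, hT, hTe, hT2⟩ := exchange hR hQ' hQ hL hM hM' hN e1 e2 ⟨x, hx, hxQ⟩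
    have m1 : s(p, m) ∈ es (L ++ M ++ N) := by
      rw [List.append_assoc, es_append hL (m := m) (by cases M <;> simp_all)]; simp
    have m2 : s(m', q) ∈ es (L ++ M ++ N) := by
      rw [es_append (p := m') (m := q) _ hN]
      · simp
      · cases M using List.reverseRecOn with
        | nil => simp at hM'
        | append_singleton => simpa [← List.append_assoc] using hM'
    rcases hA T hT hTe with rfl | rfl
    · tauto
    · tauto)
  omega

theorem count_three [DecidableEq V] {R : V → V → Prop} (hR : ∀ a b, R a b → R b a) {n : ℕ}
    {i j : V} {P1 P2 P3 : List V} (h1 : SP R n i j P1) (h2 : SP R n i j P2) (h3 : SP R n i j P3)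
    (hA : All3 R n i j P1 P2 P3) {e0 : Sym2 V} (he : e0 ∈ es P3) (he1 : e0 ∉ es P1)
    (he2 : e0 ∉ es P2) :
    ((es P1).toFinset ∪ (es P2).toFinset ∪ (es P3).toFinset).card ≤
      (P1.toFinset ∪ P2.toFinset ∪ P3.toFinset).card + 1 := by
  have c := count_two hR h1 h2 (by
    intro T hT hTe
    rcases hA T hT with h | h | h
    · exact Or.inl h
    · exact Or.inr h
    · subst h; have := hTe _ he; tauto)
  have := ear (X := P1.toFinset ∪ P2.toFinset) (E := (es P1).toFinset ∪ (es P2).toFinset)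
    (Q := P3) h3.1 (by
    intro L M N p m m' q e hL hM hM' hN e1 e2 x hx hxQ
    subst e
    simp only [List.mem_toFinset, Finset.mem_union, not_or] at e1 e2 hxQ
    have m1 : s(p, m) ∈ es (L ++ M ++ N) := by
      rw [List.append_assoc, es_append hL (m := m) (by cases M <;> simp_all)]; simp
    have m2 : s(m', q) ∈ es (L ++ M ++ N) := by
      rw [es_append (p := m') (m := q) _ hN]
      · simp
      · cases M using List.reverseRecOn with
        | nil => simp at hM'
        | append_singleton => simpa [← List.append_assoc] using hM'
    rcases hxQ with hxQ | hxQ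
    · obtain ⟨T, hT, hTe, hT2⟩ := exchange hR h3 h1 hL hM hM' hN e1.1 e2.1 ⟨x, hx, hxQ⟩
      rcases hA T hT with rfl | rfl | rfl <;> tauto
    · obtain ⟨T, hT, hTe, hT2⟩ := exchange hR h3 h2 hL hM hM' hN e1.2 e2.2 ⟨x, hx, hxQ⟩
      rcases hA T hT with rfl | rfl | rfl <;> tauto)
  omega
end ShortPath

namespace ShortPath
variable {V : Type u}

theorem Rung.ne_start {R : V → V → Prop} (hR : ∀ a b, R a b → R b a) {n : ℕ} {i j x y : V}
    (h : Rung R n i j x y) {P : List V} (hP : SP R n i j P) (hy : y ∈ P) : x ≠ i := by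
  rintro rfl
  exact (h.symm hR).not_mem hR hP hy (List.mem_of_head? hP.2.2.1)

theorem Rung.ne_end {R : V → V → Prop} (hR : ∀ a b, R a b → R b a) {n : ℕ} {i j x y : V}
    (h : Rung R n i j x y) {P : List V} (hP : SP R n i j P) (hy : y ∈ P) : x ≠ j := by
  rintro rfl
  exact (h.symm hR).not_mem hR hP hy (List.mem_of_getLast? hP.2.2.2.1)

theorem mem_first_edge {i f g : V} {q r : List V} (h : (i :: q ++ r).Nodup)
    (hq : q.head? = some f) : s(i, g) ∈ es (i :: q ++ r) ↔ g = f := by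
  cases q with
  | nil => simp at hq
  | cons a q => simp at hq; subst hq; exact first_edge h

theorem mem_last_edge {j l g : V} {q r : List V} (h : (r ++ q ++ [j]).Nodup)
    (hq : q.getLast? = some l) : s(g, j) ∈ es (r ++ q ++ [j]) ↔ g = l := by
  cases q using List.reverseRecOn with
  | nil => simp at hq
  | append_singleton q a =>
    simp at hq; subst hq
    have e : r ++ (q ++ [a]) ++ [j] = (r ++ q) ++ [a, j] := by simp
    rw [e] at h ⊢; exact last_edge h

theorem exchange_mid {R : V → V → Prop} (hR : ∀ a b, R a b → R b a) {n : ℕ} {i j f l : V}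
    {q Q' : List V} (hQ : SP R n i j (i :: q ++ [j])) (hQ' : SP R n i j Q')
    (hf : q.head? = some f) (hl : q.getLast? = some l) (h1 : s(i, f) ∉ es Q')
    (h2 : s(l, j) ∉ es Q') (hx : ∃ x ∈ q, x ∈ Q') :
    ∃ T, SP R n i j T ∧ (∀ e ∈ es T, e ∈ es (i :: q ++ [j]) ∨ e ∈ es Q') ∧
      ((s(i, f) ∈ es T ∧ s(l, j) ∉ es T) ∨ (s(i, f) ∉ es T ∧ s(l, j) ∈ es T)) :=
  exchange hR (L := [i]) (M := q) (N := [j]) hQ hQ' rfl hf hl rfl h1 h2 hx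

/-- Two disjoint short paths joined by a rung yield short paths from the first inner vertex of
one to the last inner vertex of the other. -/
theorem Rung.cross_paths {R : V → V → Prop} (hR : ∀ a b, R a b → R b a) {n : ℕ} {i j x y f l : V}
    (h : Rung R n i j x y) {q q' : List V} (hQ : SP R n i j (i :: q ++ [j]))
    (hQ' : SP R n i j (i :: q' ++ [j])) (hd : ∀ v ∈ q, v ∉ q') (hx : x ∈ q) (hy : y ∈ q')
    (hf : q.head? = some f) (hl : q'.getLast? = some l) :
    SP R n f l (f :: i :: q') ∧ SP R n f l (q ++ [j, l]) ∧ (∃ p, SP R n f l p ∧ s(x, y) ∈ es p ∧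
      (∀ e ∈ es p, e = s(x, y) ∨ e ∈ es q ∨ e ∈ es q')) ∧ q.length + 1 = n ∧
      q'.length + 1 = n := by
  obtain ⟨q1, q2, rfl⟩ := List.append_of_mem hx
  obtain ⟨q1', q2', rfl⟩ := List.append_of_mem hy
  have n1 := hQ.1
  have n2 := hQ'.1
  have d1 := lens_disjoint (P := [i]) (C := [j]) n1 n2 hd
  have d2 := lens_disjoint (P := [i]) (C := [j]) n2 n1 fun v h1 h2 => hd v h2 h1
  have e1 : i :: (q1 ++ x :: q2) ++ [j] = (i :: q1) ++ x :: (q2 ++ [j]) := by simp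
  have e2 : i :: (q1' ++ y :: q2') ++ [j] = (i :: q1') ++ y :: (q2' ++ [j]) := by simp
  obtain ⟨l1, l2, l3⟩ := h.cross_eq hR (e1 ▸ hQ) (e2 ▸ hQ') d1 d2
  have cx := cross_chain h.2.1 (e1 ▸ hQ.2.1) (e2 ▸ hQ'.2.1)
  have nx := cross_nodup (e1 ▸ n1) (e2 ▸ n2) d1
  have hfm : f ∈ q1 ++ x :: q2 := List.mem_of_head? hf
  have hlm : l ∈ q1' ++ y :: q2' := List.mem_of_getLast? hl
  simp only [List.length_cons, List.length_append, List.length_nil] at l1 l2 l3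
  have n1' : i ∉ q1 ++ x :: q2 ∧ j ∉ q1 ++ x :: q2 ∧ (q1 ++ x :: q2).Nodup := by
    have := n1
    rw [List.cons_append, List.nodup_cons, List.nodup_append] at this
    refine ⟨fun h => this.1 (List.mem_append_left _ h), fun h => ?_, this.2.1⟩
    exact this.2.2.2 j h j (by simp) rfl
  have n2' : i ∉ q1' ++ y :: q2' ∧ j ∉ q1' ++ y :: q2' ∧ (q1' ++ y :: q2').Nodup := by
    have := n2
    rw [List.cons_append, List.nodup_cons, List.nodup_append] at this
    refine ⟨fun h => this.1 (List.mem_append_left _ h), fun h => ?_, this.2.1⟩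
    exact this.2.2.2 j h j (by simp) rfl
  have hif : R i f := by
    have := hQ.2.1
    cases q1 with
    | nil => simp at hf; subst hf; simp at this; exact this.1
    | cons a q1 => simp at hf; subst hf; simp at this; exact this.1
  have hlj : R l j := by
    have := hQ'.2.1
    refine (List.isChain_append.1 this).2.2 l ?_ j rfl
    rw [← List.cons_append, getLast?_app, Option.mem_def, ← hl, getLast?_app]
  refine ⟨⟨?_, ?_, rfl, ?_, ?_⟩, ⟨?_, ?_, ?_, ?_, ?_⟩,
    ⟨q1 ++ x :: y :: q2', ⟨?_, ?_, ?_, ?_, ?_⟩, ?_, ?_⟩, ?_, ?_⟩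
  · rw [List.nodup_cons, List.nodup_cons]
    refine ⟨?_, n2'.1, n2'.2.2⟩
    rw [List.mem_cons, not_or]
    exact ⟨fun h => n1'.1 (h ▸ hfm), hd f hfm⟩
  · rw [List.isChain_cons_cons]
    exact ⟨hR _ _ hif, hQ'.2.1.left_of_append⟩
  · rw [← List.cons_append, ← List.cons_append, getLast?_app]; rw [getLast?_app] at hl; exact hl
  · simp; omega
  · rw [List.nodup_append]
    refine ⟨n1'.2.2, ?_, ?_⟩
    · simp; intro h; exact n2'.2.1 (h ▸ hlm)
    · intro v hv w hw
      simp at hw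
      rcases hw with rfl | rfl
      · rintro rfl; exact n1'.2.1 hv
      · rintro rfl; exact hd _ hv hlm
  · have := hQ.2.1
    have e : (q1 ++ x :: q2) ++ [j, l] = ((q1 ++ x :: q2) ++ [j]) ++ [l] := by simp
    rw [e, List.isChain_append]
    refine ⟨this.tail, by simp, ?_⟩
    rintro w hw z hz
    rw [List.getLast?_append] at hw
    simp at hw hz
    subst hw hz; exact hR _ _ hlj
  · cases q1 <;> simpa using hf
  · have e : (q1 ++ x :: q2) ++ [j, l] = ((q1 ++ x :: q2) ++ [j]) ++ [l] := by simp
    rw [e, List.getLast?_append]; rfl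
  · simp; omega
  · have e : [i] ++ q1 ++ x :: y :: (q2' ++ [j]) = i :: ((q1 ++ x :: y :: q2') ++ [j]) := by simp
    rw [e] at nx
    exact (List.nodup_append.1 nx.tail).1
  · exact List.IsChain.left_of_append (l₂ := [j]) (by simpa using cx.tail)
  · cases q1 <;> simpa using hf
  · rw [getLast?_app]; rw [getLast?_app] at hl; rw [← hl]; simp [List.getLast?_cons]
  · simp; omega
  · exact mem_es_iff.2 ⟨q1, q2', Or.inl rfl⟩
  · intro e he
    have s1 : q1 ++ x :: y :: q2' = (q1 ++ [x]) ++ (y :: q2') := by simp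
    rw [s1, es_append (p := x) (m := y) (by simp) rfl, List.mem_append, List.mem_cons] at he
    rcases he with he | he | he
    · right; left
      have : q1 ++ x :: q2 = [] ++ (q1 ++ [x]) ++ q2 := by simp
      rw [this]; exact mem_es_of_infix_of he
    · exact Or.inl he
    · right; right
      have : q1' ++ y :: q2' = q1' ++ (y :: q2') ++ [] := by simp
      rw [this]; exact mem_es_of_infix_of he
  · simp; omega
  · simp; omega
end ShortPath

namespace ShortPath
variable {V : Type u}

/-- `v` lies on a short path from `i` to `j`. -/
def OnSP (R : V → V → Prop) (n : ℕ) (i j v : V) : Prop := ∃ P, SP R n i j P ∧ v ∈ P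

/-- The vertices on short paths span few edges. -/
def FewEdges (R : V → V → Prop) (n : ℕ) (i j : V) (η : ℕ) : Prop :=
  ∃ E : Finset (Sym2 V), (∀ a b, OnSP R n i j a → OnSP R n i j b → a ≠ b → R a b → s(a, b) ∈ E) ∧
    E.card + 2 ≤ {v | OnSP R n i j v}.ncard + η

theorem rung_or {R : V → V → Prop} (n : ℕ) (i j : V) {a b : V} (hab : a ≠ b) (h : R a b) :
    (∃ T, SP R n i j T ∧ s(a, b) ∈ es T) ∨ Rung R n i j a b := by
  by_cases h' : ∃ T, SP R n i j T ∧ s(a, b) ∈ es T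
  · exact Or.inl h'
  · exact Or.inr ⟨hab, h, fun T hT he => h' ⟨T, hT, he⟩⟩

theorem SP.inner {R : V → V → Prop} {n : ℕ} {i j f l : V} {q : List V}
    (h : SP R n i j (i :: q ++ [j])) (hf : q.head? = some f) (hl : q.getLast? = some l) :
    R i f ∧ R l j ∧ i ∉ q ∧ j ∉ q ∧ q.Nodup := by
  have hfm : f ∈ q := List.mem_of_head? hf
  have n1 := h.1
  rw [List.cons_append, List.nodup_cons, List.nodup_append] at n1
  refine ⟨?_, ?_, fun h => n1.1 (List.mem_append_left _ h), fun h => ?_, n1.2.1⟩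
  · have := h.2.1
    cases q with
    | nil => simp at hf
    | cons a q => simp at hf; subst hf; simp at this; exact this.1
  · have := h.2.1
    refine (List.isChain_append.1 this).2.2 l ?_ j rfl
    rw [Option.mem_def, List.getLast?_cons, hl]; rfl
  · exact n1.2.2.2 j h j (by simp) rfl

theorem sp_four {R : V → V → Prop} {n : ℕ} (hn : 3 ≤ n) {i j f l : V} (hij : i ≠ j) (hif : R i f)
    (hfl : R f l) (hlj : R l j) (h1 : i ≠ f) (h2 : i ≠ l) (h3 : f ≠ l) (h4 : f ≠ j) (h5 : l ≠ j) :
    SP R n i j [i, f, l, j] := by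
  refine ⟨by simp; tauto, by simp; tauto, rfl, rfl, by simpa using hn⟩

theorem PathBound.mono {R : V → V → Prop} {n η η' : ℕ} (h : PathBound R n η) (hη : η ≤ η') :
    PathBound R n η' :=
  fun a b hab hna ls h1 h2 => (h a b hab hna ls h1 h2).trans hη

/-- For a disjoint pair of short paths with a rung whose cross edge is absent, the cross paths are
pairwise distinct. -/
theorem Rung.cross_list {R : V → V → Prop} (hR : ∀ a b, R a b → R b a) {n : ℕ} {i j x y f l : V}
    (h : Rung R n i j x y) {q q' : List V} (hQ : SP R n i j (i :: q ++ [j]))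
    (hQ' : SP R n i j (i :: q' ++ [j])) (hd : ∀ v ∈ q, v ∉ q') (hx : x ∈ q) (hy : y ∈ q')
    (hf : q.head? = some f) (hl : q'.getLast? = some l) :
    ∃ p, SP R n f l p ∧ s(x, y) ∈ es p ∧ (∀ e ∈ es p, e = s(x, y) ∨ e ∈ es q ∨ e ∈ es q') ∧
      [f :: i :: q', q ++ [j, l], p].Nodup := by
  obtain ⟨h1, h2, ⟨p, h3, h4, h5⟩, -, -⟩ := h.cross_paths hR hQ hQ' hd hx hy hf hl
  obtain ⟨a1, -, a2, a3, -⟩ := hQ.inner (hf) (l := q.getLast (by rintro rfl; simp at hf))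
    (List.getLast?_eq_some_getLast _)
  obtain ⟨-, b1, b2, b3, -⟩ := hQ'.inner (f := q'.head (by rintro rfl; simp at hl))
    (List.head?_eq_some_head _) hl
  refine ⟨p, h3, h4, h5, ?_⟩
  have hfm : f ∈ q := List.mem_of_head? hf
  have hlm : l ∈ q' := List.mem_of_getLast? hl
  have hfi : f ≠ i := fun h => a2 (h ▸ hfm)
  have hij : i ≠ j := by
    rintro rfl; have := hQ.1; simp at this
  have ne1 : f :: i :: q' ≠ p := by
    rintro rfl
    rcases mem_es_iff.1 h4 with ⟨A, B, h | h⟩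
    all_goals
      rcases h5 s(f, i) (by simp) with h' | h' | h'
      · have : i = x ∨ i = y := by
          have : i ∈ s(x, y) := by rw [← h']; simp
          simpa using this
        rcases this with rfl | rfl
        · exact a2 hx
        · exact b2 hy
      · exact a2 (mem_right_of_mem_es h')
      · exact b2 (mem_right_of_mem_es h')
  have ne2 : q ++ [j, l] ≠ p := by
    rintro rfl
    have : s(j, l) ∈ es (q ++ [j, l]) := mem_es_iff.2 ⟨q, [], Or.inl rfl⟩
    rcases h5 _ this with h' | h' | h'
    · have : j = x ∨ j = y := by
        have : j ∈ s(x, y) := by rw [← h']; simp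
        simpa using this
      rcases this with rfl | rfl
      · exact a3 hx
      · exact b3 hy
    · exact a3 (mem_left_of_mem_es h')
    · exact b3 (mem_left_of_mem_es h')
  have ne3 : f :: i :: q' ≠ q ++ [j, l] := by
    intro h
    have : i ∈ q ++ [j, l] := by rw [← h]; simp
    simp at this
    rcases this with h | h | h
    · exact a2 h
    · exact hij h
    · exact b2 (h ▸ hlm)
  simp [ne1, ne2, ne3]

theorem fewEdges_two {R : V → V → Prop} (hR : ∀ a b, R a b → R b a) {n : ℕ} (hn : 3 ≤ n)
    {i j : V} (hij : i ≠ j) (hna : ¬ R i j) {η : ℕ} (h2η : 2 ≤ η) (hη : η ≤ 3)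
    (hL : PathBound R n η) {Q Q' : List V} (hQ : SP R n i j Q) (hQ' : SP R n i j Q')
    (hA : ∀ T, SP R n i j T → T = Q ∨ T = Q') : FewEdges R n i j η := by
  classical
  have hU : {v | OnSP R n i j v} = ↑(Q.toFinset ∪ Q'.toFinset) := by
    ext v
    simp only [Set.mem_ofPred_eq, Finset.coe_union, Set.mem_union, Finset.mem_coe,
      List.mem_toFinset]
    constructor
    · rintro ⟨P, hP, hv⟩; rcases hA P hP with rfl | rfl <;> tauto
    · rintro (h | h)
      · exact ⟨Q, hQ, h⟩
      · exact ⟨Q', hQ', h⟩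
  have hc := count_two hR hQ hQ' fun T hT _ => hA T hT
  have hmem : ∀ T, SP R n i j T → ∀ e ∈ es T, e ∈ (es Q).toFinset ∪ (es Q').toFinset := by
    intro T hT e he
    rcases hA T hT with rfl | rfl <;> simp [he]
  by_cases hr : ∃ x y, Rung R n i j x y ∧ x ∈ Q ∧ y ∈ Q'
  swap
  · refine ⟨(es Q).toFinset ∪ (es Q').toFinset, ?_, ?_⟩
    · intro a b ⟨P, hP, ha⟩ ⟨P', hP', hb⟩ hab hRab
      rcases rung_or n i j hab hRab with ⟨T, hT, he⟩ | h
      · exact hmem T hT _ he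
      · exfalso
        have h1 := h.not_mem hR hP ha
        rcases hA P hP with rfl | rfl <;> rcases hA P' hP' with rfl | rfl
        · exact h1 hb
        · exact hr ⟨a, b, h, ha, hb⟩
        · exact hr ⟨b, a, h.symm hR, hb, ha⟩
        · exact h1 hb
    · rw [hU, Set.ncard_coe_finset]; omega
  obtain ⟨x, y, h, hx, hy⟩ := hr
  have hL3 := hL.mono hη
  have hff : ∀ f r r', Q = i :: f :: r → Q' = i :: f :: r' → False := by
    intro f r r' e1 e2
    refine h.false_of_same_first hR (by omega) hij hna hL3 hQ hQ' (fun t ht => ?_) e1 e2 hx hy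
    rcases hA _ ht with h | h
    · rw [e1] at h; simp at h; exact Or.inl h
    · rw [e2] at h; simp at h; exact Or.inr h
  have hll : ∀ f r r', Q = r ++ [f, j] → Q' = r' ++ [f, j] → False := by
    intro f r r' e1 e2
    refine h.false_of_same_last hR (by omega) hij hna hL3 hQ hQ' (fun t ht => ?_) e1 e2 hx hy
    rcases hA _ ht with h | h
    · rw [e1] at h; simp at h; exact Or.inl h
    · rw [e2] at h; simp at h; exact Or.inr h
  obtain ⟨q, hq, rfl⟩ := hQ.exists_mid hij hna
  obtain ⟨q', hq', rfl⟩ := hQ'.exists_mid hij hna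
  obtain ⟨f, r, rfl⟩ := List.exists_cons_of_ne_nil hq
  obtain ⟨f', r', rfl⟩ := List.exists_cons_of_ne_nil hq'
  obtain ⟨l, hl⟩ : ∃ l, (f :: r).getLast? = some l := ⟨_, List.getLast?_eq_some_getLast hq⟩
  obtain ⟨l', hl'⟩ : ∃ l, (f' :: r').getLast? = some l := ⟨_, List.getLast?_eq_some_getLast hq'⟩
  have hne : f ≠ f' := by rintro rfl; exact hff _ _ _ rfl rfl
  have hne' : l ≠ l' := by
    rintro rfl
    obtain ⟨a, ha⟩ := List.getLast?_eq_some_iff.1 hl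
    obtain ⟨a', ha'⟩ := List.getLast?_eq_some_iff.1 hl'
    exact hll l (i :: a) (i :: a') (by rw [ha]; simp) (by rw [ha']; simp)
  have m1 : s(i, f) ∉ es (i :: (f' :: r') ++ [j]) := fun h => hne ((mem_first_edge hQ'.1 rfl).1 h)
  have m2 : s(l, j) ∉ es (i :: (f' :: r') ++ [j]) := fun h =>
    hne' ((mem_last_edge (r := [i]) hQ'.1 hl').1 h)
  have m3 : s(i, f) ∈ es (i :: (f :: r) ++ [j]) := (mem_first_edge hQ.1 rfl).2 rfl
  have m4 : s(l, j) ∈ es (i :: (f :: r) ++ [j]) := (mem_last_edge (r := [i]) hQ.1 hl).2 rfl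
  have hd : ∀ v ∈ f :: r, v ∉ f' :: r' := by
    intro v hv hv'
    obtain ⟨T, hT, -, hT2⟩ := exchange_mid hR hQ hQ' rfl hl m1 m2 ⟨v, hv, by simp at hv' ⊢; tauto⟩
    rcases hA T hT with rfl | rfl <;> tauto
  obtain ⟨a1, -, a2, a3, -⟩ := hQ.inner rfl hl
  obtain ⟨-, b1, b2, b3, -⟩ := hQ'.inner rfl hl'
  have hlm : l' ∈ f' :: r' := List.mem_of_getLast? hl'
  have hfl : f ≠ l' := fun h => hd f (by simp) (h ▸ hlm)
  have hnfl : ¬ R f l' := by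
    intro hfl'
    have := sp_four hn hij a1 hfl' b1 (by rintro rfl; simp at a2) (by rintro rfl; exact b2 hlm) hfl
      (by rintro rfl; simp at a3) (by rintro rfl; exact b3 hlm)
    rcases hA _ this with h' | h'
    · have h2 : s(l', j) ∈ es (i :: (f :: r) ++ [j]) := by rw [← h']; simp
      exact hne' ((mem_last_edge (r := [i]) hQ.1 hl).1 h2).symm
    · simp at h'; exact hne h'.1
  have inner : ∀ a b, Rung R n i j a b → a ∈ i :: (f :: r) ++ [j] → b ∈ i :: (f' :: r') ++ [j] →
      a ∈ f :: r ∧ b ∈ f' :: r' := by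
    intro a b h ha hb
    have h1 := h.ne_start hR hQ' hb
    have h2 := h.ne_end hR hQ' hb
    have h3 := (h.symm hR).ne_start hR hQ ha
    have h4 := (h.symm hR).ne_end hR hQ ha
    simp only [List.mem_append, List.mem_cons, List.not_mem_nil, or_false] at ha hb ⊢
    tauto
  have hxy := inner x y h hx hy
  obtain ⟨c1, c2, -⟩ := h.cross_paths hR hQ hQ' hd hxy.1 hxy.2 rfl hl'
  obtain ⟨p, c3, c4, c5, c6⟩ := h.cross_list hR hQ hQ' hd hxy.1 hxy.2 rfl hl'
  have h3η : η = 3 := by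
    have := hL f l' hfl hnfl _ c6 (by
      intro t ht; simp only [List.mem_cons, List.not_mem_nil, or_false] at ht
      rcases ht with rfl | rfl | rfl <;> assumption)
    simp at this; omega
  subst h3η
  have uniq : ∀ a b, Rung R n i j a b → a ∈ i :: (f :: r) ++ [j] → b ∈ i :: (f' :: r') ++ [j] →
      s(a, b) = s(x, y) := by
    intro a b h' ha hb
    by_contra hcon
    have hab := inner a b h' ha hb
    obtain ⟨p', d3, d4, d5, d6⟩ := h'.cross_list hR hQ hQ' hd hab.1 hab.2 rfl hl'
    refine hL.false_of_four hfl hnfl c1 c2 c3 d3 ?_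
    have : p ≠ p' := by
      rintro rfl
      rcases c5 _ d4 with e | e | e
      · exact hcon e
      · exact h'.2.2 _ hQ (mem_es_of_infix_of (L := [i]) (N := [j]) e)
      · exact h'.2.2 _ hQ' (mem_es_of_infix_of (L := [i]) (N := [j]) e)
    simp only [List.nodup_cons, List.mem_cons, List.not_mem_nil, or_false, not_or,
      List.nodup_nil, not_false_eq_true, and_true] at c6 d6 ⊢
    tauto
  refine ⟨insert s(x, y) ((es (i :: (f :: r) ++ [j])).toFinset ∪
    (es (i :: (f' :: r') ++ [j])).toFinset), ?_, ?_⟩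
  · intro a b ⟨P, hP, ha⟩ ⟨P', hP', hb⟩ hab hRab
    rcases rung_or n i j hab hRab with ⟨T, hT, he⟩ | h
    · exact Finset.mem_insert_of_mem (hmem T hT _ he)
    · have h1 := h.not_mem hR hP ha
      rcases hA P hP with rfl | rfl <;> rcases hA P' hP' with rfl | rfl
      · exact absurd hb h1
      · rw [uniq a b h ha hb]; exact Finset.mem_insert_self _ _
      · rw [show s(a, b) = s(b, a) from Sym2.eq_swap, uniq b a (h.symm hR) hb ha]; exact Finset.mem_insert_self _ _
      · exact absurd hb h1
  · rw [hU, Set.ncard_coe_finset]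
    have := Finset.card_insert_le s(x, y) ((es (i :: (f :: r) ++ [j])).toFinset ∪
      (es (i :: (f' :: r') ++ [j])).toFinset)
    omega
end ShortPath

namespace ShortPath
variable {V : Type u}

/-- Exactly three short paths join `i` and `j`; they are given by their inner vertices. -/
structure Trio (R : V → V → Prop) (n : ℕ) (i j : V) (q1 q2 q3 : List V) : Prop where
  sp1 : SP R n i j (i :: q1 ++ [j])
  sp2 : SP R n i j (i :: q2 ++ [j])
  sp3 : SP R n i j (i :: q3 ++ [j])
  ne12 : q1 ≠ q2
  ne13 : q1 ≠ q3
  ne23 : q2 ≠ q3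
  all : ∀ q, SP R n i j (i :: q ++ [j]) → q = q1 ∨ q = q2 ∨ q = q3

/-- The standing assumptions on the skeleton near the pair `i`, `j`. -/
structure Setting (R : V → V → Prop) (n : ℕ) (i j : V) : Prop where
  symm : ∀ a b, R a b → R b a
  hn : 3 ≤ n
  ne : i ≠ j
  na : ¬ R i j
  bound : PathBound R n 3

variable {R : V → V → Prop} {n : ℕ} {i j x y f g l : V} {q1 q2 q3 : List V}

theorem Setting.reverse (h : Setting R n i j) : Setting R n j i :=
  ⟨h.symm, h.hn, h.ne.symm, fun hh => h.na (h.symm _ _ hh), h.bound⟩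

theorem Trio.swap12 (h : Trio R n i j q1 q2 q3) : Trio R n i j q2 q1 q3 :=
  ⟨h.sp2, h.sp1, h.sp3, h.ne12.symm, h.ne23, h.ne13, fun q hq => by have := h.all q hq; tauto⟩

theorem Trio.swap23 (h : Trio R n i j q1 q2 q3) : Trio R n i j q1 q3 q2 :=
  ⟨h.sp1, h.sp3, h.sp2, h.ne13, h.ne12, h.ne23.symm, fun q hq => by have := h.all q hq; tauto⟩

theorem Trio.reverse (hR : ∀ a b, R a b → R b a) (h : Trio R n i j q1 q2 q3) :
    Trio R n j i q1.reverse q2.reverse q3.reverse := by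
  have e : ∀ q : List V, (i :: q ++ [j]).reverse = j :: q.reverse ++ [i] := by simp
  refine ⟨e _ ▸ h.sp1.reverse hR, e _ ▸ h.sp2.reverse hR, e _ ▸ h.sp3.reverse hR, ?_, ?_, ?_, ?_⟩
  · exact fun h' => h.ne12 (List.reverse_injective h')
  · exact fun h' => h.ne13 (List.reverse_injective h')
  · exact fun h' => h.ne23 (List.reverse_injective h')
  · intro q hq
    have := h.all q.reverse (by simpa using hq.reverse hR)
    rwa [List.reverse_eq_iff, List.reverse_eq_iff, List.reverse_eq_iff] at this

theorem Rung.mem_mid (hR : ∀ a b, R a b → R b a) (h : Rung R n i j x y) {q : List V}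
    (hx : OnSP R n i j x) (hy : y ∈ i :: q ++ [j]) : y ∈ q := by
  obtain ⟨P, hP, hx⟩ := hx
  have h1 := (h.symm hR).ne_start hR hP hx
  have h2 := (h.symm hR).ne_end hR hP hx
  simp at hy; tauto

theorem Trio.same_first (hS : Setting R n i j) (t : Trio R n i j q1 q2 q3)
    (h : Rung R n i j x y) (hx : x ∈ q1) (hy : y ∈ q2) (h1 : q1.head? = some f)
    (h2 : q2.head? = some f) (h3 : q3.head? ≠ some f) : False := by
  obtain ⟨r1, rfl⟩ := List.head?_eq_some_iff.1 h1
  obtain ⟨r2, rfl⟩ := List.head?_eq_some_iff.1 h2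
  refine h.false_of_same_first hS.symm (by have := hS.hn; omega) hS.ne hS.na hS.bound t.sp1 t.sp2
    (r1 := r1 ++ [j]) (r2 := r2 ++ [j]) (f := f) ?_ (by simp) (by simp) ?_ ?_
  · intro r hr
    obtain ⟨q, hq, e⟩ := hr.exists_mid hS.ne hS.na
    rw [e] at hr
    obtain ⟨g, s, rfl⟩ := List.exists_cons_of_ne_nil hq
    simp only [List.cons_append, List.cons.injEq, true_and] at e
    obtain ⟨rfl, rfl⟩ := e
    rcases t.all _ hr with h | h | h
    · simp at h; simp [h]
    · simp at h; simp [h]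
    · rw [← h] at h3; simp at h3
  · simp at hx ⊢; tauto
  · simp at hy ⊢; tauto

theorem Trio.same_last (hS : Setting R n i j) (t : Trio R n i j q1 q2 q3)
    (h : Rung R n i j x y) (hx : x ∈ q1) (hy : y ∈ q2) (h1 : q1.getLast? = some f)
    (h2 : q2.getLast? = some f) (h3 : q3.getLast? ≠ some f) : False :=
  (t.reverse hS.symm).same_first hS.reverse (h.reverse hS.symm) (by simpa using hx)
    (by simpa using hy) (f := f) (by simpa using h1) (by simpa using h2) (by simpa using h3)

/-- All neighbours of `v` inside `U` are listed. -/
def Nb (R : V → V → Prop) (U : Set V) (v : V) (L : List V) : Prop :=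
  ∀ w ∈ U, R v w → w ≠ v → w ∈ L

/-- A rung from a neighbour of `i` off a short path meets that path at its first inner vertex. -/
theorem Rung.eq_first (h : Rung R n i j x g) {q : List V}
    (hQ : SP R n i j (i :: q ++ [j])) (hix : R i x) (hf : q.head? = some f) (hxi : x ≠ i)
    (hxj : x ≠ j) (hx : x ∉ q) (hg : g ∈ q) : g = f := by
  by_contra hgf
  obtain ⟨A, B, rfl⟩ := List.append_of_mem hg
  have hA : A ≠ [] := by rintro rfl; simp at hf; exact hgf hf
  obtain ⟨a, A, rfl⟩ := List.exists_cons_of_ne_nil hA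
  have e : i :: (a :: A ++ g :: B) ++ [j] = [] ++ i :: (a :: A) ++ g :: (B ++ [j]) := by simp
  rw [e] at hQ
  have := hQ.splice (Z := [x]) (by simp; exact ⟨hix, h.2.1⟩) (by simp) (by
    simp at hx ⊢; tauto) (by simp)
  exact h.2.2 _ this (mem_es_iff.2 ⟨[i], B ++ [j], Or.inl (by simp)⟩)

theorem Rung.reverse' (hR : ∀ a b, R a b → R b a) (h : Rung R n i j x y) : Rung R n j i y x :=
  (h.reverse hR).symm hR

theorem onSP_reverse (hR : ∀ a b, R a b → R b a) :
    {v | OnSP R n j i v} = {v | OnSP R n i j v} := by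
  ext v
  constructor
  · rintro ⟨P, hP, hv⟩; exact ⟨_, hP.reverse hR, by simpa using hv⟩
  · rintro ⟨P, hP, hv⟩; exact ⟨_, hP.reverse hR, by simpa using hv⟩

theorem Trio.nb_start (hS : Setting R n i j) (t : Trio R n i j q1 q2 q3) {f1 f2 f3 : V}
    (h1 : q1.head? = some f1) (h2 : q2.head? = some f2) (h3 : q3.head? = some f3) :
    Nb R {v | OnSP R n i j v} i [f1, f2, f3] := by
  intro w hw hR hne
  obtain ⟨P, hP, hwP⟩ := hw
  rcases rung_or n i j hne.symm hR with ⟨T, hT, he⟩ | h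
  · obtain ⟨q, -, rfl⟩ := hT.exists_mid hS.ne hS.na
    rcases t.all _ hT with rfl | rfl | rfl
    · rw [mem_first_edge hT.1 h1] at he; simp [he]
    · rw [mem_first_edge hT.1 h2] at he; simp [he]
    · rw [mem_first_edge hT.1 h3] at he; simp [he]
  · exact absurd rfl (h.ne_start hS.symm hP hwP)

theorem Trio.nb_end (hS : Setting R n i j) (t : Trio R n i j q1 q2 q3) {l1 l2 l3 : V}
    (h1 : q1.getLast? = some l1) (h2 : q2.getLast? = some l2) (h3 : q3.getLast? = some l3) :
    Nb R {v | OnSP R n i j v} j [l1, l2, l3] := by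
  rw [← onSP_reverse hS.symm]
  exact (t.reverse hS.symm).nb_start hS.reverse (by simpa using h1) (by simpa using h2)
    (by simpa using h3)

/-- A vertex lying on one short path only has its two path neighbours and those along rungs. -/
theorem nb_of_edges_rungs {a v b : V} {A B L : List V} (hP : (A ++ a :: v :: b :: B).Nodup)
    (hT : ∀ T w, SP R n i j T → s(v, w) ∈ es T → s(v, w) ∈ es (A ++ a :: v :: b :: B))
    (hr : ∀ w, OnSP R n i j w → Rung R n i j v w → w ∈ L) :
    Nb R {v | OnSP R n i j v} v (a :: b :: L) := by
  intro w hw hR hne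
  rcases rung_or n i j hne.symm hR with ⟨T, hTs, he⟩ | h
  · rcases mem_es_iff.1 (hT T w hTs he) with ⟨C, D, e | e⟩
    · have h1 : A ++ [a] = C ∧ b :: B = w :: D := by
        have e' : (A ++ [a]) ++ v :: (b :: B) = C ++ v :: (w :: D) := by simpa using e
        have n1 : v ∉ A ++ [a] ∧ v ∉ b :: B := by
          simp [List.nodup_append] at hP ⊢; grind
        exact ((List.append_cons_inj_of_notMem n1.1 n1.2).1 e').imp id And.right
      simp at h1; simp [h1]
    · have h1 : A ++ [a] = C ++ [w] ∧ b :: B = D := by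
        have e' : (A ++ [a]) ++ v :: (b :: B) = (C ++ [w]) ++ v :: D := by simpa using e
        have n1 : v ∉ A ++ [a] ∧ v ∉ b :: B := by
          simp [List.nodup_append] at hP ⊢; grind
        exact ((List.append_cons_inj_of_notMem n1.1 n1.2).1 e').imp id And.right
      have := List.append_inj_right' h1.1 rfl
      simp at this; simp [this]
  · simp [hr w hw h]

theorem nb_of_edges {a v b : V} {A B : List V} (hP : (A ++ a :: v :: b :: B).Nodup)
    (hT : ∀ T w, SP R n i j T → s(v, w) ∈ es T → s(v, w) ∈ es (A ++ a :: v :: b :: B))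
    (hr : ∀ w, OnSP R n i j w → ¬ Rung R n i j v w) :
    Nb R {v | OnSP R n i j v} v [a, b] :=
  nb_of_edges_rungs hP hT fun w hw h => absurd h (hr w hw)
end ShortPath

namespace ShortPath
variable {V : Type u} {R : V → V → Prop} {n : ℕ} {i j f f' l l' : V} {q q' q'' : List V}

/-- Two short paths joined by a rung, and a third with the first inner vertex of one and the last
of the other. -/
structure TwinPaths (R : V → V → Prop) (n : ℕ) (i j f f' l l' x y : V) (q q' q'' : List V) :
    Prop where
  trio : Trio R n i j q q' q''
  rung : Rung R n i j x y
  hx : x ∈ q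
  hy : y ∈ q'
  hf : q.head? = some f
  hf' : q'.head? = some f'
  hf'' : q''.head? = some f
  hl : q.getLast? = some l
  hl' : q'.getLast? = some l'
  hl'' : q''.getLast? = some l'
  nef : f ≠ f'
  nel : l ≠ l'

theorem SP.drop_start {A B : List V} {g : V} (h : SP R n i j (i :: (A ++ g :: B) ++ [j]))
    (hg : R i g) : SP R n i j (i :: (g :: B) ++ [j]) := by
  have e : i :: (A ++ g :: B) ++ [j] = [] ++ i :: A ++ g :: (B ++ [j]) := by simp
  rw [e] at h
  simpa using h.splice (Z := []) (by simpa using hg) (by simp) (by simp) (by simp)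

theorem SP.drop_end {A B : List V} {g : V} (h : SP R n i j (i :: (A ++ g :: B) ++ [j]))
    (hg : R g j) : SP R n i j (i :: (A ++ [g]) ++ [j]) := by
  have e : i :: (A ++ g :: B) ++ [j] = (i :: A) ++ g :: B ++ j :: [] := by simp
  rw [e] at h
  simpa using h.splice (Z := []) (by simpa using hg) (by simp) (by simp) (by simp)

theorem TwinPaths.reverse {x y : V} (hR : ∀ a b, R a b → R b a)
    (h : TwinPaths R n i j f f' l l' x y q q' q'') :
    TwinPaths R n j i l' l f' f y x q'.reverse q.reverse q''.reverse where
  trio := h.trio.swap12.reverse hR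
  rung := h.rung.reverse' hR
  hx := by simpa using h.hy
  hy := by simpa using h.hx
  hf := by simpa using h.hl'
  hf' := by simpa using h.hl
  hf'' := by simpa using h.hl''
  hl := by simpa using h.hf'
  hl' := by simpa using h.hf
  hl'' := by simpa using h.hf''
  nef := h.nel.symm
  nel := h.nef.symm

theorem TwinPaths.y_not_mem {x y : V} (hS : Setting R n i j)
    (h : TwinPaths R n i j f f' l l' x y q q' q'') : y ∉ q'' := fun hy =>
  h.trio.swap23.same_first hS h.rung h.hx hy h.hf h.hf''
    (by rw [h.hf']; intro e; simp at e; exact h.nef e.symm)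

theorem TwinPaths.f'_not_mem {x y : V} (hS : Setting R n i j)
    (h : TwinPaths R n i j f f' l l' x y q q' q'') : f' ∉ q ∧ f' ∉ q'' := by
  have hif' := (h.trio.sp2.inner h.hf' h.hl').1
  constructor
  · intro hm
    obtain ⟨A, B, rfl⟩ := List.append_of_mem hm
    have hT := h.trio.sp1.drop_start hif'
    rcases h.trio.all _ hT with e | e | e
    · have := h.hf; rw [← e] at this; simp at this; exact h.nef this.symm
    · have := h.hl'; rw [← e] at this
      have hl := h.hl; rw [getLast?_app, this] at hl; simp at hl; exact h.nel hl.symm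
    · have := h.hf''; rw [← e] at this; simp at this; exact h.nef this.symm
  · intro hm
    have hy := h.y_not_mem hS
    obtain ⟨A, B, rfl⟩ := List.append_of_mem hm
    have hT := h.trio.sp3.drop_start hif'
    rcases h.trio.all _ hT with e | e | e
    · have := h.hf; rw [← e] at this; simp at this; exact h.nef this.symm
    · have := h.hy; rw [← e] at this
      exact hy (List.mem_append_right _ this)
    · have := h.hf''; rw [← e] at this; simp at this; exact h.nef this.symm

theorem TwinPaths.nb_f' {x y : V} (hS : Setting R n i j)
    (h : TwinPaths R n i j f f' l l' x y q q' q'') :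
    ∃ g, Nb R {v | OnSP R n i j v} f' [i, g] := by
  have hi := h.trio.sp2.inner h.hf' h.hl'
  obtain ⟨n1, n2⟩ := h.f'_not_mem hS
  obtain ⟨r, e⟩ := List.head?_eq_some_iff.1 h.hf'
  have hf'm : f' ∈ q' := by rw [e]; simp
  have hf'i : f' ≠ i := fun hh => hi.2.2.1 (hh ▸ hf'm)
  have hf'j : f' ≠ j := fun hh => hi.2.2.2.1 (hh ▸ hf'm)
  obtain ⟨g, s, hgs⟩ : ∃ g s, r ++ [j] = g :: s := List.exists_cons_of_ne_nil (by simp)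
  have e' : i :: q' ++ [j] = [] ++ i :: f' :: g :: s := by rw [e]; simp [hgs]
  refine ⟨g, nb_of_edges (A := []) (B := s) (e' ▸ h.trio.sp2.1) ?_ ?_⟩
  · intro T w hT he
    have hm := mem_left_of_mem_es he
    obtain ⟨p, -, rfl⟩ := hT.exists_mid hS.ne hS.na
    simp only [List.mem_append, List.mem_cons, List.not_mem_nil, or_false, hf'i, hf'j,
      false_or] at hm
    rcases h.trio.all _ hT with rfl | rfl | rfl
    · exact absurd hm n1
    · rwa [e'] at he
    · exact absurd hm n2
  · intro w hw hr
    obtain ⟨P, hP, hwP⟩ := hw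
    have hfon : OnSP R n i j f' := ⟨_, h.trio.sp2, by simp [hf'm]⟩
    obtain ⟨p, hp, rfl⟩ := hP.exists_mid hS.ne hS.na
    have hwp := hr.mem_mid hS.symm hfon hwP
    have hfw : w ≠ f → w ∉ q ∧ w ∉ q'' := fun hwf =>
      ⟨fun hw => hwf (hr.eq_first h.trio.sp1 hi.1 h.hf hf'i hf'j n1 hw),
       fun hw => hwf (hr.eq_first h.trio.sp3 hi.1 h.hf'' hf'i hf'j n2 hw)⟩
    by_cases hwf : w = f
    · subst hwf
      exact h.trio.swap12.swap23.same_last hS hr hf'm (List.mem_of_head? h.hf'') h.hl' h.hl''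
        (by rw [h.hl]; simpa using h.nel)
    · rcases h.trio.all _ hP with rfl | rfl | rfl
      · exact (hfw hwf).1 hwp
      · exact hr.not_mem hS.symm h.trio.sp2 (by simp [hf'm]) (by simp [hwp])
      · exact (hfw hwf).2 hwp

/-- If `f` is off the second path then it has no neighbours besides its path neighbours. -/
theorem TwinPaths.nb_f {x y : V} (hS : Setting R n i j)
    (h : TwinPaths R n i j f f' l l' x y q q' q'') (hf : f ∉ q')
    (hes : ∀ e ∈ es (i :: q'' ++ [j]), e ∈ es (i :: q ++ [j]) ∨ e ∈ es (i :: q' ++ [j])) :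
    ∃ g, Nb R {v | OnSP R n i j v} f [i, g] := by
  have hi := h.trio.sp1.inner h.hf h.hl
  obtain ⟨r, e⟩ := List.head?_eq_some_iff.1 h.hf
  have hfm : f ∈ q := by rw [e]; simp
  have hfm'' : f ∈ q'' := List.mem_of_head? h.hf''
  have hfi : f ≠ i := fun hh => hi.2.2.1 (hh ▸ hfm)
  have hfj : f ≠ j := fun hh => hi.2.2.2.1 (hh ▸ hfm)
  have hf2 : f ∉ i :: q' ++ [j] := by simp; tauto
  obtain ⟨g, s, hgs⟩ : ∃ g s, r ++ [j] = g :: s := List.exists_cons_of_ne_nil (by simp)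
  have e' : i :: q ++ [j] = [] ++ i :: f :: g :: s := by rw [e]; simp [hgs]
  refine ⟨g, nb_of_edges (A := []) (B := s) (e' ▸ h.trio.sp1.1) ?_ ?_⟩
  · intro T w hT he
    obtain ⟨p, -, rfl⟩ := hT.exists_mid hS.ne hS.na
    rcases h.trio.all _ hT with rfl | rfl | rfl
    · rwa [e'] at he
    · exact absurd (mem_left_of_mem_es he) hf2
    · rcases hes _ he with he | he
      · rwa [e'] at he
      · exact absurd (mem_left_of_mem_es he) hf2
  · intro w hw hr
    obtain ⟨P, hP, hwP⟩ := hw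
    have hfon : OnSP R n i j f := ⟨_, h.trio.sp1, by simp [hfm]⟩
    obtain ⟨p, hp, rfl⟩ := hP.exists_mid hS.ne hS.na
    have hwp := hr.mem_mid hS.symm hfon hwP
    rcases h.trio.all _ hP with rfl | rfl | rfl
    · exact hr.not_mem hS.symm h.trio.sp1 (by simp [hfm]) (by simp [hwp])
    · exact h.trio.swap12.swap23.same_last hS (hr.symm hS.symm) hwp hfm'' h.hl' h.hl''
        (by rw [h.hl]; simpa using h.nel)
    · exact hr.not_mem hS.symm h.trio.sp3 (by simp [hfm'']) (by simp [hwp])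

/-- The remaining configuration with `f` and `l'` both shared is impossible. -/
theorem TwinPaths.false_of_mem {x y : V} (hS : Setting R n i j)
    (h : TwinPaths R n i j f f' l l' x y q q' q'') (hf : f ∈ q') (hl : l' ∈ q) (hne : f ≠ l') :
    False := by
  have hy' := h.y_not_mem hS
  have hx' := (h.reverse hS.symm).y_not_mem hS.reverse
  rw [List.mem_reverse] at hx'
  have i1 := h.trio.sp1.inner h.hf h.hl
  have i2 := h.trio.sp2.inner h.hf' h.hl'
  obtain ⟨u, W, e2⟩ := List.append_of_mem hf
  obtain ⟨A, t, e1⟩ := List.append_of_mem hl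
  have k1 : f :: W = q'' := by
    have hT := (e2 ▸ h.trio.sp2).drop_start i1.1
    have hl2 := h.hl'
    rw [e2, getLast?_app] at hl2
    rcases h.trio.all _ hT with e | e | e
    · have := h.hl; rw [← e, hl2] at this; simp at this; exact absurd this.symm h.nel
    · have := h.hf'; rw [← e] at this; simp at this; exact absurd this h.nef
    · exact e
  have k2 : A ++ [l'] = q'' := by
    have hT := (e1 ▸ h.trio.sp1).drop_end i2.2.1
    have hf2 : (A ++ [l']).head? = some f := by
      have := h.hf
      rw [e1] at this
      cases A with
      | nil => simp at this; exact absurd this.symm hne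
      | cons a A => simpa using this
    rcases h.trio.all _ hT with e | e | e
    · have := h.hl; rw [← e] at this; simp at this; exact absurd this.symm h.nel
    · have := h.hf'; rw [← e, hf2] at this; simp at this; exact absurd this h.nef
    · exact e
  obtain ⟨w, rfl⟩ : ∃ w, A = f :: w := by
    cases A with
    | nil => rw [← k1] at k2; simp at k2; exact absurd k2.1.symm hne
    | cons a A => rw [← k1] at k2; simp at k2; exact ⟨A, by rw [k2.1]⟩
  have hW : W = w ++ [l'] := by rw [← k2] at k1; simpa using k1
  subst hW
  have hxt : x ∈ t := by
    have := h.hx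
    rw [e1] at this; rw [← k1] at hx'
    simp at this hx' ⊢; tauto
  have hyu : y ∈ u := by
    have := h.hy
    rw [e2] at this; rw [← k1] at hy'
    simp at this hy' ⊢; tauto
  obtain ⟨t1, t2, rfl⟩ := List.append_of_mem hxt
  obtain ⟨u1, u2, rfl⟩ := List.append_of_mem hyu
  have c1 := h.trio.sp1.2.1
  have c2 := h.trio.sp2.2.1
  have n1 := h.trio.sp1.1
  have n2 := h.trio.sp2.1
  have g1 := h.trio.sp1.2.2.2.2
  have g2 := h.trio.sp2.2.2.2.2
  rw [e1] at c1 n1 g1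
  rw [e2] at c2 n2 g2
  have hxy := h.rung.2.1
  have hyx := hS.symm _ _ hxy
  have s1 : (f :: u2.reverse ++ [y]).IsChain R := by
    have : i :: (u1 ++ y :: u2 ++ f :: (w ++ [l'])) ++ [j] =
        (i :: u1) ++ (y :: u2 ++ [f]) ++ (w ++ [l', j]) := by simp
    rw [this] at c2
    have := chain_reverse hS.symm c2.left_of_append.right_of_append
    simpa using this
  have s2 : (x :: t2 ++ [j]).IsChain R := by
    have : i :: (f :: w ++ l' :: (t1 ++ x :: t2)) ++ [j] =
        (i :: f :: w ++ l' :: t1) ++ (x :: t2 ++ [j]) := by simp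
    rw [this] at c1
    exact c1.right_of_append
  have s3 : (i :: u1 ++ [y]).IsChain R := by
    have : i :: (u1 ++ y :: u2 ++ f :: (w ++ [l'])) ++ [j] =
        (i :: u1 ++ [y]) ++ (u2 ++ f :: w ++ [l', j]) := by simp
    rw [this] at c2
    exact c2.left_of_append
  have s4 : (x :: t1.reverse ++ [l']).IsChain R := by
    have : i :: (f :: w ++ l' :: (t1 ++ x :: t2)) ++ [j] =
        (i :: f :: w) ++ (l' :: t1 ++ [x]) ++ (t2 ++ [j]) := by simp
    rw [this] at c1
    have := chain_reverse hS.symm c1.left_of_append.right_of_append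
    simpa using this
  have join : ∀ (X Y : List V) (a b : V), (X ++ [a]).IsChain R → (b :: Y).IsChain R → R a b →
      (X ++ a :: b :: Y).IsChain R := by
    intro X Y a b hX hY hab
    have : X ++ a :: b :: Y = (X ++ [a]) ++ (b :: Y) := by simp
    rw [this, List.isChain_append]
    refine ⟨hX, hY, ?_⟩
    intro v hv z hz
    simp at hv hz
    subst hv hz; exact hab
  have w1 : (i :: (f :: u2.reverse) ++ y :: x :: (t2 ++ [j])).IsChain R :=
    join (i :: f :: u2.reverse) (t2 ++ [j]) y x (by
      simp only [List.cons_append, List.isChain_cons_cons] at s1 ⊢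
      exact ⟨i1.1, by simpa using s1⟩) (by simpa using s2) hyx
  have w2 : (i :: u1 ++ y :: x :: (t1.reverse ++ [l', j])).IsChain R := by
    refine join _ _ _ _ s3 ?_ hyx
    have := join (x :: t1.reverse) [] l' j s4 (by simp) i2.2.1
    simpa using this
  have all3 : ∀ T v, SP R n i j T → v ∈ q → v ∈ q' → v ∈ q'' → v ∈ T := by
    intro T v hT h1 h2 h3
    obtain ⟨p, -, rfl⟩ := hT.exists_mid hS.ne hS.na
    have : v ∈ p := by rcases h.trio.all _ hT with rfl | rfl | rfl <;> assumption
    simp [this]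
  have hxl : x ≠ l' := by rintro rfl; rw [← k1] at hx'; simp at hx'
  have hyf : y ≠ f := by rintro rfl; rw [← k1] at hy'; simp at hy'
  have hyl : y ≠ l' := by rintro rfl; rw [← k1] at hy'; simp at hy'
  have hxf : x ≠ f := by rintro rfl; rw [← k1] at hx'; simp at hx'
  have hij := hS.ne
  by_cases hlen : (i :: (f :: u2.reverse) ++ y :: x :: (t2 ++ [j])).length ≤ n + 1
  · obtain ⟨T, hT, hTs⟩ := walk_to_path (n := n) (a := i) (b := j) _ w1 rfl (by
      rw [getLast?_app]; simp [List.getLast?_cons]) hlen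
    have := hTs _ (all3 T l' hT hl (List.mem_of_getLast? h.hl') (List.mem_of_getLast? h.hl''))
    simp only [List.nodup_append, List.nodup_cons, List.mem_append, List.mem_cons,
      List.cons_append, List.mem_reverse, List.not_mem_nil, or_false, not_or] at n1 n2 this
    grind
  · obtain ⟨T, hT, hTs⟩ := walk_to_path (n := n) (a := i) (b := j) _ w2 rfl (by
      rw [getLast?_app]; simp [List.getLast?_cons]) (by
      simp at hlen g1 g2 ⊢; omega)
    have := hTs _ (all3 T f hT (List.mem_of_head? h.hf) hf (List.mem_of_head? h.hf''))
    simp only [List.nodup_append, List.nodup_cons, List.mem_append, List.mem_cons,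
      List.cons_append, List.mem_reverse, List.not_mem_nil, or_false, not_or] at n1 n2 this
    grind

/-- The local structure of a pair of paths with a third crossing from one to the other. -/
def Twin (R : V → V → Prop) (U : Set V) (i j : V) : Prop :=
  ∃ f f' l l', Nb R U i [f, f'] ∧ Nb R U j [l, l'] ∧ (∃ g, Nb R U f' [i, g]) ∧
    (∃ g, Nb R U l [j, g]) ∧
    ((∃ g, Nb R U f [i, g]) ∨ (∃ g, Nb R U l' [j, g]) ∨ R f l' ∨ f = l')

theorem TwinPaths.twin {x y : V} (hS : Setting R n i j)
    (h : TwinPaths R n i j f f' l l' x y q q' q'')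
    (hes : R f l' ∨
      ∀ e ∈ es (i :: q'' ++ [j]), e ∈ es (i :: q ++ [j]) ∨ e ∈ es (i :: q' ++ [j])) :
    Twin R {v | OnSP R n i j v} i j := by
  have hr := h.reverse hS.symm
  have hU := onSP_reverse (n := n) (i := i) (j := j) hS.symm
  refine ⟨f, f', l, l', ?_, ?_, h.nb_f' hS, ?_, ?_⟩
  · intro w hw h1 h2
    have := h.trio.nb_start hS h.hf h.hf' h.hf'' w hw h1 h2
    simp at this ⊢; tauto
  · intro w hw h1 h2
    have := h.trio.nb_end hS h.hl h.hl' h.hl'' w hw h1 h2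
    simp at this ⊢; tauto
  · rw [← hU]; exact hr.nb_f' hS.reverse
  · rcases hes with hes | hes
    · tauto
    by_cases h1 : f ∈ q'
    · by_cases h2 : l' ∈ q
      · by_cases h3 : f = l'
        · tauto
        · exact (h.false_of_mem hS h1 h2 h3).elim
      · right; left
        rw [← hU]
        refine hr.nb_f hS.reverse (by simpa using h2) fun e he => ?_
        have r : ∀ q : List V, j :: q.reverse ++ [i] = (i :: q ++ [j]).reverse := by simp
        rw [r, mem_es_reverse] at he ⊢
        rw [r, mem_es_reverse]
        exact (hes e he).symm
    · exact Or.inl (h.nb_f hS h1 hes)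
end ShortPath

namespace ShortPath
variable {V : Type u} {R : V → V → Prop} {n : ℕ} {i j x y : V} {q1 q2 q3 : List V}

/-- A third path with the same first inner vertex forces a cross edge. -/
theorem Trio.cross_adj (hS : Setting R n i j) (t : Trio R n i j q1 q2 q3)
    (h : Rung R n i j x y) (hx : x ∈ q1) (hy : y ∈ q2) (hd : ∀ v ∈ q1, v ∉ q2) {f l : V}
    (h1 : q1.head? = some f) (h2 : q2.getLast? = some l) (h3 : q3.head? = some f) : R f l := by
  by_contra hna
  have hfm : f ∈ q1 := List.mem_of_head? h1
  have hlm : l ∈ q2 := List.mem_of_getLast? h2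
  have hfl : f ≠ l := fun hh => hd f hfm (hh ▸ hlm)
  obtain ⟨c1, c2, -⟩ := h.cross_paths hS.symm t.sp1 t.sp2 hd hx hy h1 h2
  obtain ⟨p, c3, c4, c5, c6⟩ := h.cross_list hS.symm t.sp1 t.sp2 hd hx hy h1 h2
  obtain ⟨-, -, a2, a3, -⟩ := t.sp1.inner h1 (l := q1.getLast (by rintro rfl; simp at h1))
    (List.getLast?_eq_some_getLast _)
  obtain ⟨-, b1, b2, b3, -⟩ := t.sp2.inner (f := q2.head (by rintro rfl; simp at h2))
    (List.head?_eq_some_head _) h2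
  have hl3 : q3.getLast? = some (q3.getLast (by rintro rfl; simp at h3)) :=
    List.getLast?_eq_some_getLast _
  obtain ⟨-, d1, d2, d3, d4⟩ := t.sp3.inner h3 hl3
  have hij := hS.ne
  have len3 := t.sp3.2.2.2.2
  have ch3 := t.sp3.2.1
  have hes3 : ∀ e ∈ es q3, e ∈ es (i :: q3 ++ [j]) := fun e he => mem_es_of_infix_of (L := [i]) he
  have hr3 : s(x, y) ∉ es q3 := fun he => h.2.2 _ t.sp3 (hes3 _ he)
  have hli : l ≠ i := fun hh => b2 (hh ▸ hlm)
  have hlj : l ≠ j := fun hh => b3 (hh ▸ hlm)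
  have hxj : x ≠ j := fun hh => a3 (hh ▸ hx)
  have hyj : y ≠ j := fun hh => b3 (hh ▸ hy)
  by_cases hl : l ∈ q3
  · obtain ⟨A, B, rfl⟩ := List.append_of_mem hl
    have e : A ++ l :: B = (A ++ [l]) ++ B := by simp
    have hA : (A ++ [l]).head? = some f := by
      cases A with
      | nil => simp at h3; exact absurd h3.symm hfl
      | cons a A => simp at h3; simp [h3]
    have sp4 : SP R n f l (A ++ [l]) := by
      refine ⟨?_, ?_, hA, by simp, ?_⟩
      · rw [e] at d4; exact (List.nodup_append.1 d4).1
      · have e' : i :: (A ++ l :: B) ++ [j] = i :: ((A ++ [l]) ++ (B ++ [j])) := by simp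
        rw [e'] at ch3; exact ch3.tail.left_of_append
      · simp at len3 ⊢; omega
    have hsub : ∀ v ∈ A ++ [l], v ∈ A ++ l :: B := by intro v; simp; tauto
    refine hS.bound.false_of_four hfl hna c1 c2 c3 sp4 ?_
    have k1 : f :: i :: q2 ≠ A ++ [l] := fun hh => d2 (hsub _ (by rw [← hh]; simp))
    have k2 : q1 ++ [j, l] ≠ A ++ [l] := fun hh => d3 (hsub _ (by rw [← hh]; simp))
    have k3 : p ≠ A ++ [l] := by
      rintro rfl
      exact hr3 (by rw [e]; exact mem_es_of_infix_of (L := []) c4)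
    simp only [List.nodup_cons, List.mem_cons, List.not_mem_nil, or_false, not_or,
      List.nodup_nil, not_false_eq_true, and_true] at c6 ⊢
    tauto
  · have e : q3 ++ [j, l] = (q3 ++ [j]) ++ [l] := by simp
    have sp4 : SP R n f l (q3 ++ [j, l]) := by
      refine ⟨?_, ?_, ?_, by simp, ?_⟩
      · rw [List.nodup_append]
        refine ⟨d4, by simp; exact hlj.symm, ?_⟩
        intro v hv w hw
        simp at hw
        rcases hw with rfl | rfl
        · rintro rfl; exact d3 hv
        · rintro rfl; exact hl hv
      · rw [e, List.isChain_append]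
        refine ⟨ch3.tail, by simp, ?_⟩
        intro v hv z hz
        rw [List.getLast?_append] at hv
        simp at hv hz
        subst hv hz
        exact hS.symm _ _ b1
      · cases q3 <;> simp at h3 ⊢; exact h3
      · simp at len3 ⊢; omega
    have hjl : s(j, l) ∈ es (q3 ++ [j, l]) := mem_es_iff.2 ⟨q3, [], Or.inl rfl⟩
    refine hS.bound.false_of_four hfl hna c1 c2 c3 sp4 ?_
    have k1 : f :: i :: q2 ≠ q3 ++ [j, l] := by
      intro hh
      have : i ∈ q3 ++ [j, l] := by rw [← hh]; simp
      simp at this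
      rcases this with h | h | h
      · exact d2 h
      · exact hij h
      · exact hli h.symm
    have k2 : q1 ++ [j, l] ≠ q3 ++ [j, l] := fun hh =>
      t.ne13 (List.append_cancel_right hh)
    have k3 : p ≠ q3 ++ [j, l] := by
      rintro rfl
      rcases c5 _ hjl with h' | h' | h'
      · have : j ∈ s(x, y) := by rw [← h']; simp
        simp at this
        rcases this with h | h
        · exact hxj h.symm
        · exact hyj h.symm
      · exact a3 (mem_left_of_mem_es h')
      · exact b3 (mem_left_of_mem_es h')
    simp only [List.nodup_cons, List.mem_cons, List.not_mem_nil, or_false, not_or,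
      List.nodup_nil, not_false_eq_true, and_true] at c6 ⊢
    tauto

/-- A trio of short paths that pairwise meet only at their ends. -/
structure Prism (R : V → V → Prop) (n : ℕ) (i j : V) (q1 q2 q3 : List V) (f1 f2 f3 l1 l2 l3 : V) :
    Prop where
  trio : Trio R n i j q1 q2 q3
  hf1 : q1.head? = some f1
  hf2 : q2.head? = some f2
  hf3 : q3.head? = some f3
  hl1 : q1.getLast? = some l1
  hl2 : q2.getLast? = some l2
  hl3 : q3.getLast? = some l3
  d12 : ∀ v ∈ q1, v ∉ q2
  d13 : ∀ v ∈ q1, v ∉ q3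
  d23 : ∀ v ∈ q2, v ∉ q3

theorem Trio.twin_or_prism (hS : Setting R n i j) (t : Trio R n i j q1 q2 q3)
    (h : Rung R n i j x y) (hx : x ∈ q1) (hy : y ∈ q2) {f1 f2 f3 l1 l2 l3 : V}
    (hf1 : q1.head? = some f1) (hf2 : q2.head? = some f2) (hf3 : q3.head? = some f3)
    (hl1 : q1.getLast? = some l1) (hl2 : q2.getLast? = some l2) (hl3 : q3.getLast? = some l3)
    (hf : ¬ (f1 = f2 ∧ f1 = f3)) (hl : ¬ (l1 = l2 ∧ l1 = l3)) :
    Twin R {v | OnSP R n i j v} i j ∨ Prism R n i j q1 q2 q3 f1 f2 f3 l1 l2 l3 := by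
  have nf : f1 ≠ f2 := by
    rintro rfl
    exact t.same_first hS h hx hy hf1 hf2 (by rw [hf3]; simp at hf ⊢; exact fun h => hf h.symm)
  have nl : l1 ≠ l2 := by
    rintro rfl
    exact t.same_last hS h hx hy hl1 hl2 (by rw [hl3]; simp at hl ⊢; exact fun h => hl h.symm)
  have tA : f3 = f1 → l3 = l2 → TwinPaths R n i j f1 f2 l1 l2 x y q1 q2 q3 := by
    rintro rfl rfl
    exact ⟨t, h, hx, hy, hf1, hf2, hf3, hl1, hl2, hl3, nf, nl⟩
  have tB : f3 = f2 → l3 = l1 → TwinPaths R n i j f2 f1 l2 l1 y x q2 q1 q3 := by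
    rintro rfl rfl
    exact ⟨t.swap12, h.symm hS.symm, hy, hx, hf2, hf1, hf3, hl2, hl1, hl3, nf.symm, nl.symm⟩
  have e1 : s(i, f1) ∈ es (i :: q1 ++ [j]) := (mem_first_edge t.sp1.1 hf1).2 rfl
  have e1' : s(l1, j) ∈ es (i :: q1 ++ [j]) := (mem_last_edge (r := [i]) t.sp1.1 hl1).2 rfl
  have e2 : s(i, f1) ∉ es (i :: q2 ++ [j]) := fun hh => nf ((mem_first_edge t.sp2.1 hf2).1 hh)
  have e2' : s(l1, j) ∉ es (i :: q2 ++ [j]) := fun hh =>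
    nl ((mem_last_edge (r := [i]) t.sp2.1 hl2).1 hh)
  by_cases hd : ∃ v ∈ q1, v ∈ q2
  · left
    obtain ⟨v, hv, hv'⟩ := hd
    obtain ⟨T, hT, hTe, hT2⟩ := exchange_mid hS.symm t.sp1 t.sp2 hf1 hl1 e2 e2'
      ⟨v, hv, by simp [hv']⟩
    obtain ⟨q, -, rfl⟩ := hT.exists_mid hS.ne hS.na
    rcases t.all _ hT with rfl | rfl | rfl
    · tauto
    · tauto
    rw [mem_first_edge hT.1 hf3] at hT2
    have := mem_last_edge (r := [i]) (g := l1) hT.1 hl3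
    rw [show [i] ++ q ++ [j] = i :: q ++ [j] from rfl] at this
    rw [this] at hT2
    have k1 := hTe _ ((mem_first_edge hT.1 hf3).2 rfl)
    have k2 := hTe _ ((mem_last_edge (r := [i]) hT.1 hl3).2 rfl)
    rw [mem_first_edge t.sp1.1 hf1, mem_first_edge t.sp2.1 hf2] at k1
    have m1 := mem_last_edge (r := [i]) (g := l3) t.sp1.1 hl1
    have m2 := mem_last_edge (r := [i]) (g := l3) t.sp2.1 hl2
    rw [show [i] ++ q1 ++ [j] = i :: q1 ++ [j] from rfl] at m1
    rw [show [i] ++ q2 ++ [j] = i :: q2 ++ [j] from rfl] at m2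
    rw [m1, m2] at k2
    rcases hT2 with ⟨g1, g2⟩ | ⟨g1, g2⟩
    · exact (tA g1.symm (by rcases k2 with k | k; exact absurd k.symm g2; exact k)).twin hS
        (Or.inr hTe)
    · exact (tB (by rcases k1 with k | k; exact absurd k.symm g1; exact k) g2.symm).twin hS
        (Or.inr fun e he => (hTe e he).symm)
  · have d12 : ∀ v ∈ q1, v ∉ q2 := fun v h1 h2 => hd ⟨v, h1, h2⟩
    have d21 : ∀ v ∈ q2, v ∉ q1 := fun v h1 h2 => hd ⟨v, h2, h1⟩
    obtain ⟨a1, a2, a3, a4, -⟩ := t.sp1.inner hf1 hl1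
    obtain ⟨b1, b2, b3, b4, -⟩ := t.sp2.inner hf2 hl2
    have mf1 := List.mem_of_head? hf1
    have mf2 := List.mem_of_head? hf2
    have ml1 := List.mem_of_getLast? hl1
    have ml2 := List.mem_of_getLast? hl2
    have four : ∀ f l, R f l → R i f → R l j → f ≠ l → f ≠ i → f ≠ j → l ≠ i → l ≠ j →
        [f, l] = q1 ∨ [f, l] = q2 ∨ [f, l] = q3 := by
      intro f l h1 h2 h3 h4 h5 h6 h7 h8
      exact t.all _ (sp_four hS.hn hS.ne h2 h1 h3 h5.symm h7.symm h4 h6 h8)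
    have key1 : R f1 l2 → Twin R {v | OnSP R n i j v} i j := by
      intro hr
      rcases four f1 l2 hr a1 b2 (fun hh => d12 _ mf1 (hh ▸ ml2)) (fun hh => a3 (hh ▸ mf1))
        (fun hh => a4 (hh ▸ mf1)) (fun hh => b3 (hh ▸ ml2)) (fun hh => b4 (hh ▸ ml2)) with e | e | e
      · rw [← e] at hl1; simp at hl1; exact absurd hl1.symm nl
      · rw [← e] at hf2; simp at hf2; exact absurd hf2 nf
      · rw [← e] at hf3 hl3; simp at hf3 hl3
        exact (tA hf3.symm hl3.symm).twin hS (Or.inl hr)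
    have key2 : R f2 l1 → Twin R {v | OnSP R n i j v} i j := by
      intro hr
      rcases four f2 l1 hr b1 a2 (fun hh => d12 _ ml1 (hh ▸ mf2)) (fun hh => b3 (hh ▸ mf2))
        (fun hh => b4 (hh ▸ mf2)) (fun hh => a3 (hh ▸ ml1)) (fun hh => a4 (hh ▸ ml1)) with e | e | e
      · rw [← e] at hf1; simp at hf1; exact absurd hf1.symm nf
      · rw [← e] at hl2; simp at hl2; exact absurd hl2 nl
      · rw [← e] at hf3 hl3; simp at hf3 hl3
        exact (tB hf3.symm hl3.symm).twin hS (Or.inl hr)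
    by_cases c1 : f3 = f1
    · exact Or.inl (key1 (t.cross_adj hS h hx hy d12 hf1 hl2 (c1 ▸ hf3)))
    by_cases c2 : f3 = f2
    · exact Or.inl (key2 (t.swap12.cross_adj hS (h.symm hS.symm) hy hx d21 hf2 hl1 (c2 ▸ hf3)))
    by_cases c3 : l3 = l1
    · exact Or.inl (key2 (hS.symm _ _ ((t.reverse hS.symm).cross_adj hS.reverse
        (h.reverse hS.symm) (by simpa using hx) (by simpa using hy) (by simpa using d12)
        (by simpa using hl1) (by simpa using hf2) (by simpa using c3 ▸ hl3))))
    by_cases c4 : l3 = l2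
    · exact Or.inl (key1 (hS.symm _ _ ((t.swap12.reverse hS.symm).cross_adj hS.reverse
        (h.reverse' hS.symm) (by simpa using hy) (by simpa using hx) (by simpa using d21)
        (by simpa using hl2) (by simpa using hf1) (by simpa using c4 ▸ hl3))))
    right
    have disj : ∀ (q : List V) (f l : V), SP R n i j (i :: q ++ [j]) →
        q.head? = some f → q.getLast? = some l → f3 ≠ f → l3 ≠ l →
        ∀ v ∈ q, v ∉ q3 := by
      intro q f l hq hf hl hne1 hne2 v hv hv'
      have k1 : s(i, f3) ∉ es (i :: q ++ [j]) := fun hh => hne1 ((mem_first_edge hq.1 hf).1 hh)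
      have k2 : s(l3, j) ∉ es (i :: q ++ [j]) := fun hh =>
        hne2 ((mem_last_edge (r := [i]) hq.1 hl).1 hh)
      obtain ⟨T, hT, hTe, hT2⟩ := exchange_mid hS.symm t.sp3 hq hf3 hl3 k1 k2
        ⟨v, hv', by simp [hv]⟩
      obtain ⟨p, -, rfl⟩ := hT.exists_mid hS.ne hS.na
      have fin : ∀ (f l : V), p.head? = some f → p.getLast? = some l →
          (f3 ≠ f ∧ l3 ≠ l ∨ f3 = f ∧ l3 = l) → False := by
        intro f l hf hl hne
        have m := mem_first_edge (g := f3) hT.1 hf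
        have o : s(l3, j) ∈ es (i :: p ++ [j]) ↔ l3 = l := mem_last_edge (r := [i]) hT.1 hl
        rw [m, o] at hT2
        rcases hT2 with ⟨g1, g2⟩ | ⟨g1, g2⟩ <;> rcases hne with ⟨g3, g4⟩ | ⟨g3, g4⟩ <;>
          contradiction
      rcases t.all _ hT with rfl | rfl | rfl
      · exact fin f1 l1 hf1 hl1 (Or.inl ⟨c1, c3⟩)
      · exact fin f2 l2 hf2 hl2 (Or.inl ⟨c2, c4⟩)
      · exact fin f3 l3 hf3 hl3 (Or.inr ⟨rfl, rfl⟩)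
    exact ⟨t, hf1, hf2, hf3, hl1, hl2, hl3, d12,
      disj q1 f1 l1 t.sp1 hf1 hl1 c1 c3, disj q2 f2 l2 t.sp2 hf2 hl2 c2 c4⟩
end ShortPath

namespace ShortPath
variable {V : Type u} {R : V → V → Prop} {n : ℕ} {i j x y : V} {q1 q2 q3 : List V}
  {f1 f2 f3 l1 l2 l3 : V}

theorem Trio.fewEdges_aux (t : Trio R n i j q1 q2 q3) (hS : Setting R n i j)
    (hf1 : q1.head? = some f1) (hf2 : q2.head? = some f2) (hf3 : q3.head? = some f3)
    (h1 : f3 ≠ f1) (h2 : f3 ≠ f2)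
    (hr : ∀ a b, OnSP R n i j a → OnSP R n i j b → ¬ Rung R n i j a b) :
    FewEdges R n i j 3 := by
  classical
  have hall : ∀ T, SP R n i j T → T = i :: q1 ++ [j] ∨ T = i :: q2 ++ [j] ∨ T = i :: q3 ++ [j] := by
    intro T hT
    obtain ⟨q, -, rfl⟩ := hT.exists_mid hS.ne hS.na
    rcases t.all _ hT with rfl | rfl | rfl <;> simp
  have hc := count_three hS.symm t.sp1 t.sp2 t.sp3 hall (e0 := s(i, f3))
    ((mem_first_edge t.sp3.1 hf3).2 rfl) (fun h => h1 ((mem_first_edge t.sp1.1 hf1).1 h))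
    (fun h => h2 ((mem_first_edge t.sp2.1 hf2).1 h))
  refine ⟨(es (i :: q1 ++ [j])).toFinset ∪ (es (i :: q2 ++ [j])).toFinset ∪
    (es (i :: q3 ++ [j])).toFinset, ?_, ?_⟩
  · intro a b ha hb hab hRab
    rcases rung_or n i j hab hRab with ⟨T, hT, he⟩ | h
    · simp only [Finset.mem_union, List.mem_toFinset]
      rcases hall T hT with rfl | rfl | rfl <;> tauto
    · exact absurd h (hr a b ha hb)
  · have hU : {v | OnSP R n i j v} = ↑((i :: q1 ++ [j]).toFinset ∪ (i :: q2 ++ [j]).toFinset ∪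
        (i :: q3 ++ [j]).toFinset) := by
      ext v
      simp only [Set.mem_ofPred_eq, Finset.coe_union, Set.mem_union, Finset.mem_coe,
        List.mem_toFinset]
      constructor
      · rintro ⟨P, hP, hv⟩; rcases hall P hP with rfl | rfl | rfl <;> tauto
      · rintro ((h | h) | h)
        · exact ⟨_, t.sp1, h⟩
        · exact ⟨_, t.sp2, h⟩
        · exact ⟨_, t.sp3, h⟩
    rw [hU, Set.ncard_coe_finset]; omega

theorem Trio.fewEdges (t : Trio R n i j q1 q2 q3) (hS : Setting R n i j)
    (hf1 : q1.head? = some f1) (hf2 : q2.head? = some f2) (hf3 : q3.head? = some f3)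
    (hf : ¬ (f1 = f2 ∧ f1 = f3))
    (hr : ∀ a b, OnSP R n i j a → OnSP R n i j b → ¬ Rung R n i j a b) :
    FewEdges R n i j 3 := by
  by_cases h12 : f1 = f2
  · have h13 : f3 ≠ f1 := fun h => hf ⟨h12, h.symm⟩
    exact t.fewEdges_aux hS hf1 hf2 hf3 h13 (h12 ▸ h13) hr
  by_cases h13 : f1 = f3
  · exact t.swap23.fewEdges_aux hS hf1 hf3 hf2 (Ne.symm h12) (h13 ▸ Ne.symm h12) hr
  · exact t.swap12.swap23.fewEdges_aux hS hf2 hf3 hf1 h12 h13 hr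

theorem Prism.swap12 (p : Prism R n i j q1 q2 q3 f1 f2 f3 l1 l2 l3) :
    Prism R n i j q2 q1 q3 f2 f1 f3 l2 l1 l3 :=
  ⟨p.trio.swap12, p.hf2, p.hf1, p.hf3, p.hl2, p.hl1, p.hl3, fun v h h' => p.d12 v h' h, p.d23,
    p.d13⟩

theorem Prism.swap23 (p : Prism R n i j q1 q2 q3 f1 f2 f3 l1 l2 l3) :
    Prism R n i j q1 q3 q2 f1 f3 f2 l1 l3 l2 :=
  ⟨p.trio.swap23, p.hf1, p.hf3, p.hf2, p.hl1, p.hl3, p.hl2, p.d13, p.d12,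
    fun v h h' => p.d23 v h' h⟩

theorem Prism.reverse (hR : ∀ a b, R a b → R b a)
    (p : Prism R n i j q1 q2 q3 f1 f2 f3 l1 l2 l3) :
    Prism R n j i q1.reverse q2.reverse q3.reverse l1 l2 l3 f1 f2 f3 where
  trio := p.trio.reverse hR
  hf1 := by simpa using p.hl1
  hf2 := by simpa using p.hl2
  hf3 := by simpa using p.hl3
  hl1 := by simpa using p.hf1
  hl2 := by simpa using p.hf2
  hl3 := by simpa using p.hf3
  d12 := by simpa using p.d12
  d13 := by simpa using p.d13
  d23 := by simpa using p.d23

theorem Prism.not_adj (p : Prism R n i j q1 q2 q3 f1 f2 f3 l1 l2 l3) (hS : Setting R n i j) :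
    f1 ≠ l2 ∧ ¬ R f1 l2 := by
  obtain ⟨a1, a2, a3, a4, -⟩ := p.trio.sp1.inner p.hf1 p.hl1
  obtain ⟨b1, b2, b3, b4, -⟩ := p.trio.sp2.inner p.hf2 p.hl2
  have m1 := List.mem_of_head? p.hf1
  have m2 := List.mem_of_getLast? p.hl2
  have hne : f1 ≠ l2 := fun hh => p.d12 _ m1 (hh ▸ m2)
  refine ⟨hne, fun hr => ?_⟩
  have := sp_four hS.hn hS.ne a1 hr b2 (fun h => a3 (h ▸ m1)) (fun h => b3 (h ▸ m2)) hne
    (fun h => a4 (h ▸ m1)) (fun h => b4 (h ▸ m2))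
  rcases p.trio.all [f1, l2] this with e | e | e
  · exact p.d12 l2 (by rw [← e]; simp) m2
  · exact p.d12 f1 m1 (by rw [← e]; simp)
  · exact p.d13 f1 m1 (by rw [← e]; simp)

theorem Prism.rung_unique (p : Prism R n i j q1 q2 q3 f1 f2 f3 l1 l2 l3) (hS : Setting R n i j)
    {a b : V} (h : Rung R n i j x y) (hx : x ∈ q1) (hy : y ∈ q2) (h' : Rung R n i j a b)
    (ha : a ∈ q1) (hb : b ∈ q2) : s(a, b) = s(x, y) := by
  by_contra hcon
  obtain ⟨c1, c2, -⟩ := h.cross_paths hS.symm p.trio.sp1 p.trio.sp2 p.d12 hx hy p.hf1 p.hl2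
  obtain ⟨r, c3, c4, c5, c6⟩ :=
    h.cross_list hS.symm p.trio.sp1 p.trio.sp2 p.d12 hx hy p.hf1 p.hl2
  obtain ⟨r', d3, d4, d5, d6⟩ :=
    h'.cross_list hS.symm p.trio.sp1 p.trio.sp2 p.d12 ha hb p.hf1 p.hl2
  obtain ⟨n1, n2⟩ := p.not_adj hS
  refine hS.bound.false_of_four n1 n2 c1 c2 c3 d3 ?_
  have : r ≠ r' := by
    rintro rfl
    rcases c5 _ d4 with e | e | e
    · exact hcon e
    · exact h'.2.2 _ p.trio.sp1 (mem_es_of_infix_of (L := [i]) (N := [j]) e)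
    · exact h'.2.2 _ p.trio.sp2 (mem_es_of_infix_of (L := [i]) (N := [j]) e)
  simp only [List.nodup_cons, List.mem_cons, List.not_mem_nil, or_false, not_or,
    List.nodup_nil, not_false_eq_true, and_true] at c6 d6 ⊢
  tauto

/-- Rungs joining the third path to the other two at opposite ends exclude further rungs. -/
theorem Prism.no_rung (p : Prism R n i j q1 q2 q3 f1 f2 f3 l1 l2 l3) (hS : Setting R n i j)
    (r1 : Rung R n i j f1 f3) (r2 : Rung R n i j l3 l2) (hx : x ∈ q1) (hy : y ∈ q2) :
    ¬ Rung R n i j x y := by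
  intro h
  obtain ⟨c1, c2, -⟩ := h.cross_paths hS.symm p.trio.sp1 p.trio.sp2 p.d12 hx hy p.hf1 p.hl2
  obtain ⟨r, c3, c4, c5, c6⟩ :=
    h.cross_list hS.symm p.trio.sp1 p.trio.sp2 p.d12 hx hy p.hf1 p.hl2
  obtain ⟨n1, n2⟩ := p.not_adj hS
  obtain ⟨-, -, a3, a4, -⟩ := p.trio.sp1.inner p.hf1 p.hl1
  obtain ⟨-, -, b3, b4, -⟩ := p.trio.sp2.inner p.hf2 p.hl2
  obtain ⟨-, -, e3, e4, e5⟩ := p.trio.sp3.inner p.hf3 p.hl3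
  have m1 := List.mem_of_head? p.hf1
  have m2 := List.mem_of_getLast? p.hl2
  have m3 := List.mem_of_head? p.hf3
  obtain ⟨t, ht⟩ := List.head?_eq_some_iff.1 p.hf3
  have ch := p.trio.sp3.2.1.tail.left_of_append (l₁ := q3) (l₂ := [j])
  have sp : SP R n f1 l2 (f1 :: q3 ++ [l2]) := by
    refine ⟨?_, ?_, by simp, by rw [List.getLast?_append]; simp, ?_⟩
    · rw [List.nodup_append]
      refine ⟨List.nodup_cons.2 ⟨p.d13 _ m1, e5⟩, by simp, ?_⟩
      intro v hv w hw
      simp only [List.mem_cons, List.not_mem_nil, or_false] at hv hw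
      subst hw
      rcases hv with rfl | hv
      · exact n1
      · rintro rfl; exact p.d23 _ m2 hv
    · rw [List.isChain_append]
      refine ⟨?_, by simp, ?_⟩
      · rw [ht] at ch ⊢; exact List.IsChain.cons_cons r1.2.1 ch
      · intro v hv w hw
        have hl := p.hl3
        rw [ht] at hv hl
        simp only [List.getLast?_cons_cons, hl, Option.mem_def, Option.some.injEq, List.head?_cons] at hv hw
        subst hv hw
        exact r2.2.1
    · have := p.trio.sp3.2.2.2.2
      simp at this ⊢; omega
  have he : s(f1, f3) ∈ es (f1 :: q3 ++ [l2]) := by rw [ht]; simp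
  refine hS.bound.false_of_four n1 n2 c1 c2 c3 sp ?_
  have k1 : f1 :: i :: q2 ≠ f1 :: q3 ++ [l2] := by
    intro hh
    rw [ht] at hh
    simp at hh
    exact e3 (hh.1 ▸ m3)
  have k2 : q1 ++ [j, l2] ≠ f1 :: q3 ++ [l2] := by
    intro hh
    have hj : j ∈ f1 :: q3 ++ [l2] := by rw [← hh]; simp
    simp only [List.mem_append, List.mem_cons, List.not_mem_nil, or_false] at hj
    rcases hj with (h | h) | h
    · exact a4 (h ▸ m1)
    · exact e4 h
    · exact b4 (h ▸ m2)
  have k3 : r ≠ f1 :: q3 ++ [l2] := by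
    rintro rfl
    rcases c5 _ he with e | e | e
    · have : f3 ∈ s(x, y) := by rw [← e]; simp
      simp only [Sym2.mem_iff] at this
      rcases this with rfl | rfl
      · exact p.d13 _ hx m3
      · exact p.d23 _ hy m3
    · exact p.d13 _ (mem_right_of_mem_es e) m3
    · exact p.d23 _ (mem_right_of_mem_es e) m3
  simp only [List.nodup_cons, List.mem_cons, List.not_mem_nil, or_false, not_or,
    List.nodup_nil, not_false_eq_true, and_true] at c6 ⊢
  tauto

theorem Prism.nb (p : Prism R n i j q1 q2 q3 f1 f2 f3 l1 l2 l3) (hS : Setting R n i j)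
    {a v b : V} {A B L : List V} (e : i :: q1 ++ [j] = A ++ a :: v :: b :: B) (hv : v ∈ q1)
    (hr : ∀ w, w ∈ q2 ∨ w ∈ q3 → Rung R n i j v w → w ∈ L) :
    Nb R {v | OnSP R n i j v} v (a :: b :: L) := by
  obtain ⟨-, -, a3, a4, -⟩ := p.trio.sp1.inner p.hf1 p.hl1
  have hvi : v ≠ i := fun h => a3 (h ▸ hv)
  have hvj : v ≠ j := fun h => a4 (h ▸ hv)
  refine nb_of_edges_rungs (e ▸ p.trio.sp1.1) ?_ ?_
  · intro T w hT he
    obtain ⟨q, -, rfl⟩ := hT.exists_mid hS.ne hS.na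
    have hm := mem_left_of_mem_es he
    simp only [List.mem_append, List.mem_cons, List.not_mem_nil, or_false, hvi, hvj,
      false_or] at hm
    rcases p.trio.all _ hT with rfl | rfl | rfl
    · rwa [e] at he
    · exact absurd hm (p.d12 v hv)
    · exact absurd hm (p.d13 v hv)
  · intro w hw h
    obtain ⟨P, hP, hwP⟩ := hw
    obtain ⟨q, -, rfl⟩ := hP.exists_mid hS.ne hS.na
    have hm := h.mem_mid hS.symm ⟨_, p.trio.sp1, by simp [hv]⟩ hwP
    rcases p.trio.all _ hP with rfl | rfl | rfl
    · exact absurd hwP (h.not_mem hS.symm p.trio.sp1 (by simp [hv]))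
    · exact hr w (Or.inl hm) h
    · exact hr w (Or.inr hm) h

/-- No two neighbours of `i` are adjacent, and each has just one further neighbour. -/
def Star (R : V → V → Prop) (U : Set V) (i : V) : Prop :=
  ∃ a b c, Nb R U i [a, b, c] ∧ (∃ g, Nb R U a [i, g]) ∧ (∃ g, Nb R U b [i, g]) ∧
    ∃ g, Nb R U c [i, g]

/-- The neighbourhood of `i` when exactly two of its neighbours `a` and `c` are adjacent. -/
def HalfPrism (R : V → V → Prop) (U : Set V) (i j a b c d : V) : Prop :=
  ∃ a2 a3 b2 c2, Nb R U i [a, b, c] ∧ Nb R U b [i, b2] ∧ Nb R U a [i, a2, c] ∧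
    Nb R U c [i, c2, a] ∧ Nb R U a2 [a, a3] ∧ ((∃ c3, Nb R U c2 [c, c3]) ∨ c2 = d) ∧
    j ∉ [a, b, c, a2, c2] ∧ R i c

theorem Prism.first_rung (p : Prism R n i j q1 q2 q3 f1 f2 f3 l1 l2 l3)
    (h : Rung R n i j f1 y) (hy : y ∈ q2) : y = f2 := by
  obtain ⟨a1, -, a3, a4, -⟩ := p.trio.sp1.inner p.hf1 p.hl1
  have m := List.mem_of_head? p.hf1
  exact h.eq_first p.trio.sp2 a1 p.hf2 (fun h => a3 (h ▸ m)) (fun h => a4 (h ▸ m)) (p.d12 _ m) hy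

theorem Prism.nb_first (p : Prism R n i j q1 q2 q3 f1 f2 f3 l1 l2 l3) (hS : Setting R n i j)
    (h2 : ¬ Rung R n i j f1 f2) (h3 : ¬ Rung R n i j f1 f3) :
    ∃ g, Nb R {v | OnSP R n i j v} f1 [i, g] := by
  obtain ⟨r, hr⟩ := List.head?_eq_some_iff.1 p.hf1
  obtain ⟨g, s, hgs⟩ : ∃ g s, r ++ [j] = g :: s := List.exists_cons_of_ne_nil (by simp)
  refine ⟨g, p.nb hS (A := []) (B := s) (L := []) (by rw [hr]; simp [hgs])
    (List.mem_of_head? p.hf1) ?_⟩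
  rintro w (hw | hw) h
  · exact absurd (p.first_rung h hw ▸ h) h2
  · exact absurd (p.swap23.first_rung h hw ▸ h) h3

theorem Prism.star (p : Prism R n i j q1 q2 q3 f1 f2 f3 l1 l2 l3) (hS : Setting R n i j)
    (h12 : ¬ Rung R n i j f1 f2) (h13 : ¬ Rung R n i j f1 f3) (h23 : ¬ Rung R n i j f2 f3) :
    Star R {v | OnSP R n i j v} i := by
  refine ⟨f1, f2, f3, p.trio.nb_start hS p.hf1 p.hf2 p.hf3, p.nb_first hS h12 h13,
    p.swap12.nb_first hS (fun h => h12 (h.symm hS.symm)) h23,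
    p.swap23.swap12.nb_first hS (fun h => h13 (h.symm hS.symm)) (fun h => h23 (h.symm hS.symm))⟩

theorem Prism.two_le (p : Prism R n i j q1 q2 q3 f1 f2 f3 l1 l2 l3) (hS : Setting R n i j)
    (h : Rung R n i j x y) (hx : x ∈ q1) (hy : y ∈ q2) :
    (∃ g r, q1 = f1 :: g :: r) ∧ f1 ≠ l1 := by
  obtain ⟨-, -, -, hlen, -⟩ :=
    h.cross_paths hS.symm p.trio.sp1 p.trio.sp2 p.d12 hx hy p.hf1 p.hl2
  have hn := hS.hn
  have hnd := (p.trio.sp1.inner p.hf1 p.hl1).2.2.2.2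
  obtain ⟨r, hr⟩ := List.head?_eq_some_iff.1 p.hf1
  have hl := p.hl1
  subst hr
  cases r with
  | nil => simp at hlen; omega
  | cons g r =>
    refine ⟨⟨g, r, rfl⟩, ?_⟩
    rintro rfl
    rw [List.getLast?_cons_cons] at hl
    exact (List.nodup_cons.1 hnd).1 (List.mem_of_getLast? hl)

theorem Prism.halfPrism (p : Prism R n i j q1 q2 q3 f1 f2 f3 l1 l2 l3) (hS : Setting R n i j)
    (r1 : Rung R n i j f1 f3) (r2 : Rung R n i j l3 l2) :
    HalfPrism R {v | OnSP R n i j v} i j f1 f2 f3 l3 := by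
  have m1 := List.mem_of_head? p.hf1
  have m2 := List.mem_of_head? p.hf2
  have m3 := List.mem_of_head? p.hf3
  have k2 := List.mem_of_getLast? p.hl2
  have k3 := List.mem_of_getLast? p.hl3
  have no := fun {x y} (hx : x ∈ q1) (hy : y ∈ q2) => p.no_rung hS r1 r2 hx hy
  have no' : ∀ {x y}, x ∈ q2 → y ∈ q1 → ¬ Rung R n i j x y :=
    fun hx hy h => no hy hx (h.symm hS.symm)
  have u13 : ∀ {x y}, Rung R n i j x y → x ∈ q1 → y ∈ q3 → x = f1 ∧ y = f3 := by
    intro x y h hx hy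
    have := p.swap23.rung_unique hS r1 m1 m3 h hx hy
    rw [Sym2.eq_iff] at this
    rcases this with h | ⟨rfl, -⟩
    · exact h
    · exact absurd m3 (p.d13 _ hx)
  have u32 : ∀ {x y}, Rung R n i j x y → x ∈ q3 → y ∈ q2 → x = l3 ∧ y = l2 := by
    intro x y h hx hy
    have := p.swap12.swap23.swap12.rung_unique hS r2 k3 k2 h hx hy
    rw [Sym2.eq_iff] at this
    rcases this with h | ⟨rfl, -⟩
    · exact h
    · exact absurd hx (p.d23 _ k2)
  obtain ⟨⟨a2, ra, e1⟩, -⟩ := p.swap23.two_le hS r1 m1 m3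
  obtain ⟨⟨c2, rc, e3⟩, ne3⟩ := p.swap12.swap23.swap12.two_le hS r2 k3 k2
  obtain ⟨⟨b2, rb, e2⟩, ne2⟩ := p.swap12.swap23.two_le hS (r2.symm hS.symm) k2 k3
  obtain ⟨-, -, -, j1, nd1⟩ := p.trio.sp1.inner p.hf1 p.hl1
  obtain ⟨-, -, -, j2, -⟩ := p.trio.sp2.inner p.hf2 p.hl2
  obtain ⟨i3, -, -, j3, nd3⟩ := p.trio.sp3.inner p.hf3 p.hl3
  obtain ⟨a3, ta, ha⟩ : ∃ g s, ra ++ [j] = g :: s := List.exists_cons_of_ne_nil (by simp)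
  obtain ⟨c3, tc, hc⟩ : ∃ g s, rc ++ [j] = g :: s := List.exists_cons_of_ne_nil (by simp)
  have ma2 : a2 ∈ q1 := by rw [e1]; simp
  have mc2 : c2 ∈ q3 := by rw [e3]; simp
  have na : a2 ≠ f1 := by rintro rfl; rw [e1] at nd1; simp at nd1
  have nc : c2 ≠ f3 := by rintro rfl; rw [e3] at nd3; simp at nd3
  refine ⟨a2, a3, b2, c2, p.trio.nb_start hS p.hf1 p.hf2 p.hf3, ?_, ?_, ?_, ?_, ?_, ?_, i3⟩
  · refine p.swap12.nb hS (A := []) (B := rb ++ [j]) (L := []) (by rw [e2]; simp) m2 ?_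
    rintro w (hw | hw) h
    · exact absurd h (no' m2 hw)
    · exact absurd (u32 (h.symm hS.symm) hw m2).2 ne2
  · refine p.nb hS (A := []) (B := ra ++ [j]) (by rw [e1]; simp) m1 ?_
    rintro w (hw | hw) h
    · exact absurd h (no m1 hw)
    · simp [(u13 h m1 hw).2]
  · refine p.swap23.swap12.nb hS (A := []) (B := rc ++ [j]) (by rw [e3]; simp) m3 ?_
    rintro w (hw | hw) h
    · simp [(u13 (h.symm hS.symm) hw m3).1]
    · exact absurd (u32 h m3 hw).1 ne3
  · refine p.nb hS (A := [i]) (B := ta) (L := []) (by rw [e1]; simp [ha]) ma2 ?_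
    rintro w (hw | hw) h
    · exact absurd h (no ma2 hw)
    · exact absurd (u13 h ma2 hw).1 na
  · refine or_iff_not_imp_right.2 fun hne => ⟨c3, ?_⟩
    refine p.swap23.swap12.nb hS (A := [i]) (B := tc) (L := []) (by rw [e3]; simp [hc]) mc2 ?_
    rintro w (hw | hw) h
    · exact absurd (u13 (h.symm hS.symm) hw mc2).2 nc
    · exact absurd (u32 h mc2 hw).1 hne
  · simp only [List.mem_cons, List.not_mem_nil, or_false, not_or]
    exact ⟨fun h => j1 (h ▸ m1), fun h => j2 (h ▸ m2), fun h => j3 (h ▸ m3), fun h => j1 (h ▸ ma2),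
      fun h => j3 (h ▸ mc2)⟩

/-- Both ends of the pair look like a half prism, with matching third paths. -/
def TwoHalves (R : V → V → Prop) (U : Set V) (i j : V) : Prop :=
  ∃ a b c a' b' c', HalfPrism R U i j a b c c' ∧ HalfPrism R U j i a' b' c' c

theorem Prism.twoHalves (p : Prism R n i j q1 q2 q3 f1 f2 f3 l1 l2 l3) (hS : Setting R n i j)
    (r1 : Rung R n i j f1 f3) (r2 : Rung R n i j l3 l2) :
    TwoHalves R {v | OnSP R n i j v} i j := by
  refine ⟨f1, f2, f3, l2, l1, l3, p.halfPrism hS r1 r2, ?_⟩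
  have := (p.swap12.reverse hS.symm).halfPrism hS.reverse (r2.reverse' hS.symm)
    (r1.reverse' hS.symm)
  rwa [onSP_reverse hS.symm] at this

theorem Prism.false_of_same (p : Prism R n i j q1 q2 q3 f1 f2 f3 l1 l2 l3) (hS : Setting R n i j)
    (r1 : Rung R n i j f1 f2) (r2 : Rung R n i j l1 l2) : False := by
  have m1 := List.mem_of_head? p.hf1
  have m2 := List.mem_of_head? p.hf2
  have k1 := List.mem_of_getLast? p.hl1
  have k2 := List.mem_of_getLast? p.hl2
  have := p.rung_unique hS r1 m1 m2 r2 k1 k2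
  rw [Sym2.eq_iff] at this
  rcases this with ⟨h, -⟩ | ⟨h, -⟩
  · exact (p.two_le hS r1 m1 m2).2 h.symm
  · exact p.d12 _ k1 (h ▸ m2)

theorem Prism.classify_aux (p : Prism R n i j q1 q2 q3 f1 f2 f3 l1 l2 l3) (hS : Setting R n i j)
    (r1 : Rung R n i j f1 f2)
    (h : Rung R n i j l1 l2 ∨ Rung R n i j l1 l3 ∨ Rung R n i j l2 l3) :
    TwoHalves R {v | OnSP R n i j v} i j := by
  rcases h with h | h | h
  · exact (p.false_of_same hS r1 h).elim
  · exact p.swap12.swap23.twoHalves hS (r1.symm hS.symm) h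
  · exact p.swap23.twoHalves hS r1 h

theorem Prism.classify (p : Prism R n i j q1 q2 q3 f1 f2 f3 l1 l2 l3) (hS : Setting R n i j) :
    Star R {v | OnSP R n i j v} i ∨ Star R {v | OnSP R n i j v} j ∨
      TwoHalves R {v | OnSP R n i j v} i j := by
  by_cases hl : Rung R n i j l1 l2 ∨ Rung R n i j l1 l3 ∨ Rung R n i j l2 l3
  · have sw := fun {a b} (h : Rung R n i j a b) => h.symm hS.symm
    by_cases h12 : Rung R n i j f1 f2
    · exact Or.inr (Or.inr (p.classify_aux hS h12 hl))
    by_cases h13 : Rung R n i j f1 f3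
    · refine Or.inr (Or.inr (p.swap23.classify_aux hS h13 ?_))
      rcases hl with h | h | h
      · exact Or.inr (Or.inl h)
      · exact Or.inl h
      · exact Or.inr (Or.inr (sw h))
    by_cases h23 : Rung R n i j f2 f3
    · refine Or.inr (Or.inr (p.swap12.swap23.classify_aux hS h23 ?_))
      rcases hl with h | h | h
      · exact Or.inr (Or.inl (sw h))
      · exact Or.inr (Or.inr (sw h))
      · exact Or.inl h
    · exact Or.inl (p.star hS h12 h13 h23)
  · simp only [not_or] at hl
    refine Or.inr (Or.inl ?_)
    have sw := fun {a b} (h : Rung R n j i a b) => h.reverse hS.reverse.symm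
    have := (p.reverse hS.symm).star hS.reverse (fun h => hl.1 (sw h)) (fun h => hl.2.1 (sw h))
      (fun h => hl.2.2 (sw h))
    rwa [onSP_reverse hS.symm] at this

end ShortPath

namespace ShortPath
variable {V : Type u} {R : V → V → Prop} {n : ℕ} {i j x y : V} {q1 q2 q3 : List V}
  {f1 f2 f3 l1 l2 l3 : V}

theorem exists_first_path (hR : ∀ a b, R a b → R b a) (hij : i ≠ j) (hna : ¬ R i j)
    (hx : OnSP R n i j x) (h : R i x) (hne : x ≠ i) :
    ∃ q, SP R n i j (i :: q ++ [j]) ∧ q.head? = some x := by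
  obtain ⟨P, hP, hm⟩ := hx
  rcases rung_or n i j hne.symm h with ⟨T, hT, he⟩ | h
  · obtain ⟨q, hq, rfl⟩ := hT.exists_mid hij hna
    obtain ⟨f, r, rfl⟩ := List.exists_cons_of_ne_nil hq
    rw [mem_first_edge (f := f) hT.1 rfl] at he
    exact ⟨_, hT, by simp [he]⟩
  · exact absurd rfl (h.ne_start hR hP hm)

/-- `i` has at least two neighbours on short paths. -/
def Branches (R : V → V → Prop) (U : Set V) (i : V) : Prop :=
  ∃ u ∈ U, ∃ v ∈ U, u ≠ v ∧ u ≠ i ∧ v ≠ i ∧ R i u ∧ R i v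

theorem Branches.not_eq {f : V} {U : Set V} (h : Branches R U i) (hn : Nb R U i [f, f, f]) :
    False := by
  obtain ⟨u, hu, v, hv, huv, hui, hvi, h1, h2⟩ := h
  have a := hn u hu h1 hui
  have b := hn v hv h2 hvi
  simp at a b
  exact huv (a.trans b.symm)

theorem Trio.twin_or_prism' (hS : Setting R n i j) (t : Trio R n i j q1 q2 q3)
    (h : Rung R n i j x y) (hx : x ∈ q1) (hy : y ∈ q2)
    (hi : Branches R {v | OnSP R n i j v} i) (hj : Branches R {v | OnSP R n i j v} j) :
    Twin R {v | OnSP R n i j v} i j ∨ Star R {v | OnSP R n i j v} i ∨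
      Star R {v | OnSP R n i j v} j ∨ TwoHalves R {v | OnSP R n i j v} i j := by
  have ex : ∀ q, SP R n i j (i :: q ++ [j]) → ∃ f l, q.head? = some f ∧ q.getLast? = some l := by
    intro q hq
    obtain ⟨p, hp, e⟩ := hq.exists_mid hS.ne hS.na
    obtain rfl : q = p := by simpa using e
    exact ⟨_, _, List.head?_eq_some_head hp, List.getLast?_eq_some_getLast hp⟩
  obtain ⟨f1, l1, hf1, hl1⟩ := ex _ t.sp1
  obtain ⟨f2, l2, hf2, hl2⟩ := ex _ t.sp2
  obtain ⟨f3, l3, hf3, hl3⟩ := ex _ t.sp3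
  have n1 : ¬ (f1 = f2 ∧ f1 = f3) := by
    rintro ⟨rfl, rfl⟩; exact hi.not_eq (t.nb_start hS hf1 hf2 hf3)
  have n2 : ¬ (l1 = l2 ∧ l1 = l3) := by
    rintro ⟨rfl, rfl⟩; exact hj.not_eq (t.nb_end hS hl1 hl2 hl3)
  rcases t.twin_or_prism hS h hx hy hf1 hf2 hf3 hl1 hl2 hl3 n1 n2 with h | p
  · exact Or.inl h
  · exact Or.inr (p.classify hS)

theorem Trio.classify (hS : Setting R n i j) (t : Trio R n i j q1 q2 q3)
    (hi : Branches R {v | OnSP R n i j v} i) (hj : Branches R {v | OnSP R n i j v} j) :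
    FewEdges R n i j 3 ∨ Twin R {v | OnSP R n i j v} i j ∨ Star R {v | OnSP R n i j v} i ∨
      Star R {v | OnSP R n i j v} j ∨ TwoHalves R {v | OnSP R n i j v} i j := by
  by_cases hr : ∀ a b, OnSP R n i j a → OnSP R n i j b → ¬ Rung R n i j a b
  · left
    have ex : ∀ q, SP R n i j (i :: q ++ [j]) → ∃ f, q.head? = some f := by
      intro q hq
      obtain ⟨p, hp, e⟩ := hq.exists_mid hS.ne hS.na
      obtain rfl : q = p := by simpa using e
      exact ⟨_, List.head?_eq_some_head hp⟩
    obtain ⟨f1, hf1⟩ := ex _ t.sp1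
    obtain ⟨f2, hf2⟩ := ex _ t.sp2
    obtain ⟨f3, hf3⟩ := ex _ t.sp3
    refine t.fewEdges hS hf1 hf2 hf3 ?_ hr
    rintro ⟨rfl, rfl⟩; exact hi.not_eq (t.nb_start hS hf1 hf2 hf3)
  · right
    simp only [not_forall, not_not] at hr
    obtain ⟨a, b, ⟨P, hP, ha⟩, ⟨P', hP', hb⟩, h⟩ := hr
    obtain ⟨p, -, rfl⟩ := hP.exists_mid hS.ne hS.na
    obtain ⟨p', -, rfl⟩ := hP'.exists_mid hS.ne hS.na
    have hn := h.not_mem hS.symm hP ha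
    have hb' := h.mem_mid hS.symm ⟨_, hP, ha⟩ hb
    have ha' := (h.symm hS.symm).mem_mid hS.symm ⟨_, hP', hb⟩ ha
    have h' := h.symm hS.symm
    rcases t.all _ hP with rfl | rfl | rfl <;> rcases t.all _ hP' with rfl | rfl | rfl
    · exact absurd hb hn
    · exact t.twin_or_prism' hS h ha' hb' hi hj
    · exact t.swap23.twin_or_prism' hS h ha' hb' hi hj
    · exact t.twin_or_prism' hS h' hb' ha' hi hj
    · exact absurd hb hn
    · exact t.swap12.swap23.twin_or_prism' hS h ha' hb' hi hj
    · exact t.swap23.twin_or_prism' hS h' hb' ha' hi hj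
    · exact t.swap12.swap23.twin_or_prism' hS h' hb' ha' hi hj
    · exact absurd hb hn

/-- The possible shapes of the union of the short paths between `i` and `j`. -/
theorem classify (hR : ∀ a b, R a b → R b a) (hn : 3 ≤ n) (hij : i ≠ j) (hna : ¬ R i j) {η : ℕ}
    (hη : η ≤ 3) (hL : PathBound R n η)
    (hi : Branches R {v | OnSP R n i j v} i) (hj : Branches R {v | OnSP R n i j v} j) :
    2 ≤ η ∧ (FewEdges R n i j η ∨ Twin R {v | OnSP R n i j v} i j ∨
      Star R {v | OnSP R n i j v} i ∨ Star R {v | OnSP R n i j v} j ∨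
      3 ≤ η ∧ TwoHalves R {v | OnSP R n i j v} i j) := by
  obtain ⟨u, hu, v, hv, huv, hui, hvi, h1, h2⟩ := id hi
  obtain ⟨q, hq, hqu⟩ := exists_first_path hR hij hna hu h1 hui
  obtain ⟨q', hq', hqv⟩ := exists_first_path hR hij hna hv h2 hvi
  have hne : q ≠ q' := by
    rintro rfl; rw [hqu] at hqv; exact huv (by simpa using hqv)
  have h2η : 2 ≤ η := hL i j hij hna [i :: q ++ [j], i :: q' ++ [j]] (by simpa using hne)
    (by simp; exact ⟨by simpa using hq, by simpa using hq'⟩)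
  refine ⟨h2η, ?_⟩
  by_cases h3 : ∀ T, SP R n i j T → T = i :: q ++ [j] ∨ T = i :: q' ++ [j]
  · exact Or.inl (fewEdges_two hR hn hij hna h2η hη hL hq hq' h3)
  simp only [not_forall, not_or] at h3
  obtain ⟨T, hT, e1, e2⟩ := h3
  obtain ⟨q'', -, rfl⟩ := hT.exists_mid hij hna
  have e1' : q'' ≠ q := fun h => e1 (by rw [h])
  have e2' : q'' ≠ q' := fun h => e2 (by rw [h])
  have h3η : 3 ≤ η := hL i j hij hna [i :: q ++ [j], i :: q' ++ [j], i :: q'' ++ [j]]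
    (by simp; exact ⟨⟨hne, e1'.symm⟩, e2'.symm⟩)
    (by simp; exact ⟨by simpa using hq, by simpa using hq', by simpa using hT⟩)
  obtain rfl : η = 3 := le_antisymm hη h3η
  refine Or.imp_right (Or.imp_right (Or.imp_right (Or.imp_right fun h => ⟨le_rfl, h⟩)))
    (Trio.classify (q1 := q) (q2 := q') (q3 := q'') ⟨hR, hn, hij, hna, hL⟩
    ⟨hq, hq', hT, hne, e1'.symm, e2'.symm, ?_⟩ hi hj)
  intro p hp
  by_contra hcon
  simp only [not_or] at hcon
  refine hL.false_of_four hij hna hq hq' hT hp ?_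
  simp
  tauto

end ShortPath

namespace ShortPath
variable {V : Type u} {H : MixedGraph V} {i j a b x y z : V}

/-- A step along a directed or an undirected edge. -/
def Step (H : MixedGraph V) (a b : V) : Prop := H.dir a b ∨ H.undir a b

/-- `v` is anterior to `i` or to `j`. -/
def Ant (H : MixedGraph V) (i j v : V) : Prop :=
  Relation.ReflTransGen (Step H) v i ∨ Relation.ReflTransGen (Step H) v j

theorem Ant.symm (h : Ant H i j x) : Ant H j i x := Or.symm h

theorem Ant.step (h : Ant H i j y) (hs : Step H x y) : Ant H i j x :=
  h.imp (fun h => h.head hs) fun h => h.head hs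

theorem Ant.anc (h : Ant H i j y) (hs : H.Anc x y) : Ant H i j x := by
  have : Relation.ReflTransGen (Step H) x y :=
    Relation.ReflTransGen.mono (p := Step H) (fun _ _ h => Or.inl h) _ _ hs
  exact h.imp (fun h => this.trans h) fun h => this.trans h

theorem adj_symm (h : H.Adj a b) : H.Adj b a := by
  rcases h with h | h | h | h
  · exact Or.inr (Or.inl h)
  · exact Or.inl h
  · exact Or.inr (Or.inr (Or.inl (H.bidir_symm _ _ h)))
  · exact Or.inr (Or.inr (Or.inr (H.undir_symm _ _ h)))

theorem not_undir_of_arrow (hH : H.IsAncestral) (h : H.ArrowInto y x) (z : V) :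
    ¬ H.undir x z := fun hu => hH.2.2 _ _ (H.undir_symm _ _ hu) _ h

theorem step_of_not_arrow (h : H.Adj a b) (hn : ¬ H.ArrowInto b a) : Step H a b := by
  rcases h with h | h | h | h
  · exact Or.inl h
  · exact absurd (Or.inl h) hn
  · exact absurd (Or.inr (H.bidir_symm _ _ h)) hn
  · exact Or.inr h

theorem not_arrow_of_dir (hH : H.IsAncestral) (h : H.dir a b) : ¬ H.ArrowInto b a := by
  rintro (h' | h')
  · exact hH.1 _ _ h (.single h')
  · exact hH.2.1 _ _ (H.bidir_symm _ _ h') (.single h)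

theorem anc_of_arrow (hH : H.IsAncestral) (h : H.ArrowInto y x)
    (hz : Relation.ReflTransGen (Step H) x z) : H.Anc x z := by
  induction hz using Relation.ReflTransGen.head_induction_on generalizing y with
  | refl => exact .refl
  | head hs _ ih =>
    rcases hs with hs | hs
    · exact .head hs (ih (Or.inl hs))
    · exact absurd hs (not_undir_of_arrow hH h _)

theorem not_dir_bidir (hH : H.IsAncestral) (h : H.dir a b) : ¬ H.bidir a b ∧ ¬ H.bidir b a :=
  ⟨fun h' => hH.2.1 _ _ h' (.single h), fun h' => hH.2.1 _ _ (H.bidir_symm _ _ h') (.single h)⟩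

/-- A vertex leaving a path by a tail is anterior when the colliders on the rest are. -/
theorem ant_of_tail (hH : H.IsAncestral) {T : Set V} (hT : ∀ x y, Step H x y → y ∈ T → x ∈ T)
    {r : List V} : ∀ {x y : V}, (x :: y :: r).IsChain H.Adj →
    (∀ z, (x :: y :: r).getLast? = some z → z ∈ T) →
    (∀ a b c, [a, b, c] <:+: x :: y :: r → H.Collider a b c → b ∈ T) → Step H x y → x ∈ T := by
  induction r with
  | nil => intro x y _ hl _ hs; exact hT _ _ hs (hl y (by simp))
  | cons w r ih =>
    intro x y hc hl hcol hs
    refine hT _ _ hs ?_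
    by_cases ha : H.ArrowInto w y
    · rcases hs with hs | hs
      · exact hcol x y w ⟨[], r, rfl⟩ ⟨Or.inl hs, ha⟩
      · exact absurd ha (hH.2.2 _ _ hs w)
    · simp only [List.isChain_cons_cons] at hc
      refine ih (List.isChain_cons_cons.2 hc.2) (fun z hz => hl z (by simpa using hz)) ?_
        (step_of_not_arrow hc.2.1 ha)
      exact fun a b c hi => hcol a b c (hi.trans ⟨[x], [], by simp⟩)

theorem collider_symm {a b c : V} (h : H.Collider a b c) : H.Collider c b a := ⟨h.2, h.1⟩

/-- Unblocked paths stay within the anterior set. -/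
theorem ant_of_not_blocks (hH : H.IsAncestral) {S : Set V} (hS : ∀ v ∈ S, Ant H i j v)
    {π : List V} (hπ : H.IsPathBetween i j π) (hb : ¬ H.Blocks S π) : ∀ v ∈ π, Ant H i j v := by
  have hcol : ∀ a b c, [a, b, c] <:+: π → H.Collider a b c → Ant H i j b := by
    intro a b c hi hc
    by_contra hna
    exact hb ⟨a, b, c, hi, Or.inr ⟨hc, fun d hd hdS => hna ((hS d hdS).anc hd)⟩⟩
  obtain ⟨hnd, hch, hh, hl⟩ := hπ
  have hstep : ∀ x y, Step H x y → y ∈ {v | Ant H i j v} → x ∈ {v | Ant H i j v} :=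
    fun x y hs hy => Ant.step hy hs
  intro v hv
  obtain ⟨X, Y, rfl⟩ := List.append_of_mem hv
  rcases List.eq_nil_or_concat' X with rfl | ⟨X, a, rfl⟩
  · simp at hh; subst hh; exact Or.inl .refl
  cases Y with
  | nil => simp at hl; subst hl; exact Or.inr .refl
  | cons c Y =>
    have hch' : (X ++ [a] ++ v :: c :: Y).IsChain H.Adj := hch
    have hi : [a, v, c] <:+: X ++ [a] ++ v :: c :: Y := ⟨X, Y, by simp⟩
    by_cases h1 : H.ArrowInto c v
    · by_cases h2 : H.ArrowInto a v
      · exact hcol a v c hi ⟨h2, h1⟩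
      · have hr : (v :: a :: X.reverse).IsChain H.Adj := by
          have e : v :: a :: X.reverse = (X ++ [a] ++ [v]).reverse := by simp
          rw [e]
          refine chain_reverse (fun _ _ => adj_symm) ?_
          have e' : X ++ [a] ++ v :: c :: Y = (X ++ [a] ++ [v]) ++ (c :: Y) := by simp
          rw [e'] at hch'
          exact hch'.left_of_append
        refine ant_of_tail hH hstep (r := X.reverse) hr ?_ ?_
          (step_of_not_arrow (List.isChain_cons_cons.1 hr).1 h2)
        · intro z hz
          have e : v :: a :: X.reverse = (X ++ [a] ++ [v]).reverse := by simp
          rw [e, List.getLast?_reverse] at hz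
          have : (X ++ [a] ++ v :: c :: Y).head? = (X ++ [a] ++ [v]).head? := by
            cases X <;> simp
          rw [← this, hh] at hz
          simp at hz; subst hz; exact Or.inl .refl
        · intro p q s hps hc
          refine hcol s q p ?_ (collider_symm hc)
          have h3 := List.reverse_infix.2 hps
          refine (show [s, q, p] <:+: X ++ [a] ++ [v] by simpa using h3).trans
            ⟨[], c :: Y, by simp⟩
    · have hr : (v :: c :: Y).IsChain H.Adj := hch'.right_of_append
      refine ant_of_tail hH hstep hr ?_ ?_ (step_of_not_arrow (List.isChain_cons_cons.1 hr).1 h1)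
      · intro z hz
        rw [getLast?_app, hz] at hl
        simp at hl; subst hl; exact Or.inr .refl
      · exact fun p q s hps hc => hcol p q s (hps.trans ⟨X ++ [a], [], by simp⟩) hc

theorem exists_crossing {W : Set V} : ∀ {l : List V} {i j : V}, l.head? = some i →
    l.getLast? = some j → i ∈ W → j ∉ W → ∃ X x y Y, l = X ++ x :: y :: Y ∧ x ∈ W ∧ y ∉ W := by
  intro l
  induction l with
  | nil => intro i j h; simp at h
  | cons a l ih =>
    intro i j hh hl hi hj
    simp at hh; subst hh
    cases l with
    | nil => simp at hl; subst hl; exact absurd hi hj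
    | cons b l =>
      by_cases hb : b ∈ W
      · obtain ⟨X, x, y, Y, e, h⟩ := ih (i := b) rfl (by simpa using hl) hb hj
        exact ⟨a :: X, x, y, Y, by rw [e]; rfl, h⟩
      · exact ⟨[], a, b, l, rfl, hi, hb⟩

/-- `S` contains a tail of every anterior edge leaving some set that contains `i` but not `j`. -/
def Cuts (H : MixedGraph V) (i j : V) (S : Set V) : Prop :=
  ∃ W : Set V, i ∈ W ∧ j ∉ W ∧ ∀ x ∈ W, ∀ y ∉ W, Ant H i j x → Ant H i j y → H.Adj x y →
    (x ∈ S ∧ ¬ H.ArrowInto y x) ∨ (y ∈ S ∧ ¬ H.ArrowInto x y)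

theorem Cuts.symm {S : Set V} (h : Cuts H i j S) : Cuts H j i S := by
  obtain ⟨W, hi, hj, h⟩ := h
  refine ⟨Wᶜ, hj, fun h => h hi, fun x hx y hy hax hay hadj => ?_⟩
  exact (h y (by simpa using hy) x hx hay.symm hax.symm (adj_symm hadj)).symm

theorem Cuts.mono {S T : Set V} (h : Cuts H i j S) (hST : S ⊆ T) : Cuts H i j T := by
  obtain ⟨W, hi, hj, h⟩ := h
  exact ⟨W, hi, hj, fun x hx y hy hax hay hadj =>
    (h x hx y hy hax hay hadj).imp (And.imp_left (@hST x)) (And.imp_left (@hST y))⟩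

theorem Cuts.mSep (hH : H.IsAncestral) {S : Set V} (hS : ∀ v ∈ S, Ant H i j v)
    (hc : Cuts H i j S) (hiS : i ∉ S) (hjS : j ∉ S) : H.MSep i j S := by
  intro π hπ
  by_contra hb
  have hA := ant_of_not_blocks hH hS hπ hb
  obtain ⟨W, hi, hj, h⟩ := hc
  obtain ⟨hnd, hch, hh, hl⟩ := id hπ
  obtain ⟨X, x, y, Y, rfl, hx, hy⟩ := exists_crossing hh hl hi hj
  have hxy : H.Adj x y := by
    have hch' : (X ++ x :: y :: Y).IsChain H.Adj := hch
    exact (List.isChain_cons_cons.1 hch'.right_of_append).1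
  rcases h x hx y hy (hA x (by simp)) (hA y (by simp)) hxy with ⟨hS, ht⟩ | ⟨hS, ht⟩
  · rcases List.eq_nil_or_concat' X with rfl | ⟨X, a, rfl⟩
    · simp at hh; exact hiS (hh ▸ hS)
    · exact hb ⟨a, x, y, ⟨X, Y, by simp⟩, Or.inl ⟨fun hc => ht hc.2, hS⟩⟩
  · cases Y with
    | nil => simp at hl; exact hjS (hl ▸ hS)
    | cons c Y => exact hb ⟨x, y, c, ⟨X, Y, by simp⟩, Or.inl ⟨fun hc => ht hc.1, hS⟩⟩

end ShortPath

namespace ShortPath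
open Relation
variable {V : Type u} {H : MixedGraph V} {i j a b c x y z : V}

/-- Bidirected edges between anterior vertices. -/
def Bi (H : MixedGraph V) (i j a b : V) : Prop := H.bidir a b ∧ Ant H i j a ∧ Ant H i j b

theorem Bi.symm (h : Bi H i j a b) : Bi H i j b a := ⟨H.bidir_symm _ _ h.1, h.2.2, h.2.1⟩

theorem ant_swap : Ant H i j = Ant H j i := funext fun _ => propext ⟨Or.symm, Or.symm⟩

theorem bi_swap : Bi H i j = Bi H j i := by unfold Bi; rw [ant_swap]

theorem Bi.reach_symm (h : ReflTransGen (Bi H i j) a b) : ReflTransGen (Bi H i j) b a := by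
  induction h with
  | refl => exact .refl
  | tail _ h ih => exact .head h.symm ih

theorem exists_step_of_ant (h : Ant H i j x) (hi : x ≠ i) (hj : x ≠ j) :
    ∃ y, Step H x y ∧ Ant H i j y := by
  rcases h with h | h
  · rcases ReflTransGen.cases_head h with h | ⟨y, hy, h⟩
    · exact absurd h hi
    · exact ⟨y, hy, Or.inl h⟩
  · rcases ReflTransGen.cases_head h with h | ⟨y, hy, h⟩
    · exact absurd h hj
    · exact ⟨y, hy, Or.inr h⟩

theorem Step.adj (h : Step H a b) : H.Adj a b := by
  rcases h with h | h
  · exact Or.inl h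
  · exact Or.inr (Or.inr (Or.inr h))

theorem exists_dir_of_ant (hH : H.IsAncestral) (h : Ant H i j x) (hi : x ≠ i) (hj : x ≠ j)
    (ha : H.ArrowInto y x) : ∃ w, H.dir x w ∧ Ant H i j w := by
  obtain ⟨w, hw | hw, hA⟩ := exists_step_of_ant h hi hj
  · exact ⟨w, hw, hA⟩
  · exact absurd hw (not_undir_of_arrow hH ha _)

/-- The configuration where neither end is anterior to the other and both ends have anterior
bidirected neighbours. -/
structure Hard (H : MixedGraph V) (i j : V) : Prop where
  anc : H.IsAncestral
  ne : i ≠ j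
  nadj : ¬ H.Adj i j
  nij : ¬ ReflTransGen (Step H) i j
  nji : ¬ ReflTransGen (Step H) j i
  ci : ∃ c, Bi H i j i c
  cj : ∃ c, Bi H i j j c
  nbi : ¬ ReflTransGen (Bi H i j) i j

theorem Hard.symm (h : Hard H i j) : Hard H j i where
  anc := h.anc
  ne := h.ne.symm
  nadj := fun h' => h.nadj (adj_symm h')
  nij := h.nji
  nji := h.nij
  ci := by rw [bi_swap]; exact h.cj
  cj := by rw [bi_swap]; exact h.ci
  nbi := by rw [bi_swap]; exact fun h' => h.nbi (Bi.reach_symm h')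

/-- Every anterior edge at `i` has an arrowhead at `i`. -/
theorem Hard.arrow (h : Hard H i j) (hx : Ant H i j x) (ha : H.Adj x i) : H.ArrowInto x i := by
  obtain ⟨c, hc, -, -⟩ := h.ci
  by_contra hn
  rcases step_of_not_arrow (adj_symm ha) hn with hd | hu
  · rcases hx with hx | hx
    · exact h.anc.1 _ _ hd (anc_of_arrow h.anc (Or.inl hd) hx)
    · exact h.nij (.head (Or.inl hd) hx)
  · exact not_undir_of_arrow h.anc (Or.inr (H.bidir_symm _ _ hc)) _ hu

theorem Hard.ant_left (_ : Hard H i j) : Ant H i j i := Or.inl .refl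
/-- Bidirected neighbours of `i` are ancestors of `j`. -/
theorem Hard.reach_of_bidir (h : Hard H i j) (hx : Bi H i j i x) : ReflTransGen (Step H) x j := by
  rcases hx.2.2 with h' | h'
  · exact absurd (anc_of_arrow h.anc (Or.inr hx.1) h')
      (h.anc.2.1 _ _ (H.bidir_symm _ _ hx.1))
  · exact h'

theorem Hard.bi_ne (h : Hard H i j) (hx : Bi H i j i x) : x ≠ i ∧ x ≠ j := by
  constructor
  · rintro rfl; exact h.anc.2.1 _ _ hx.1 .refl
  · rintro rfl; exact h.nbi (.single hx)

theorem Hard.exists_sep (h : Hard H i j) {U : Set V} (hU : ∀ x y, H.Adj x y → x ∈ U) {S : Set V}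
    (hc : Cuts H i j S) : ∃ T, T ⊆ U \ {i, j} ∧ T ⊆ S ∧ H.MSep i j T := by
  refine ⟨{v | v ∈ S ∧ Ant H i j v ∧ v ≠ i ∧ v ≠ j}, ?_, fun v hv => hv.1, ?_⟩
  · rintro v ⟨-, hA, hi, hj⟩
    obtain ⟨y, hy, -⟩ := exists_step_of_ant hA hi hj
    exact ⟨hU _ _ hy.adj, by simp [hi, hj]⟩
  · refine Cuts.mSep h.anc (fun v hv => hv.2.1) ?_ (fun h => h.2.2.1 rfl) fun h => h.2.2.2 rfl
    obtain ⟨W, hi, hj, hW⟩ := hc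
    have key : ∀ x y, Ant H i j x → Ant H i j y → H.Adj x y → ¬ H.ArrowInto y x →
        x ≠ i ∧ x ≠ j := by
      intro x y hx hy ha hn
      constructor
      · rintro rfl; exact hn (h.arrow hy (adj_symm ha))
      · rintro rfl; exact hn (h.symm.arrow hy.symm (adj_symm ha))
    refine ⟨W, hi, hj, fun x hx y hy hax hay ha => ?_⟩
    rcases hW x hx y hy hax hay ha with ⟨h1, h2⟩ | ⟨h1, h2⟩
    · exact Or.inl ⟨⟨h1, hax, key x y hax hay ha h2⟩, h2⟩
    · exact Or.inr ⟨⟨h1, hay, key y x hay hax (adj_symm ha) h2⟩, h2⟩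

theorem cuts_neighbours (hij : i ≠ j)
    (h : ∀ y, Ant H i j y → H.Adj i y → y ≠ i → ¬ H.ArrowInto i y) :
    Cuts H i j {y | y ≠ i ∧ H.Adj i y ∧ Ant H i j y} := by
  refine ⟨{i}, rfl, fun h => hij h.symm, ?_⟩
  rintro x rfl y hy - hay ha
  exact Or.inr ⟨⟨hy, ha, hay⟩, h y hay ha hy⟩

theorem not_arrow_of_reach (hH : H.IsAncestral) (h : ReflTransGen (Step H) y i) :
    ¬ H.ArrowInto i y := by
  intro ha
  have := anc_of_arrow hH ha h
  rcases ha with ha | ha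
  · exact hH.1 _ _ ha this
  · exact hH.2.1 _ _ (H.bidir_symm _ _ ha) this

/-- Reduction to the hard configuration. -/
theorem exists_sep_of_hard [Finite V] (hH : H.IsAncestral) (hij : i ≠ j) (hna : ¬ H.Adj i j)
    {U : Set V} (hU : ∀ x y, H.Adj x y → x ∈ U) {η : ℕ}
    (hdi : {y | y ≠ i ∧ H.Adj i y}.ncard ≤ η) (hdj : {y | y ≠ j ∧ H.Adj j y}.ncard ≤ η)
    (hnb : ¬ ReflTransGen (Bi H i j) i j)
    (hard : Hard H i j → ∃ S, Cuts H i j S ∧ S.ncard ≤ η) :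
    ∃ S, S ⊆ U \ {i, j} ∧ H.MSep i j S ∧ S.ncard ≤ η := by
  have left : (∀ y, Ant H i j y → H.Adj i y → y ≠ i → ¬ H.ArrowInto i y) →
      ∃ S, S ⊆ U \ {i, j} ∧ H.MSep i j S ∧ S.ncard ≤ η := by
    intro h
    refine ⟨_, ?_, Cuts.mSep hH (fun v hv => hv.2.2) (cuts_neighbours hij h) (fun h => h.1 rfl)
      (fun h => hna h.2.1), (Set.ncard_le_ncard (t := {y | y ≠ i ∧ H.Adj i y})
        (fun y hy => ⟨hy.1, hy.2.1⟩)).trans hdi⟩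
    rintro v ⟨h1, h2, -⟩
    refine ⟨hU v i (adj_symm h2), ?_⟩
    rintro (rfl | rfl)
    · exact h1 rfl
    · exact hna h2
  have right : (∀ y, Ant H j i y → H.Adj j y → y ≠ j → ¬ H.ArrowInto j y) →
      ∃ S, S ⊆ U \ {i, j} ∧ H.MSep i j S ∧ S.ncard ≤ η := by
    intro h
    refine ⟨_, ?_, Cuts.mSep hH (fun v hv => hv.2.2.symm) (cuts_neighbours hij.symm h).symm
      (fun h => hna (adj_symm h.2.1)) (fun h => h.1 rfl),
      (Set.ncard_le_ncard (t := {y | y ≠ j ∧ H.Adj j y})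
        (fun y hy => ⟨hy.1, hy.2.1⟩)).trans hdj⟩
    rintro v ⟨h1, h2, -⟩
    refine ⟨hU v j (adj_symm h2), ?_⟩
    rintro (rfl | rfl)
    · exact hna (adj_symm h2)
    · exact h1 rfl
  by_cases hji : ReflTransGen (Step H) j i
  · exact left fun y hy _ _ =>
      not_arrow_of_reach hH (hy.elim id fun h => h.trans hji)
  by_cases hij' : ReflTransGen (Step H) i j
  · exact right fun y hy _ _ =>
      not_arrow_of_reach hH (hy.elim id fun h => h.trans hij')
  by_cases hci : ∃ c, Bi H i j i c
  · by_cases hcj : ∃ c, Bi H i j j c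
    · have hh : Hard H i j := ⟨hH, hij, hna, hij', hji, hci, hcj, hnb⟩
      obtain ⟨S, hS, hc⟩ := hard hh
      obtain ⟨T, h1, h2, h3⟩ := hh.exists_sep hU hS
      exact ⟨T, h1, h3, (Set.ncard_le_ncard h2).trans hc⟩
    · refine right fun y hy _ _ ha => ?_
      rcases hy with h | h
      · exact not_arrow_of_reach hH h ha
      · rcases ha with ha | ha
        · exact hji (.head (Or.inl ha) h)
        · exact hcj ⟨y, ha, Or.inr .refl, Or.inl h⟩
  · refine left fun y hy _ _ ha => ?_
    rcases hy with h | h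
    · exact not_arrow_of_reach hH h ha
    · rcases ha with ha | ha
      · exact hij' (.head (Or.inl ha) h)
      · exact hci ⟨y, ha, Or.inl .refl, Or.inr h⟩

end ShortPath

namespace ShortPath
open Relation
variable {V : Type u} {G : MixedGraph V} {S : Set V} {i j a b c s v w x y z : V}

theorem triple_append_left {L M : List V} : [a, b, c] <:+: L ++ v :: M →
    [a, b] <:+: L ++ [v] ∨ [a, b, c] <:+: v :: M := by
  induction L with
  | nil => exact fun h => Or.inr h
  | cons x L ih =>
    intro h
    rcases List.infix_cons_iff.1 h with h | h
    · left
      refine List.IsPrefix.isInfix ?_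
      rw [List.cons_append]
      replace h : [a, b, c] <+: x :: (L ++ v :: M) := h
      rw [List.cons_prefix_cons] at h ⊢
      refine ⟨h.1, ?_⟩
      cases L with
      | nil => simpa [List.cons_prefix_cons] using (List.cons_prefix_cons.1 h.2).1
      | cons y L => simpa [List.cons_prefix_cons] using (List.cons_prefix_cons.1 h.2).1
    · exact (ih h).imp (fun h => h.trans ⟨[x], [], by simp⟩) id

theorem triple_append_right {L M : List V} : [a, b, c] <:+: L ++ v :: M →
    [a, b, c] <:+: L ++ [v] ∨ [b, c] <:+: v :: M := by
  induction L with
  | nil => exact fun h => Or.inr (List.IsInfix.trans ⟨[a], [], by simp⟩ h)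
  | cons x L ih =>
    intro h
    rcases List.infix_cons_iff.1 h with h | h
    · replace h : [a, b, c] <+: x :: (L ++ v :: M) := h
      rw [List.cons_prefix_cons] at h
      obtain rfl := h.1
      clear ih
      replace h := h.2
      revert h
      match L with
      | [] => intro h; exact Or.inr h.isInfix
      | [y] =>
        intro h
        simp only [List.cons_append, List.nil_append, List.cons_prefix_cons] at h
        exact Or.inl ⟨[], [], by simp [h.1, h.2.1]⟩
      | y :: y' :: L =>
        intro h
        simp only [List.cons_append, List.cons_prefix_cons] at h
        exact Or.inl ⟨[], L ++ [v], by simp [h.1, h.2.1]⟩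
    · exact (ih h).imp (fun h => h.trans ⟨[x], [], by simp⟩) id

/-- No descendant of `v` lies in `S`. -/
def Closed (G : MixedGraph V) (S : Set V) (v : V) : Prop := ∀ d, G.Anc v d → d ∉ S

theorem Closed.of_anc (h : Closed G S v) (hw : G.Anc v w) : Closed G S w :=
  fun d hd => h d (hw.trans hd)

theorem exists_dir_list (hG : G.IsAncestral) (h : G.Anc v z) : ∃ Q : List V, Q.Nodup ∧
    Q.head? = some v ∧ Q.getLast? = some z ∧ Q.IsChain G.dir ∧ ∀ x ∈ Q, G.Anc v x := by
  induction h using ReflTransGen.head_induction_on with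
  | refl => exact ⟨[z], by simp, rfl, rfl, by simp, fun x hx => by
      rw [List.mem_singleton.1 hx]; exact ReflTransGen.refl⟩
  | @head v w hs _ ih =>
    obtain ⟨Q, h1, h2, h3, h4, h5⟩ := ih
    cases Q with
    | nil => simp at h2
    | cons w' Q =>
      simp at h2; subst h2
      refine ⟨v :: w' :: Q, List.nodup_cons.2 ⟨fun h => hG.1 _ _ hs (h5 _ h), h1⟩, rfl,
        by simpa using h3, List.isChain_cons_cons.2 ⟨hs, h4⟩, ?_⟩
      intro x hx
      rcases List.mem_cons.1 hx with rfl | hx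
      · exact .refl
      · exact .head hs (h5 _ hx)

/-- `v` is `z`, or a closed ancestor of `z`. -/
def Reaches (G : MixedGraph V) (S : Set V) (z v : V) : Prop := v = z ∨ Closed G S v ∧ G.Anc v z

theorem chain_pair {R : V → V → Prop} {l : List V} (h : l.IsChain R) (hi : [a, b] <:+: l) :
    R a b := by
  obtain ⟨X, Y, rfl⟩ := hi
  simp only [List.append_assoc] at h
  exact (List.isChain_cons_cons.1 (h.right_of_append)).1

theorem chain_of_pairs {R : V → V → Prop} {l : List V} (h : ∀ a b, [a, b] <:+: l → R a b) :
    l.IsChain R := by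
  induction l with
  | nil => simp
  | cons a l ih =>
    cases l with
    | nil => simp
    | cons b l =>
      exact List.isChain_cons_cons.2 ⟨h a b ⟨[], l, rfl⟩,
        ih fun x y hxy => h x y (hxy.trans ⟨[a], [], by simp⟩)⟩

theorem Reaches.exists_list (hG : G.IsAncestral) (h : Reaches G S z v) : ∃ Q : List V, Q.Nodup ∧
    Q.head? = some v ∧ Q.getLast? = some z ∧ (∀ b c, [b, c] <:+: Q → G.dir b c ∧ b ∉ S) ∧
    ∀ x ∈ Q, x = v ∨ Closed G S x := by
  rcases h with rfl | ⟨hc, ha⟩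
  · refine ⟨[v], by simp, rfl, rfl, fun b c h => ?_, by simp⟩
    simpa using h.length_le
  · obtain ⟨Q, h1, h2, h3, h4, h5⟩ := exists_dir_list hG ha
    refine ⟨Q, h1, h2, h3, fun b c h => ⟨chain_pair h4 h, ?_⟩, fun x hx =>
      Or.inr (hc.of_anc (h5 x hx))⟩
    exact hc b (h5 b (h.subset (by simp)))

theorem mem_of_head? {l : List V} (h : l.head? = some a) : ∃ m, l = a :: m := by
  cases l with
  | nil => simp at h
  | cons x m => simp at h; exact ⟨m, by rw [h]⟩

theorem exists_first_mem {P : List V} {T : V → Prop} (h : ∃ x ∈ P, T x) :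
    ∃ X y Y, P = X ++ y :: Y ∧ T y ∧ ∀ x ∈ X, ¬ T x := by
  induction P with
  | nil => simp at h
  | cons a P ih =>
    by_cases ha : T a
    · exact ⟨[], a, P, rfl, ha, by simp⟩
    · obtain ⟨X, y, Y, rfl, h1, h2⟩ := ih (by simpa [ha] using h)
      exact ⟨a :: X, y, Y, rfl, h1, by simpa [ha] using h2⟩

theorem mem_of_middle {r : List V} (h : [a, b, c] <:+: s :: r ++ [w]) : b ∈ r := by
  have key : ∀ X Z : List V, Z ≠ [] → X ++ b :: Z = r ++ [w] → b ∈ r := by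
    intro X Z hZ e
    obtain ⟨Z, z, rfl⟩ := (List.eq_nil_or_concat' Z).resolve_left hZ
    have e' : (X ++ b :: Z) ++ [z] = r ++ [w] := by simpa using e
    rw [← (List.append_inj' e' rfl).1]
    simp
  obtain ⟨X, Y, e⟩ := h
  cases X with
  | nil =>
    simp at e
    exact key [] (c :: Y) (by simp) (by simpa using e.2)
  | cons x X =>
    simp at e
    exact key (X ++ [a]) (c :: Y) (by simp) (by simpa using e.2)

/-- A bidirected chain of open colliders joining closed ancestors of the ends is not blocked. -/
theorem not_mSep_of_chain (hG : G.IsAncestral) {r : List V} (hs : Reaches G S i s)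
    (hw : Reaches G S j w) (hnd : (s :: r ++ [w]).Nodup) (hch : (s :: r ++ [w]).IsChain G.bidir)
    (hr : ∀ x ∈ r, ¬ Closed G S x) : ¬ G.MSep i j S := by
  intro hm
  obtain ⟨P, p1, p2, p3, p4, p5⟩ := hs.exists_list hG
  obtain ⟨Q, q1, q2, q3, q4, q5⟩ := hw.exists_list hG
  have hP : ∀ a b, [a, b] <:+: P.reverse → G.dir b a ∧ b ∉ S := by
    intro a b h
    refine p4 b a ?_
    simpa using List.reverse_infix.2 h
  have bad : ∀ π : List V, π.Nodup → π.IsChain G.Adj → π.head? = some i → π.getLast? = some j →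
      (∀ a b c, [a, b, c] <:+: π → (G.dir b a ∧ b ∉ S) ∨ (G.dir b c ∧ b ∉ S) ∨
        (G.bidir a b ∧ G.bidir b c ∧ ¬ Closed G S b)) → False := by
    intro π h1 h2 h3 h4 h5
    obtain ⟨a, b, c, hi, hb⟩ := hm π ⟨h1, h2, h3, h4⟩
    rcases h5 a b c hi with ⟨h, hS⟩ | ⟨h, hS⟩ | ⟨h, h', ho⟩
    · rcases hb with hb | hb
      · exact hS hb.2
      · exact not_arrow_of_dir hG h hb.1.1
    · rcases hb with hb | hb
      · exact hS hb.2
      · exact not_arrow_of_dir hG h hb.1.2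
    · rcases hb with hb | hb
      · exact hb.1 ⟨Or.inr h, Or.inr (G.bidir_symm _ _ h')⟩
      · exact ho hb.2
  by_cases hint : ∃ x ∈ P.reverse, x ∈ Q
  · obtain ⟨X, y, Y, e, hy, hX⟩ := exists_first_mem hint
    obtain ⟨Z, Y2, rfl⟩ := List.append_of_mem hy
    have hPi : ∀ a b, [a, b] <:+: X ++ [y] → G.dir b a ∧ b ∉ S := fun a b h =>
      hP a b (by rw [e]; exact h.trans ⟨[], Y, by simp⟩)
    have hQi : ∀ a b, [a, b] <:+: y :: Y2 → G.dir a b ∧ a ∉ S := fun a b h =>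
      q4 a b (h.trans ⟨Z, [], by simp⟩)
    refine bad (X ++ y :: Y2) ?_ ?_ ?_ ?_ ?_
    · have n1 : (X ++ y :: Y).Nodup := e ▸ List.nodup_reverse.2 p1
      rw [List.nodup_append] at n1 q1 ⊢
      refine ⟨n1.1, q1.2.1, fun a ha b hb hab => hX a ha ?_⟩
      subst hab; simp at hb ⊢; tauto
    · rw [List.isChain_split]
      exact ⟨chain_of_pairs fun a b h => Or.inr (Or.inl (hPi a b h).1),
        chain_of_pairs fun a b h => Or.inl (hQi a b h).1⟩
    · have : (X ++ y :: Y).head? = some i := by rw [← e]; simpa using p3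
      cases X <;> simpa using this
    · rw [getLast?_app] at q3 ⊢; exact q3
    · intro a b c h
      rcases triple_append_left h with h | h
      · exact Or.inl (hPi a b h)
      · exact Or.inr (Or.inl (hQi b c (List.IsInfix.trans ⟨[a], [], by simp⟩ h)))
  · obtain ⟨P, rfl⟩ := mem_of_head? p2
    obtain ⟨Q, rfl⟩ := mem_of_head? q2
    simp only [List.reverse_cons] at hP hint
    refine bad (P.reverse ++ s :: (r ++ w :: Q)) ?_ ?_ ?_ ?_ ?_
    · have hsr : s ∉ r ∧ s ≠ w ∧ w ∉ r ∧ r.Nodup := by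
        simp only [List.cons_append, List.nodup_cons, List.mem_append, List.mem_singleton,
          List.nodup_append] at hnd
        refine ⟨fun h => hnd.1 (Or.inl h), fun h => hnd.1 (Or.inr h), fun h => ?_, hnd.2.1⟩
        exact hnd.2.2.2 w h w rfl rfl
      have hrP : ∀ x ∈ r, x ∉ s :: P := fun x hx h => by
        rcases p5 x h with rfl | h
        · exact hsr.1 hx
        · exact hr x hx h
      have hrQ : ∀ x ∈ r, x ∉ w :: Q := fun x hx h => by
        rcases q5 x h with rfl | h
        · exact hsr.2.2.1 hx
        · exact hr x hx h
      have hPQ : ∀ x ∈ s :: P, x ∉ w :: Q := fun x hx h => hint ⟨x, by simp at hx ⊢; tauto, h⟩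
      have hsp := List.nodup_cons.1 p1
      rw [List.nodup_append, List.nodup_cons, List.nodup_append]
      refine ⟨List.nodup_reverse.2 hsp.2, ⟨?_, hsr.2.2.2, q1, ?_⟩, ?_⟩
      · rw [List.mem_append]
        rintro (h | h)
        · exact hsr.1 h
        · exact hPQ s (by simp) h
      · rintro x hx y hy rfl
        exact hrQ x hx hy
      · rintro x hx y hy rfl
        rw [List.mem_reverse] at hx
        rcases List.mem_cons.1 hy with rfl | hy
        · exact hsp.1 hx
        · rcases List.mem_append.1 hy with hy | hy
          · exact hrP x hy (by simp [hx])
          · exact hPQ x (by simp [hx]) hy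
    · rw [List.isChain_split]
      refine ⟨chain_of_pairs fun a b h => Or.inr (Or.inl (hP a b h).1), ?_⟩
      rw [← List.cons_append, List.isChain_split]
      exact ⟨hch.imp fun a b h => Or.inr (Or.inr (Or.inl h)),
        chain_of_pairs fun a b h => Or.inl (q4 a b h).1⟩
    · have : (P.reverse ++ [s]).head? = some i := by
        rw [← List.reverse_cons, List.head?_reverse]; exact p3
      cases h : P.reverse with
      | nil => simpa [h] using this
      | cons a l => simpa [h] using this
    · rw [getLast?_app, ← List.cons_append, getLast?_app]; exact q3
    · intro a b c h
      rcases triple_append_left h with h | h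
      · exact Or.inl (hP a b h)
      · rw [← List.cons_append] at h
        rcases triple_append_right h with h | h
        · right; right
          refine ⟨chain_pair hch (List.IsInfix.trans ⟨[], [c], by simp⟩ h),
            chain_pair hch (List.IsInfix.trans ⟨[a], [], by simp⟩ h), ?_⟩
          exact hr b (mem_of_middle h)
        · exact Or.inr (Or.inl (q4 b c h))

/-- Non-adjacent vertices of a maximal ancestral graph are not joined by an inducing path. -/
theorem not_inducing (hG : G.IsMAG) (hij : i ≠ j) (hna : ¬ G.Adj i j) :
    ¬ ReflTransGen (fun a b => G.bidir a b ∧ (G.Anc b i ∨ G.Anc b j)) i j := by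
  obtain ⟨hA, hM⟩ := hG
  obtain ⟨S, -, hS⟩ := hM i j hij hna
  intro h
  have key : ∀ v, ReflTransGen (fun a b => G.bidir a b ∧ (G.Anc b i ∨ G.Anc b j)) i v →
      ∃ s r, Reaches G S i s ∧ (s :: r).Nodup ∧ (s :: r).IsChain G.bidir ∧
      (∀ x ∈ r, ¬ Closed G S x) ∧ j ∉ s :: r ∧ (s :: r).getLast? = some v := by
    intro v h
    induction h with
    | refl => exact ⟨i, [], Or.inl rfl, by simp, by simp, by simp, by simpa using hij.symm, rfl⟩
    | @tail v w _ hs ih =>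
      obtain ⟨s, r, h1, h2, h3, h4, h5, h6⟩ := ih
      by_cases hw : w ∈ s :: r
      · rcases List.mem_cons.1 hw with rfl | hw
        · exact ⟨w, [], h1, by simp, by simp, by simp,
            by simp at h5 ⊢; tauto, rfl⟩
        · obtain ⟨X, Y, rfl⟩ := List.append_of_mem hw
          have e : s :: (X ++ w :: Y) = (s :: (X ++ [w])) ++ Y := by simp
          rw [e] at h2 h3 h5
          refine ⟨s, X ++ [w], h1, (List.nodup_append.1 h2).1, h3.left_of_append, ?_, ?_, ?_⟩
          · intro x hx; exact h4 x (by simp at hx ⊢; tauto)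
          · exact fun h => h5 (List.mem_append_left _ h)
          · rw [← List.cons_append, getLast?_app]; rfl
      · have n1 : (s :: r ++ [w]).Nodup := by
          rw [List.nodup_append]
          refine ⟨h2, by simp, ?_⟩
          rintro x hx y hy rfl
          exact hw (List.mem_singleton.1 hy ▸ hx)
        have n2 : (s :: r ++ [w]).IsChain G.bidir := by
          rw [List.isChain_append]
          refine ⟨h3, by simp, fun x hx y hy => ?_⟩
          rw [h6] at hx
          simp at hx hy; subst hx; subst hy
          exact hs.1
        by_cases hJ : Reaches G S j w
        · exact absurd hS (not_mSep_of_chain hA h1 hJ n1 n2 h4)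
        · have hwj : w ≠ j := fun h => hJ (Or.inl h)
          by_cases hc : Closed G S w
          · have hi : Reaches G S i w := by
              rcases hs.2 with h | h
              · exact Or.inr ⟨hc, h⟩
              · exact absurd (Or.inr ⟨hc, h⟩) hJ
            exact ⟨w, [], hi, by simp, by simp, by simp, by simpa using hwj.symm, rfl⟩
          · refine ⟨s, r ++ [w], h1, n1, n2, ?_, ?_, ?_⟩
            · intro x hx
              rcases List.mem_append.1 hx with hx | hx
              · exact h4 x hx
              · rwa [List.mem_singleton.1 hx]
            · rw [← List.cons_append, List.mem_append]
              rintro (h | h)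
              · exact h5 h
              · exact hwj (List.mem_singleton.1 h).symm
            · rw [← List.cons_append, getLast?_app]; rfl
  obtain ⟨s, r, -, -, -, -, h5, h6⟩ := key j h
  exact h5 (List.mem_of_getLast? h6)

end ShortPath

namespace ShortPath
open Relation
variable {V : Type u} {H : MixedGraph V} {i j a b c d f g l n s u v w x y z : V}

theorem not_arrow_or_not_arrow (hH : H.IsAncestral) (hx : Ant H i j x) (hy : Ant H i j y)
    (hb : ¬ Bi H i j x y) : ¬ H.ArrowInto y x ∨ ¬ H.ArrowInto x y := by
  by_contra! h
  obtain ⟨h1 | h1, h2⟩ := h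
  · exact not_arrow_of_dir hH h1 h2
  · exact hb ⟨H.bidir_symm _ _ h1, hx, hy⟩

theorem Hard.not_arrow (h : Hard H i j) (hx : Ant H i j x) (ha : H.Adj i x)
    (hb : ¬ Bi H i j i x) : ¬ H.ArrowInto i x :=
  (not_arrow_or_not_arrow h.anc h.ant_left hx hb).resolve_left
    fun h' => h' (h.arrow hx (adj_symm ha))

theorem Bi.adj (h : Bi H i j x y) : H.Adj x y := Or.inr (Or.inr (Or.inl h.1))

theorem Hard.not_anc (h : Hard H i j) (hc : Bi H i j i c) : ¬ H.Anc c i :=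
  h.anc.2.1 _ _ (H.bidir_symm _ _ hc.1)

/-- An anterior bidirected neighbour of `i` has a directed edge to a vertex other than `i`. -/
theorem Hard.exists_dir (h : Hard H i j) (hc : Bi H i j i c) : ∃ w, H.dir c w ∧ Ant H i j w ∧
    w ≠ i ∧ w ≠ c := by
  obtain ⟨w, hw, hA⟩ := exists_dir_of_ant h.anc hc.2.2 (h.bi_ne hc).1 (h.bi_ne hc).2 (Or.inr hc.1)
  refine ⟨w, hw, hA, ?_, ?_⟩
  · rintro rfl; exact h.not_anc hc (.single hw)
  · rintro rfl; exact h.anc.1 _ _ hw .refl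

theorem Hard.exists_parent (h : Hard H i j) : ∃ u, H.dir u i ∧ u ≠ i ∧ ¬ Bi H i j i u := by
  obtain ⟨c', hc'⟩ := h.cj
  have hc2 : Bi H j i j c' := by rw [bi_swap]; exact hc'
  have hA := anc_of_arrow h.anc (Or.inr hc'.1) (h.symm.reach_of_bidir hc2)
  rcases ReflTransGen.cases_tail hA with e | ⟨u, -, hu⟩
  · exact absurd e.symm (h.symm.bi_ne hc2).2
  · refine ⟨u, hu, ?_, fun hb => h.not_anc hb (.single hu)⟩
    rintro rfl; exact h.anc.1 _ _ hu .refl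

theorem Hard.not_adj (h : Hard H i j) (hc : Bi H i j i c) (hd : Bi H i j j d) :
    ¬ H.Adj c d ∧ c ≠ d := by
  have hd' : Bi H j i j d := by rw [bi_swap]; exact hd
  have hci := anc_of_arrow h.anc (Or.inr hc.1) (h.reach_of_bidir hc)
  have hdi := anc_of_arrow h.anc (Or.inr hd.1) (h.symm.reach_of_bidir hd')
  constructor
  · rintro (e | e | e | e)
    · exact h.not_anc hc (.head e hdi)
    · exact h.symm.not_anc hd' (.head e hci)
    · exact h.nbi (((ReflTransGen.single hc).tail ⟨e, hc.2.2, hd.2.2⟩).tail hd.symm)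
    · exact not_undir_of_arrow h.anc (Or.inr hc.1) _ e
  · rintro rfl
    exact h.nbi ((ReflTransGen.single hc).tail hd.symm)

theorem Hard.cuts_all (h : Hard H i j) {U : Set V} (hU : ∀ x y, H.Adj x y → x ∈ U) :
    Cuts H i j (U \ {i, j}) := by
  refine ⟨{v | ReflTransGen (Bi H i j) i v}, .refl, h.nbi, fun x hx y hy hax hay ha => ?_⟩
  have key : ∀ x y, Ant H i j x → Ant H i j y → H.Adj x y → ¬ H.ArrowInto y x →
      x ∈ U \ {i, j} := by
    intro x y hx hy ha hn
    refine ⟨hU _ _ ha, ?_⟩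
    rintro (rfl | rfl)
    · exact hn (h.arrow hy (adj_symm ha))
    · exact hn (h.symm.arrow hy.symm (adj_symm ha))
  rcases not_arrow_or_not_arrow h.anc hax hay fun hb => hy (hx.tail hb) with hn | hn
  · exact Or.inl ⟨key x y hax hay ha hn, hn⟩
  · exact Or.inr ⟨key y x hay hax (adj_symm ha) hn, hn⟩

/-- The anterior edges leaving the set of vertices reachable from `i` by bidirected edges. -/
def Boundary (H : MixedGraph V) (i j : V) : Set (V × V) :=
  {p | ReflTransGen (Bi H i j) i p.1 ∧ ¬ ReflTransGen (Bi H i j) i p.2 ∧ Ant H i j p.1 ∧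
    Ant H i j p.2 ∧ H.Adj p.1 p.2}

open Classical in
theorem Hard.cuts_boundary [Finite V] (h : Hard H i j) :
    ∃ S, Cuts H i j S ∧ S.ncard ≤ (Boundary H i j).ncard := by
  refine ⟨(fun p : V × V => if H.ArrowInto p.2 p.1 then p.2 else p.1) '' Boundary H i j, ?_,
    Set.ncard_image_le (Set.toFinite _)⟩
  refine ⟨{v | ReflTransGen (Bi H i j) i v}, .refl, h.nbi, fun x hx y hy hax hay ha => ?_⟩
  have hp : (x, y) ∈ Boundary H i j := ⟨hx, hy, hax, hay, ha⟩
  by_cases h1 : H.ArrowInto y x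
  · refine Or.inr ⟨⟨(x, y), hp, by simp [h1]⟩, ?_⟩
    rcases not_arrow_or_not_arrow h.anc hax hay fun hb => hy (hx.tail hb) with hn | hn
    · exact absurd h1 hn
    · exact hn
  · exact Or.inl ⟨⟨(x, y), hp, by simp [h1]⟩, h1⟩

theorem Hard.cuts_pair (h : Hard H i j) (hc : Bi H i j i c) (hu : H.dir u i)
    (hi : ∀ w, H.Adj i w → w ≠ i → w = c ∨ w = u)
    (hcn : ∀ w, H.Adj c w → w ≠ c → w = i ∨ w = n) : Cuts H i j {u, c} := by
  obtain ⟨w, hw, -, hwi, hwc⟩ := h.exists_dir hc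
  refine ⟨{i, c}, by simp, ?_, ?_⟩
  · rintro (e | e)
    · exact h.ne e.symm
    · exact (h.bi_ne hc).2 e.symm
  · rintro x hx y hy - - ha
    simp only [Set.mem_insert_iff, Set.mem_singleton_iff, not_or] at hx hy ⊢
    rcases hx with rfl | rfl
    · rcases hi y ha hy.1 with rfl | rfl
      · exact absurd rfl hy.2
      · exact Or.inr ⟨Or.inl rfl, not_arrow_of_dir h.anc hu⟩
    · have e1 := (hcn y ha hy.2).resolve_left hy.1
      have e2 := (hcn w (Or.inl hw) hwc).resolve_left hwi
      rw [e1, ← e2]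
      exact Or.inl ⟨Or.inr rfl, not_arrow_of_dir h.anc hw⟩

theorem Hard.cuts_star (h : Hard H i j)
    (hs : ∀ x, H.Adj i x → x ≠ i → ∃ g, ∀ w, H.Adj x w → w ≠ x → w = i ∨ w = g) :
    Cuts H i j {y | y ≠ i ∧ H.Adj i y} := by
  refine ⟨{v | v = i ∨ Bi H i j i v}, Or.inl rfl, ?_, ?_⟩
  · rintro (e | e)
    · exact h.ne e.symm
    · exact h.nbi (.single e)
  · rintro x hx y hy - hay ha
    simp only [Set.mem_ofPred_eq, not_or] at hy
    rcases hx with rfl | hx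
    · exact Or.inr ⟨⟨hy.1, ha⟩, h.not_arrow hay ha hy.2⟩
    · obtain ⟨w, hw, -, hwi, hwc⟩ := h.exists_dir hx
      obtain ⟨g, hg⟩ := hs x hx.adj (h.bi_ne hx).1
      by_cases hyx : y = x
      · exact absurd (hyx ▸ hx) hy.2
      · have e1 := (hg y ha hyx).resolve_left hy.1
        have e2 := (hg w (Or.inl hw) hwc).resolve_left hwi
        rw [e1, ← e2]
        exact Or.inl ⟨⟨(h.bi_ne hx).1, hx.adj⟩, not_arrow_of_dir h.anc hw⟩

variable {R : V → V → Prop} {U : Set V} {L : List V}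

theorem Nb.mem (hadj : ∀ x y, H.Adj x y ↔ x ∈ U ∧ y ∈ U ∧ R x y) (h : Nb R U v L)
    (ha : H.Adj v w) (hne : w ≠ v) : w ∈ L :=
  h w ((hadj _ _).1 ha).2.1 ((hadj _ _).1 ha).2.2 hne

theorem Hard.cuts_twin [Finite V] (hadj : ∀ x y, H.Adj x y ↔ x ∈ U ∧ y ∈ U ∧ R x y)
    (h : Hard H i j) (ht : Twin R U i j) : ∃ S, Cuts H i j S ∧ S.ncard ≤ 2 := by
  obtain ⟨f, f', l, l', hi, hj, ⟨g1, hf'⟩, ⟨g2, hl⟩, hopt⟩ := ht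
  have cut : ∀ {i j f f' c g : V}, Hard H i j → Nb R U i [f, f'] → Bi H i j i c →
      Nb R U c [i, g] → ∃ S, Cuts H i j S ∧ S.ncard ≤ 2 := by
    intro i j f f' c g h hi hc hn
    obtain ⟨u, hu, hui, hub⟩ := h.exists_parent
    have hcu : c ≠ u := by rintro rfl; exact hub hc
    refine ⟨_, h.cuts_pair (n := g) hc hu ?_ ?_, (Set.ncard_insert_le _ _).trans (by simp)⟩
    · intro w hw hwi
      have h1 := hi.mem hadj hw hwi
      have h2 := hi.mem hadj hc.adj (h.bi_ne hc).1
      have h3 := hi.mem hadj (adj_symm (Or.inl hu)) hui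
      simp only [List.mem_cons, List.not_mem_nil, or_false] at h1 h2 h3
      grind
    · intro w hw hwc
      simpa using hn.mem hadj hw hwc
  have cut' : ∀ {c g : V}, Bi H i j j c → Nb R U c [j, g] →
      ∃ S, Cuts H i j S ∧ S.ncard ≤ 2 := by
    intro c g hc hn
    obtain ⟨S, h1, h2⟩ := cut h.symm hj (by rw [bi_swap]; exact hc) hn
    exact ⟨S, h1.symm, h2⟩
  obtain ⟨c, hc⟩ := h.ci
  obtain ⟨c', hc'⟩ := h.cj
  have hc2 : Bi H j i j c' := by rw [bi_swap]; exact hc'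
  have h1 := hi.mem hadj hc.adj (h.bi_ne hc).1
  have h2 := hj.mem hadj hc'.adj (h.symm.bi_ne hc2).1
  simp only [List.mem_cons, List.not_mem_nil, or_false] at h1 h2
  rcases h1 with rfl | rfl
  · rcases h2 with rfl | rfl
    · exact cut' hc' hl
    · have hn := h.not_adj hc hc'
      rcases hopt with ⟨g, hg⟩ | ⟨g, hg⟩ | hR | he
      · exact cut h hi hc hg
      · exact cut' hc' hg
      · refine absurd ((hadj _ _).2 ⟨?_, ?_, hR⟩) hn.1
        · exact ((hadj _ _).1 hc.adj).2.1
        · exact ((hadj _ _).1 hc'.adj).2.1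
      · exact absurd he hn.2
  · exact cut h hi hc hf'

end ShortPath

namespace ShortPath
open Relation
variable {V : Type u} {H : MixedGraph V} {i j a b c d x y : V} {R : V → V → Prop} {U : Set V}

/-- A vertex with an arrowhead and at most one neighbour other than its parent-side neighbour `p`
has a tail towards that neighbour. -/
theorem Hard.tail_of_two (h : Hard H i j) {p q x y : V} (hxi : x ≠ i) (hxj : x ≠ j)
    (hb : Bi H i j p x) (hn : ∀ w, H.Adj x w → w ≠ x → w = p ∨ w = q) (ha : H.Adj x y)
    (hyx : y ≠ x) (hyp : y ≠ p) : ¬ H.ArrowInto y x := by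
  obtain ⟨w, hw, hA⟩ := exists_dir_of_ant h.anc hb.2.2 hxi hxj (Or.inr hb.1)
  have hwp : w ≠ p := by
    rintro rfl; exact (not_dir_bidir h.anc hw).2 hb.1
  have hwx : w ≠ x := by
    rintro rfl; exact h.anc.1 _ _ hw .refl
  have e1 := (hn y ha hyx).resolve_left hyp
  have e2 := (hn w (Or.inl hw) hwx).resolve_left hwp
  rw [e1, ← e2]
  exact not_arrow_of_dir h.anc hw

theorem ncard_triple_le (a b c : V) : ({a, b, c} : Set V).ncard ≤ 3 :=
  (Set.ncard_insert_le _ _).trans (Nat.succ_le_succ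
    ((Set.ncard_insert_le _ _).trans (by simp)))

open Classical in
theorem Hard.cuts_halfPrism (hadj : ∀ x y, H.Adj x y ↔ x ∈ U ∧ y ∈ U ∧ R x y)
    (h : Hard H i j) (hp : HalfPrism R U i j a b c d) :
    (∃ S, Cuts H i j S ∧ S.ncard ≤ 3) ∨ ReflTransGen (Bi H i j) i c ∧ Bi H i j c d := by
  obtain ⟨a2, a3, b2, c2, hi, hb, ha, hc, ha2, hc2, hj, hR⟩ := hp
  have mi := fun w h1 h2 => hi.mem hadj (w := w) h1 h2
  have mb := fun w h1 h2 => hb.mem hadj (w := w) h1 h2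
  have ma := fun w h1 h2 => ha.mem hadj (w := w) h1 h2
  have mc := fun w h1 h2 => hc.mem hadj (w := w) h1 h2
  have ma2 := fun w h1 h2 => ha2.mem hadj (w := w) h1 h2
  simp only [List.mem_cons, List.not_mem_nil, or_false, not_or] at mi mb ma mc ma2 hj
  obtain ⟨hja, hjb, hjc, hja2, hjc2⟩ := hj
  have tb : ∀ y, Bi H i j i b → H.Adj b y → y ≠ b → y ≠ i → ¬ H.ArrowInto y b :=
    fun y hbb hy h1 h2 => h.tail_of_two (h.bi_ne hbb).1 (h.bi_ne hbb).2 hbb mb hy h1 h2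
  by_cases hcd : Bi H i j c c2 ∧ c2 = d
  · obtain ⟨hcc, rfl⟩ := hcd
    by_cases hD : ReflTransGen (Bi H i j) i c
    · exact Or.inr ⟨hD, hcc⟩
    left
    have hic : ¬ Bi H i j i c := fun h' => hD (.single h')
    refine ⟨{a, b, c}, ?_, ncard_triple_le _ _ _⟩
    by_cases hia : Bi H i j i a
    · have hac : ¬ Bi H i j a c := fun h' => hD ((ReflTransGen.single hia).tail h')
      refine ⟨{x | x = i ∨ x = a ∨ x = b ∧ Bi H i j i b}, Or.inl rfl, ?_, ?_⟩
      · simp [hja, hjb, h.ne.symm]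
      · rintro x hx y hy hax hay hxy
        simp only [Set.mem_ofPred_eq, not_or, not_and] at hx hy
        rcases hx with rfl | rfl | ⟨rfl, hx⟩
        · have hy' : y = b ∨ y = c := (mi y hxy hy.1).resolve_left hy.2.1
          refine Or.inr ⟨?_, h.not_arrow hay hxy ?_⟩
          · rcases hy' with rfl | rfl <;> simp
          · rcases hy' with rfl | rfl
            · exact hy.2.2 rfl
            · exact hic
        · obtain ⟨w, hw, hA, hwi, hwx⟩ := h.exists_dir hia
          have hwc : w ≠ c := by
            rintro rfl
            have hU : H.Adj i w :=
              (hadj _ _).2 ⟨((hadj _ _).1 hia.adj).1, ((hadj _ _).1 (Or.inl hw)).2.1, hR⟩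
            rcases step_of_not_arrow (adj_symm hU) (h.not_arrow hA hU hic) with hd | hu
            · exact h.not_anc hia (.head hw (.single hd))
            · exact not_undir_of_arrow h.anc (Or.inl hw) _ hu
          have hwa : w = a2 := ((ma w (Or.inl hw) hwx).resolve_left hwi).resolve_right hwc
          rcases ma y hxy hy.2.1 with rfl | rfl | rfl
          · exact absurd rfl hy.1
          · rw [← hwa]
            exact Or.inl ⟨by simp, not_arrow_of_dir h.anc hw⟩
          · rcases not_arrow_or_not_arrow h.anc hax hay hac with h' | h'
            · exact Or.inl ⟨by simp, h'⟩
            · exact Or.inr ⟨by simp, h'⟩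
        · refine Or.inl ⟨by simp, tb y hx hxy ?_ hy.1⟩
          rintro rfl; exact hy.2.2 rfl hx
    · refine ⟨{x | x = i ∨ x = b ∧ Bi H i j i b}, Or.inl rfl, ?_, ?_⟩
      · simp [hjb, h.ne.symm]
      · rintro x hx y hy hax hay hxy
        simp only [Set.mem_ofPred_eq, not_or, not_and] at hx hy
        rcases hx with rfl | ⟨rfl, hx⟩
        · have hy' := mi y hxy hy.1
          refine Or.inr ⟨by simpa using hy', h.not_arrow hay hxy ?_⟩
          rcases hy' with rfl | rfl | rfl
          · exact hia
          · exact hy.2 rfl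
          · exact hic
        · refine Or.inl ⟨by simp, tb y hx hxy ?_ hy.1⟩
          rintro rfl; exact hy.2 rfl hx
  · left
    refine ⟨{b, if H.ArrowInto a2 a then a2 else a, if H.ArrowInto c2 c then c2 else c}, ?_,
      ncard_triple_le _ _ _⟩
    refine ⟨{x | x = i ∨ x = a ∨ x = c ∨ x = b ∧ Bi H i j i b ∨ x = a2 ∧ Bi H i j a a2 ∨
      x = c2 ∧ Bi H i j c c2}, Or.inl rfl, ?_, ?_⟩
    · simp [hja, hjb, hjc, hja2, hjc2, h.ne.symm]
    · rintro x hx y hy hax hay hxy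
      simp only [Set.mem_ofPred_eq, not_or, not_and] at hx hy
      obtain ⟨hyi, hya, hyc, hyb, hya2, hyc2⟩ := hy
      by_cases hxi : x = i
      · subst hxi
        obtain rfl : y = b := ((mi y hxy hyi).resolve_left hya).resolve_right hyc
        exact Or.inr ⟨by simp, h.not_arrow hay hxy (hyb rfl)⟩
      rcases hx with rfl | rfl | rfl | ⟨rfl, hx⟩ | ⟨rfl, hx⟩ | ⟨rfl, hx⟩
      · exact absurd rfl hxi
      · obtain rfl : y = a2 := ((ma y hxy hya).resolve_left hyi).resolve_right hyc
        by_cases h1 : H.ArrowInto y x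
        · refine Or.inr ⟨by simp [h1], ?_⟩
          exact (not_arrow_or_not_arrow h.anc hax hay (hya2 rfl)).resolve_left fun h' => h' h1
        · exact Or.inl ⟨by simp [h1], h1⟩
      · obtain rfl : y = c2 := ((mc y hxy hyc).resolve_left hyi).resolve_right hya
        by_cases h1 : H.ArrowInto y x
        · refine Or.inr ⟨by simp [h1], ?_⟩
          exact (not_arrow_or_not_arrow h.anc hax hay (hyc2 rfl)).resolve_left fun h' => h' h1
        · exact Or.inl ⟨by simp [h1], h1⟩
      · refine Or.inl ⟨by simp, tb y hx hxy ?_ hyi⟩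
        rintro rfl; exact hyb rfl hx
      · have h1 : H.ArrowInto x a := Or.inr (H.bidir_symm _ _ hx.1)
        refine Or.inl ⟨by simp [h1], h.tail_of_two hxi (Ne.symm hja2) hx ma2 hxy ?_ hya⟩
        rintro rfl; exact hya2 rfl hx
      · have h1 : H.ArrowInto x c := Or.inr (H.bidir_symm _ _ hx.1)
        obtain ⟨c3, hc3⟩ := hc2.resolve_right fun h' => hcd ⟨hx, h'⟩
        have mc2 := fun w h1 h2 => hc3.mem hadj (w := w) h1 h2
        simp only [List.mem_cons, List.not_mem_nil, or_false] at mc2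
        refine Or.inl ⟨by simp [h1], h.tail_of_two hxi (Ne.symm hjc2) hx mc2 hxy ?_ hyc⟩
        rintro rfl; exact hyc2 rfl hx

theorem Hard.cuts_twoHalves (hadj : ∀ x y, H.Adj x y ↔ x ∈ U ∧ y ∈ U ∧ R x y)
    (h : Hard H i j) (hp : TwoHalves R U i j) : ∃ S, Cuts H i j S ∧ S.ncard ≤ 3 := by
  obtain ⟨a, b, c, a', b', c', h1, h2⟩ := hp
  rcases h.cuts_halfPrism hadj h1 with h1 | ⟨hc, hcc⟩
  · exact h1
  rcases h.symm.cuts_halfPrism hadj h2 with ⟨S, h2, h3⟩ | ⟨hc', -⟩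
  · exact ⟨S, h2.symm, h3⟩
  · rw [← bi_swap] at hc'
    exact absurd ((hc.tail hcc).trans (Bi.reach_symm hc')) h.nbi

end ShortPath

namespace ShortPath
open Relation
variable {V : Type u} {H : MixedGraph V} {i j a b c d v x y : V} {R : V → V → Prop} {n : ℕ}

theorem OnSP.two_neighbours (hR : ∀ a b, R a b → R b a) (h : OnSP R n i j v) (hi : v ≠ i)
    (hj : v ≠ j) : ∃ a b, a ≠ b ∧ a ≠ v ∧ b ≠ v ∧ OnSP R n i j a ∧ OnSP R n i j b ∧
      R v a ∧ R v b := by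
  obtain ⟨P, hP, hv⟩ := h
  obtain ⟨X, Y, rfl⟩ := List.append_of_mem hv
  obtain ⟨hnd, hch, hh, hl, -⟩ := id hP
  rcases List.eq_nil_or_concat' X with rfl | ⟨X, a, rfl⟩
  · simp at hh; exact absurd hh hi
  cases Y with
  | nil => simp at hl; exact absurd hl hj
  | cons b Y =>
    have e : X ++ [a] ++ v :: b :: Y = X ++ a :: v :: b :: Y := by simp
    rw [e] at hnd hch
    have hc := hch.right_of_append
    simp only [List.isChain_cons_cons] at hc
    have hn := (List.nodup_append.1 hnd).2.1
    simp at hn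
    refine ⟨a, b, ?_, ?_, ?_, ⟨_, hP, by simp⟩, ⟨_, hP, by simp⟩, hR _ _ hc.1, hc.2.1⟩ <;> grind

/-- Ordered pairs of bidirected edges in the part reachable from `i`. -/
def Arcs (H : MixedGraph V) (i j : V) : Set (V × V) :=
  {p | ReflTransGen (Bi H i j) i p.1 ∧ Bi H i j p.1 p.2}

theorem arcs_ncard [Finite V] (hH : H.IsAncestral) :
    2 * {v | ReflTransGen (Bi H i j) i v}.ncard ≤ (Arcs H i j).ncard + 2 := by
  classical
  have := Fintype.ofFinite V
  let D : Set V := {v | ReflTransGen (Bi H i j) i v}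
  let K : SimpleGraph D :=
    { Adj := fun a b => Bi H i j a.1 b.1
      symm := ⟨fun a b h => h.symm⟩
      loopless := ⟨fun a h => hH.2.1 _ _ h.1 .refl⟩ }
  have hreach : ∀ v (hv : ReflTransGen (Bi H i j) i v), K.Reachable ⟨i, .refl⟩ ⟨v, hv⟩ := by
    intro v hv
    induction hv with
    | refl => exact SimpleGraph.Reachable.refl _
    | tail h h' ih => exact ih.trans (SimpleGraph.Adj.reachable h')
  have hconn : K.Connected :=
    { preconnected := fun a b => (hreach a.1 a.2).symm.trans (hreach b.1 b.2)
      nonempty := ⟨⟨i, .refl⟩⟩ }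
  have h1 := hconn.card_vert_le_card_edgeSet_add_one
  have h2 := K.dart_card_eq_twice_card_edges
  have h3 : Fintype.card K.Dart ≤ (Arcs H i j).ncard := by
    rw [← Nat.card_eq_fintype_card, ← Set.ncard_univ]
    refine Set.ncard_le_ncard_of_injOn (fun d => (d.fst.1, d.snd.1)) ?_ ?_
    · exact fun d _ => ⟨d.fst.2, d.adj⟩
    · intro d _ d' _ he
      simp only [Prod.mk.injEq] at he
      exact SimpleGraph.Dart.ext _ _ (Prod.ext (Subtype.ext he.1) (Subtype.ext he.2))
  have h4 : Nat.card K.edgeSet = K.edgeFinset.card := by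
    rw [Nat.card_eq_fintype_card, SimpleGraph.edgeFinset_card]
  have h5 : Nat.card D = {v | ReflTransGen (Bi H i j) i v}.ncard := rfl
  omega

theorem ncard_pairs_le [Finite V] {P : Set (V × V)} {E : Finset (Sym2 V)}
    (h : ∀ p ∈ P, s(p.1, p.2) ∈ E) : P.ncard ≤ 2 * E.card := by
  classical
  have := Fintype.ofFinite V
  rw [Set.ncard_eq_toFinset_card']
  refine Finset.card_le_mul_card_image_of_maps_to (f := fun p : V × V => s(p.1, p.2))
    (fun p hp => h p (by simpa using hp)) 2 ?_
  intro e _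
  induction e using Sym2.ind with
  | _ a b =>
    refine (Finset.card_le_card (t := {(a, b), (b, a)}) ?_).trans Finset.card_le_two
    rintro ⟨x, y⟩ hp
    simp only [Finset.mem_filter, Sym2.eq_iff] at hp
    simp only [Finset.mem_insert, Finset.mem_singleton, Prod.mk.injEq]
    exact hp.2

theorem Hard.cuts_fewEdges [Finite V] (hR : ∀ a b, R a b → R b a)
    (hadj : ∀ x y, H.Adj x y ↔ OnSP R n i j x ∧ OnSP R n i j y ∧ R x y) {η : ℕ}
    (h : Hard H i j) (hf : FewEdges R n i j η) : ∃ S, Cuts H i j S ∧ S.ncard ≤ η := by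
  by_contra hcon
  obtain ⟨E, hE, hcard⟩ := hf
  obtain ⟨S, hS, hSn⟩ := h.cuts_boundary
  obtain ⟨S', hS', hSn'⟩ := h.symm.cuts_boundary
  have b1 : η < S.ncard := by by_contra hh; exact hcon ⟨S, hS, by omega⟩
  have b2 : η < S'.ncard := by by_contra hh; exact hcon ⟨S', hS'.symm, by omega⟩
  set D : Set V := {v | ReflTransGen (Bi H i j) i v} with hD
  set D' : Set V := {v | ReflTransGen (Bi H j i) j v} with hD'
  have a1 := arcs_ncard (i := i) (j := j) h.anc
  have a2 := arcs_ncard (i := j) (j := i) h.anc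
  rw [← hD] at a1
  rw [← hD'] at a2
  have hdisj : ∀ v, v ∈ D → v ∉ D' := by
    intro v hv hv'
    have hv'' : ReflTransGen (Bi H i j) j v := by rw [bi_swap]; exact hv'
    exact h.nbi (hv.trans (Bi.reach_symm hv''))
  set C : Set V := {v | OnSP R n i j v ∧ v ∉ D ∧ v ∉ D'} with hC
  have hUn : {v | OnSP R n i j v}.ncard ≤ D.ncard + D'.ncard + C.ncard := by
    refine (Set.ncard_le_ncard (t := D ∪ D' ∪ C) ?_).trans
      ((Set.ncard_union_le _ _).trans (Nat.add_le_add_right (Set.ncard_union_le _ _) _))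
    intro v hv
    by_cases h1 : v ∈ D
    · exact Or.inl (Or.inl h1)
    · by_cases h2 : v ∈ D'
      · exact Or.inl (Or.inr h2)
      · exact Or.inr ⟨hv, h1, h2⟩
  have hnb : ∀ v, ∃ p : V × V, v ∈ C → p.1 ≠ p.2 ∧ p.1 ≠ v ∧ p.2 ≠ v ∧ H.Adj v p.1 ∧
      H.Adj v p.2 := by
    intro v
    by_cases hv : v ∈ C
    · obtain ⟨a, b, h1, h2, h3, h4, h5, h6, h7⟩ := hv.1.two_neighbours hR
        (fun e => hv.2.1 (e ▸ ReflTransGen.refl)) (fun e => hv.2.2 (e ▸ ReflTransGen.refl))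
      exact ⟨(a, b), fun _ => ⟨h1, h2, h3, (hadj _ _).2 ⟨hv.1, h4, h6⟩,
        (hadj _ _).2 ⟨hv.1, h5, h7⟩⟩⟩
    · exact ⟨(v, v), fun h => absurd h hv⟩
  choose f hf using hnb
  set F : Set (V × V) := (fun v => (v, (f v).1)) '' C
  set F' : Set (V × V) := (fun v => (v, (f v).2)) '' C
  have cF : F.ncard = C.ncard := Set.ncard_image_of_injective _ fun a b e => (Prod.mk.inj e).1
  have cF' : F'.ncard = C.ncard := Set.ncard_image_of_injective _ fun a b e => (Prod.mk.inj e).1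
  have u1 : (F ∪ F').ncard = F.ncard + F'.ncard := by
    refine Set.ncard_union_eq (Set.disjoint_left.2 ?_)
    rintro _ ⟨v, hv, rfl⟩ ⟨w, hw, e⟩
    simp only [Prod.mk.injEq] at e
    obtain ⟨rfl, e⟩ := e
    exact (hf _ hv).1 e.symm
  have reach : ∀ {i j : V} {p : V × V}, p ∈ Arcs H i j → ReflTransGen (Bi H i j) i p.2 :=
    fun hp => hp.1.tail hp.2
  have u2 : (Arcs H i j ∪ Boundary H i j).ncard = (Arcs H i j).ncard + (Boundary H i j).ncard :=
    Set.ncard_union_eq (Set.disjoint_left.2 fun p h1 h2 => h2.2.1 (reach h1))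
  have u3 : (Arcs H j i ∪ Boundary H j i).ncard = (Arcs H j i).ncard + (Boundary H j i).ncard :=
    Set.ncard_union_eq (Set.disjoint_left.2 fun p h1 h2 => h2.2.1 (reach h1))
  have m1 : ∀ p ∈ Arcs H i j ∪ Boundary H i j, p.1 ∈ D := by
    rintro p (h | h) <;> exact h.1
  have m2 : ∀ p ∈ Arcs H j i ∪ Boundary H j i, p.1 ∈ D' := by
    rintro p (h | h) <;> exact h.1
  have m3 : ∀ p ∈ F ∪ F', p.1 ∈ C := by
    rintro p (⟨v, hv, rfl⟩ | ⟨v, hv, rfl⟩) <;> exact hv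
  have u4 : ((Arcs H i j ∪ Boundary H i j) ∪ (Arcs H j i ∪ Boundary H j i)).ncard =
      (Arcs H i j ∪ Boundary H i j).ncard + (Arcs H j i ∪ Boundary H j i).ncard :=
    Set.ncard_union_eq (Set.disjoint_left.2 fun p h1 h2 => hdisj _ (m1 p h1) (m2 p h2))
  have u5 : (((Arcs H i j ∪ Boundary H i j) ∪ (Arcs H j i ∪ Boundary H j i)) ∪ (F ∪ F')).ncard =
      ((Arcs H i j ∪ Boundary H i j) ∪ (Arcs H j i ∪ Boundary H j i)).ncard + (F ∪ F').ncard := by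
    refine Set.ncard_union_eq (Set.disjoint_left.2 ?_)
    rintro p (h1 | h1) h2
    · exact (m3 p h2).2.1 (m1 p h1)
    · exact (m3 p h2).2.2 (m2 p h1)
  have key : ∀ p ∈ ((Arcs H i j ∪ Boundary H i j) ∪ (Arcs H j i ∪ Boundary H j i)) ∪ (F ∪ F'),
      p.1 ≠ p.2 ∧ H.Adj p.1 p.2 := by
    have kA : ∀ {i j : V} {p : V × V}, p ∈ Arcs H i j ∪ Boundary H i j →
        p.1 ≠ p.2 ∧ H.Adj p.1 p.2 := by
      rintro i j p (hp | hp)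
      · refine ⟨fun e => ?_, hp.2.adj⟩
        exact h.anc.2.1 _ _ hp.2.1 (e ▸ ReflTransGen.refl)
      · exact ⟨fun e => hp.2.1 (e ▸ hp.1), hp.2.2.2.2⟩
    rintro p ((hp | hp) | (⟨v, hv, rfl⟩ | ⟨v, hv, rfl⟩))
    · exact kA hp
    · exact kA hp
    · exact ⟨(hf v hv).2.1.symm, (hf v hv).2.2.2.1⟩
    · exact ⟨(hf v hv).2.2.1.symm, (hf v hv).2.2.2.2⟩
  have up := ncard_pairs_le (E := E) fun p hp => by
    obtain ⟨h1, h2, h3⟩ := (hadj _ _).1 (key p hp).2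
    exact hE _ _ h1 h2 (key p hp).1 h3
  omega

end ShortPath

namespace ShortPath
open Relation
variable {V : Type u} {G : MixedGraph V} {i j v x y : V} {γ η : ℕ}

theorem mem_Vγ : v ∈ G.Vγ γ i j ↔ OnSP G.Adj γ i j v := by
  constructor
  · rintro ⟨P, ⟨h1, h2, h3, h4⟩, h5, hv⟩
    exact ⟨P, ⟨h1, h2, h3, h4, h5⟩, hv⟩
  · rintro ⟨P, ⟨h1, h2, h3, h4, h5⟩, hv⟩
    exact ⟨P, ⟨h1, h2, h3, h4⟩, h5, hv⟩

theorem localGraph_adj : (G.localGraph γ i j).Adj x y ↔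
    OnSP G.Adj γ i j x ∧ OnSP G.Adj γ i j y ∧ G.Adj x y := by
  simp only [← mem_Vγ, MixedGraph.localGraph, MixedGraph.Adj, MixedGraph.induce]
  tauto

theorem Anc.of_induce {A : Set V} (h : (G.induce A).Anc x y) : G.Anc x y :=
  ReflTransGen.mono (r := (G.induce A).dir) (p := G.dir) (fun _ _ h => h.2.2) _ _ h

theorem isAncestral_induce (hG : G.IsAncestral) (A : Set V) : (G.induce A).IsAncestral := by
  refine ⟨fun a b h h' => hG.1 a b h.2.2 (Anc.of_induce h'),
    fun a b h h' => hG.2.1 a b h.2.2 (Anc.of_induce h'), fun a b h c h' => ?_⟩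
  exact hG.2.2 a b h.2.2 c (h'.imp (fun h => h.2.2) fun h => h.2.2)

theorem not_reach_induce (hG : G.IsMAG) (hij : i ≠ j) (hna : ¬ G.Adj i j) (A : Set V) :
    ¬ ReflTransGen (Bi (G.induce A) i j) i j := by
  refine fun h => not_inducing hG hij hna (ReflTransGen.mono (r := Bi (G.induce A) i j) ?_ _ _ h)
  rintro a b ⟨hab, -, hb⟩
  refine ⟨hab.2.2, hb.imp ?_ ?_⟩ <;>
    exact fun h => Anc.of_induce (anc_of_arrow (isAncestral_induce hG.1 A) (Or.inr hab) h)

theorem finite_paths [Finite V] (i j : V) :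
    {π : List V | G.IsPathBetween i j π ∧ π.length ≤ γ + 1}.Finite :=
  (List.finite_length_le V (γ + 1)).subset fun _ h => h.2

theorem pathBound_of_localPathProp [Finite V] (h : G.LocalPathProp η γ) :
    PathBound G.Adj γ η := by
  classical
  intro a b hab hna ls hnd hls
  refine le_trans ?_ (h a b hab hna)
  rw [← List.toFinset_card_of_nodup hnd, ← Set.ncard_coe_finset]
  refine Set.ncard_le_ncard (fun P hP => ?_) (finite_paths a b)
  obtain ⟨h1, h2, h3, h4, h5⟩ := hls P (by simpa using hP)
  exact ⟨⟨h1, h2, h3, h4⟩, h5⟩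

theorem ncard_neighbours_le [Finite V] (h : G.LocalPathProp η γ) (hij : i ≠ j)
    (hna : ¬ G.Adj i j) : {y | y ≠ i ∧ OnSP G.Adj γ i j y ∧ G.Adj i y}.ncard ≤ η := by
  refine le_trans ?_ (h i j hij hna)
  have hex : ∀ y, ∃ q : List V, y ∈ {y | y ≠ i ∧ OnSP G.Adj γ i j y ∧ G.Adj i y} →
      SP G.Adj γ i j (i :: q ++ [j]) ∧ q.head? = some y := by
    intro y
    by_cases hy : y ∈ {y | y ≠ i ∧ OnSP G.Adj γ i j y ∧ G.Adj i y}
    · obtain ⟨q, hq⟩ := exists_first_path (fun _ _ => adj_symm) hij hna hy.2.1 hy.2.2 hy.1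
      exact ⟨q, fun _ => hq⟩
    · exact ⟨[], fun h => absurd h hy⟩
  choose q hq using hex
  refine Set.ncard_le_ncard_of_injOn (fun y => i :: q y ++ [j]) ?_ ?_ (finite_paths i j)
  · intro y hy
    obtain ⟨h1, h2, h3, h4, h5⟩ := (hq y hy).1
    exact ⟨⟨h1, h2, h3, h4⟩, h5⟩
  · intro x hx y hy e
    have e' : q x = q y := by simpa using e
    have := (hq x hx).2
    rw [e', (hq y hy).2] at this
    simpa using this.symm

theorem Hard.branches {R : V → V → Prop} {U : Set V} {H : MixedGraph V}
    (hadj : ∀ x y, H.Adj x y ↔ x ∈ U ∧ y ∈ U ∧ R x y) (h : Hard H i j) : Branches R U i := by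
  obtain ⟨c, hc⟩ := h.ci
  obtain ⟨u, hu, hui, hub⟩ := h.exists_parent
  have h1 := (hadj _ _).1 hc.adj
  have h2 := (hadj _ _).1 (adj_symm (Or.inl hu))
  exact ⟨c, h1.2.1, u, h2.2.1, fun e => hub (e ▸ hc), (h.bi_ne hc).1, hui, h1.2.2, h2.2.2⟩

theorem OnSP.adj_of_short {R : V → V → Prop} {n : ℕ} (hn : n ≤ 2) (hij : i ≠ j) (hna : ¬ R i j)
    (h : OnSP R n i j v) (hi : v ≠ i) (hj : v ≠ j) : R i v := by
  obtain ⟨P, hP, hv⟩ := h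
  obtain ⟨q, -, rfl⟩ := hP.exists_mid hij hna
  have hl := hP.2.2.2.2
  match q with
  | [] => simp at hv; tauto
  | [w] =>
    obtain rfl : v = w := by simp at hv; tauto
    exact (List.isChain_cons_cons.1 hP.2.1).1
  | w :: w' :: q => simp at hl; omega

theorem Hard.exists_cuts [Finite V] (hη : η ≤ 3) (hlp : G.LocalPathProp η γ)
    (hij : i ≠ j) (hna : ¬ G.Adj i j) (h : Hard (G.localGraph γ i j) i j)
    (hdi : {y | y ≠ i ∧ (G.localGraph γ i j).Adj i y}.ncard ≤ η)
    (hdj : {y | y ≠ j ∧ (G.localGraph γ i j).Adj j y}.ncard ≤ η) :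
    ∃ S, Cuts (G.localGraph γ i j) i j S ∧ S.ncard ≤ η := by
  have hR : ∀ a b, G.Adj a b → G.Adj b a := fun _ _ => adj_symm
  have hadj : ∀ x y, (G.localGraph γ i j).Adj x y ↔ x ∈ {v | OnSP G.Adj γ i j v} ∧
    y ∈ {v | OnSP G.Adj γ i j v} ∧ G.Adj x y := fun x y => localGraph_adj
  have hbi := h.branches hadj
  by_cases hγ : γ ≤ 2
  · refine ⟨_, h.cuts_all fun x y hxy => ((hadj x y).1 hxy).1,
      (Set.ncard_le_ncard ?_ (Set.toFinite _)).trans hdi⟩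
    rintro v ⟨hv, hvn⟩
    simp only [Set.mem_insert_iff, Set.mem_singleton_iff, not_or] at hvn
    obtain ⟨c, hc⟩ := h.ci
    exact ⟨hvn.1, (hadj _ _).2 ⟨((hadj _ _).1 hc.adj).1, hv,
      OnSP.adj_of_short hγ hij hna hv hvn.1 hvn.2⟩⟩
  have hstar : ∀ {i j : V} {H : MixedGraph V} {U : Set V}, Hard H i j →
      (∀ x y, H.Adj x y ↔ x ∈ U ∧ y ∈ U ∧ G.Adj x y) → Star G.Adj U i →
      Cuts H i j {y | y ≠ i ∧ H.Adj i y} := by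
    rintro i j H U h hadj ⟨a, b, c, hi, ⟨g1, h1⟩, ⟨g2, h2⟩, ⟨g3, h3⟩⟩
    refine h.cuts_star fun x hx hxi => ?_
    have hm := hi.mem hadj hx hxi
    simp only [List.mem_cons, List.not_mem_nil, or_false] at hm
    rcases hm with rfl | rfl | rfl
    · exact ⟨g1, fun w hw hwx => by simpa using h1.mem hadj hw hwx⟩
    · exact ⟨g2, fun w hw hwx => by simpa using h2.mem hadj hw hwx⟩
    · exact ⟨g3, fun w hw hwx => by simpa using h3.mem hadj hw hwx⟩
  obtain ⟨h2, hf | ht | hs | hs | ⟨h3, hp⟩⟩ := classify hR (by omega) hij hna hη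
    (pathBound_of_localPathProp hlp) hbi (h.symm.branches hadj)
  · exact h.cuts_fewEdges hR hadj hf
  · obtain ⟨S, h1, hS⟩ := h.cuts_twin hadj ht
    exact ⟨S, h1, hS.trans h2⟩
  · exact ⟨_, hstar h hadj hs, hdi⟩
  · exact ⟨_, (hstar h.symm hadj hs).symm, hdj⟩
  · obtain ⟨S, h1, hS⟩ := h.cuts_twoHalves hadj hp
    exact ⟨S, h1, hS.trans h3⟩

end ShortPath

open ShortPath in
/-- For a MAG whose skeleton satisfies the (η,γ)-local path property
with η ≤ 3, every non-adjacent pair admits a γ-local-graph separator of size ≤ η. -/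
theorem stmt5 {V : Type u} [Fintype V] (G : MixedGraph V) (hG : G.IsMAG)
    (η γ : ℕ) (hη : η ≤ 3) (hlp : G.LocalPathProp η γ)
    (i j : V) (hij : i ≠ j) (hadj : ¬ G.Adj i j) :
    ∃ S : Set V, G.IsLocalSep γ i j S ∧ S.ncard ≤ η := by
  have hdi : {y | y ≠ i ∧ (G.localGraph γ i j).Adj i y}.ncard ≤ η :=
    (Set.ncard_le_ncard (t := {y | y ≠ i ∧ OnSP G.Adj γ i j y ∧ G.Adj i y})
      fun y hy => ⟨hy.1, (localGraph_adj.1 hy.2).2⟩).trans (ncard_neighbours_le hlp hij hadj)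
  have hdj : {y | y ≠ j ∧ (G.localGraph γ i j).Adj j y}.ncard ≤ η := by
    refine (Set.ncard_le_ncard fun y hy => ?_).trans
      (ncard_neighbours_le hlp hij.symm fun h => hadj (adj_symm h))
    have := localGraph_adj.1 hy.2
    refine ⟨hy.1, ?_, this.2.2⟩
    have e := onSP_reverse (R := G.Adj) (n := γ) (i := i) (j := j) fun _ _ => adj_symm
    exact e.ge this.2.1
  obtain ⟨S, h1, h2, h3⟩ := exists_sep_of_hard (isAncestral_induce hG.1 (G.Vγ γ i j)) hij
    (fun h => hadj (localGraph_adj.1 h).2.2) (U := G.Vγ γ i j)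
    (fun x y h => mem_Vγ.2 (localGraph_adj.1 h).1) hdi hdj (not_reach_induce hG hij hadj _)
    fun h => h.exists_cuts hη hlp hij hadj hdi hdj
  exact ⟨S, ⟨h1, h2⟩, h3⟩
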